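/- arXiv:2601.13161 — 4 statements merged into one kernel-verified Lean document; each statement's English description precedes it below -/
import Mathlib

section
/- Let Γ be a finite group and (X,T) a free Γ-dynamical system on a compact metric space X. Then dim(X,T) = dim(X)/|Γ|. -/
open MeasureTheory Set
open scoped ENNReal Classical

/-- The order of a finite collection of sets at a point: (number of members containing x) − 1. -/
noncomputable def ordAt {X : Type*} (V : Finset (Set X)) (x : X) : ℝ :=
  ((V.filter fun A => x ∈ A).card : ℝ) - 1

/-- A finite open cover. -/
def IsOpenCover {X : Type*} [TopologicalSpace X] (U : Finset (Set X)) : Prop :=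
  (∀ A ∈ U, IsOpen A) ∧ ⋃₀ (U : Set (Set X)) = Set.univ

/-- `Refines U V` : every element of `V` is contained in some element of `U` (V ⪰ U). -/
def Refines {X : Type*} (U V : Finset (Set X)) : Prop :=
  ∀ B ∈ V, ∃ A ∈ U, B ⊆ A

/-- The set of T-invariant Borel probability measures. -/
def invProb {X Γ : Type*} [TopologicalSpace X] [MeasurableSpace X]
    (T : Γ → X ≃ₜ X) : Set (ProbabilityMeasure X) :=
  {μ | ∀ γ : Γ, (μ : Measure X).map (T γ) = (μ : Measure X)}

/-- The capacity of a Borel set with respect to the action: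
cap(A,T) = sup over invariant μ of μ(A). -/
noncomputable def cap {X Γ : Type*} [TopologicalSpace X] [MeasurableSpace X]
    (T : Γ → X ≃ₜ X) (A : Set X) : ℝ≥0∞ :=
  ⨆ μ ∈ invProb T, (μ : Measure X) A

/-- dim(X,T) = sup over finite open covers U of inf over finite open covers V refining U
of sup over invariant μ of ∫ ord(V,x) dμ(x). -/
noncomputable def dimDyn {X Γ : Type*} [TopologicalSpace X] [MeasurableSpace X]
    (T : Γ → X ≃ₜ X) : ℝ≥0∞ :=
  ⨆ U ∈ {U : Finset (Set X) | IsOpenCover U},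
    ⨅ V ∈ {V : Finset (Set X) | IsOpenCover V ∧ Refines U V},
      ⨆ μ ∈ invProb T, ENNReal.ofReal (∫ x, ordAt V x ∂(μ : Measure X))

/-- The Lebesgue covering dimension of X (as an extended nonnegative real), expressed as
sup over finite open covers U of inf over finite open covers V refining U of
sup over x of ord(V,x). -/
noncomputable def covDimE (X : Type*) [TopologicalSpace X] : ℝ≥0∞ :=
  ⨆ U ∈ {U : Finset (Set X) | IsOpenCover U},
    ⨅ V ∈ {V : Finset (Set X) | IsOpenCover V ∧ Refines U V},
      ⨆ x : X, (((V.filter fun A => x ∈ A).card : ℝ≥0∞) - 1)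

section FiniteCovers

lemma card_filter_mem_image_le {X ι : Type*} [Fintype ι] (w : ι → Set X) (x : X) :
    ((Finset.univ.image w).filter fun A => x ∈ A).card ≤
      (Finset.univ.filter fun i => x ∈ w i).card := by
  rw [Finset.filter_image]
  exact Finset.card_image_le

lemma Refines.trans {X : Type*} {U V W : Finset (Set X)} (h : Refines U V) (h' : Refines V W) :
    Refines U W := fun C hC => by
  obtain ⟨B, hB, hCB⟩ := h' C hC
  obtain ⟨A, hA, hBA⟩ := h B hB
  exact ⟨A, hA, hCB.trans hBA⟩

variable {X : Type*} [TopologicalSpace X]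

lemma isOpenCover_image {ι : Type*} [Fintype ι] {w : ι → Set X} (ho : ∀ i, IsOpen (w i))
    (hc : ∀ x, ∃ i, x ∈ w i) : IsOpenCover (Finset.univ.image w) := by
  refine ⟨by simpa using ho, eq_univ_of_forall fun x => ?_⟩
  obtain ⟨i, hi⟩ := hc x
  exact ⟨w i, by simp, hi⟩

lemma IsOpenCover.exists_mem {V : Finset (Set X)} (hV : IsOpenCover V) (x : X) :
    ∃ A ∈ V, x ∈ A := by
  have : x ∈ ⋃₀ (V : Set (Set X)) := hV.2 ▸ mem_univ x
  simpa using this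

/-- An enumerated partition of unity subordinate to a finite open cover. -/
lemma IsOpenCover.exists_partition [T2Space X] [CompactSpace X] {V : Finset (Set X)}
    (hV : IsOpenCover V) :
    ∃ (N : ℕ) (a : ℕ → Set X) (φ : ℕ → X → ℝ), (∀ i < N, a i ∈ V) ∧ InjOn a (Iio N) ∧
      (∀ i, Continuous (φ i)) ∧ (∀ i x, 0 ≤ φ i x) ∧ (∀ i < N, ∀ x, φ i x ≠ 0 → x ∈ a i) ∧
      ∀ x, ∑ i ∈ Finset.range N, φ i x = 1 := by
  let e := V.equivFin
  obtain ⟨f, hf⟩ := PartitionOfUnity.exists_isSubordinate (s := (univ : Set X)) isClosed_univ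
    (fun i : Fin V.card => ((e.symm i : V) : Set X)) (fun i => hV.1 _ (e.symm i).2) (by
      intro x _
      obtain ⟨A, hA, hx⟩ := hV.exists_mem x
      exact mem_iUnion.2 ⟨e ⟨A, hA⟩, by simpa using hx⟩)
  refine ⟨V.card, fun i => if h : i < V.card then (e.symm ⟨i, h⟩ : V) else ∅,
    fun i => if h : i < V.card then f ⟨i, h⟩ else 0, ?_, ?_, ?_, ?_, ?_, ?_⟩
  · intro i hi
    simp [hi]
  · intro i hi j hj hij
    have hi' : i < V.card := hi
    have hj' : j < V.card := hj
    simp only [hi', hj', dif_pos] at hij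
    simpa using e.symm.injective (Subtype.ext hij)
  · intro i
    by_cases h : i < V.card
    · simpa [h] using (f ⟨i, h⟩).continuous
    · simpa [h] using continuous_zero
  · intro i x
    by_cases h : i < V.card
    · simpa [h] using f.nonneg ⟨i, h⟩ x
    · simp [h]
  · intro i hi x hx
    simp only [hi, dif_pos] at hx ⊢
    exact hf _ (subset_tsupport _ hx)
  · intro x
    have := f.sum_eq_one (mem_univ x)
    rw [finsum_eq_sum_of_fintype] at this
    rw [Finset.sum_range, ← this]
    simp

/-- A finite open cover together with its translates has a common refinement whose order is at
most the sum of the orders of the translates. The members of the refinement correspond to the cells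
of the staircase triangulation of a product of simplices. -/
lemma IsOpenCover.exists_refines_ordAt_le_sum [T2Space X] [CompactSpace X]
    {Γ : Type*} [Fintype Γ] {V : Finset (Set X)}
    (hV : IsOpenCover V) (T : Γ → X → X) (hc : ∀ γ, Continuous (T γ)) (e : Γ)
    (he : ∀ x, T e x = x) :
    ∃ W, IsOpenCover W ∧ Refines V W ∧ ∀ x, ordAt W x ≤ ∑ γ, ordAt V (T γ x) := by
  obtain ⟨N, a, φ, haV, hinj, hφc, hφ0, hφa, hφ1⟩ := hV.exists_partition
  set F : ℕ → X → ℝ := fun k x => ∑ j ∈ Finset.range k, φ j x with hF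
  have hFc : ∀ k, Continuous (F k) := fun k => continuous_finsetSum _ fun j _ => hφc j
  have hFs : ∀ k x, F (k + 1) x = F k x + φ k x := fun k x => Finset.sum_range_succ _ _
  have hFm : ∀ x, Monotone fun k => F k x := fun x => monotone_nat_of_le_succ fun k => by
    rw [hFs]; linarith [hφ0 k x]
  have hF0 : ∀ x, F 0 x = 0 := fun x => by simp [hF]
  have hFN : ∀ x, F N x = 1 := hφ1
  let w : (Γ → Fin N) → Set X := fun i =>
    {x | ∃ t, ∀ γ, F (i γ) (T γ x) < t ∧ t < F (i γ + 1) (T γ x)}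
  refine ⟨Finset.univ.image w, isOpenCover_image ?_ ?_, ?_, ?_⟩
  · intro i
    have : w i = ⋃ t, ⋂ γ, {x | F (i γ) (T γ x) < t ∧ t < F (i γ + 1) (T γ x)} := by
      ext x; simp [w]
    rw [this]
    refine isOpen_iUnion fun t => isOpen_iInter_of_finite fun γ => ?_
    exact (isOpen_lt ((hFc _).comp (hc γ)) continuous_const).inter
      (isOpen_lt continuous_const ((hFc _).comp (hc γ)))
  · intro x
    obtain ⟨t, ht, htB⟩ := (Set.Ioo_infinite (zero_lt_one' ℝ)).exists_notMem_finset
      ((Finset.univ ×ˢ Finset.range (N + 1)).image fun p : Γ × ℕ => F p.2 (T p.1 x))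
    have key : ∀ γ, ∃ k : Fin N, F k (T γ x) < t ∧ t < F (k + 1) (T γ x) := by
      intro γ
      have hex : ∃ k, t < F k (T γ x) := ⟨N, by rw [hFN]; exact ht.2⟩
      have hm := Nat.find_spec hex
      have hN : Nat.find hex ≤ N := Nat.find_min' hex (by rw [hFN]; exact ht.2)
      rcases hk : Nat.find hex with _ | k
      · rw [hk, hF0] at hm
        exact absurd ht.1 (by linarith)
      · rw [hk] at hm hN
        refine ⟨⟨k, hN⟩, lt_of_le_of_ne ?_ ?_, hm⟩
        · exact not_lt.1 (Nat.find_min hex (by omega : k < Nat.find hex))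
        · rintro h
          exact htB (Finset.mem_image.2 ⟨(γ, k), by simp; omega, h⟩)
    choose i hi using key
    exact ⟨i, t, hi⟩
  · intro B hB
    obtain ⟨i, -, rfl⟩ := Finset.mem_image.1 hB
    refine ⟨a (i e), haV _ (i e).2, ?_⟩
    rintro x ⟨t, ht⟩
    have h := ht e
    rw [he, hFs] at h
    exact hφa _ (i e).2 _ (by linarith [h.1, h.2] : (0:ℝ) < φ (i e) x).ne'
  · intro x
    let K : Γ → Finset ℕ := fun γ => (Finset.range N).filter fun k => φ k (T γ x) ≠ 0
    let R : Γ → Finset ℝ := fun γ => (K γ).image fun k => F (k + 1) (T γ x)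
    have hR1 : ∀ γ, (1 : ℝ) ∈ R γ := by
      intro γ
      have hex : ∃ k, F k (T γ x) = 1 := ⟨N, hFN _⟩
      have hm := Nat.find_spec hex
      have hN : Nat.find hex ≤ N := Nat.find_min' hex (hFN _)
      rcases hk : Nat.find hex with _ | k
      · rw [hk, hF0] at hm
        exact absurd hm (by norm_num)
      · rw [hk] at hm hN
        refine Finset.mem_image.2 ⟨k, Finset.mem_filter.2 ⟨by simp; omega, fun h => ?_⟩, hm⟩
        rw [hFs, h, add_zero] at hm
        exact Nat.find_min hex (by omega : k < Nat.find hex) hm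
    have hRcard : ∀ γ, (((R γ).erase 1).card : ℝ) ≤ ordAt V (T γ x) := by
      intro γ
      have h1 : (K γ).card ≤ (V.filter fun A => T γ x ∈ A).card := by
        refine Finset.card_le_card_of_injOn a ?_ ?_
        · intro k hk
          have hk' := Finset.mem_filter.1 hk
          have hkN := Finset.mem_range.1 hk'.1
          exact Finset.mem_coe.2 (Finset.mem_filter.2 ⟨haV _ hkN, hφa _ hkN _ hk'.2⟩)
        · refine hinj.mono fun k hk => ?_
          exact Finset.mem_range.1 (Finset.mem_filter.1 hk).1
      have h2 : (R γ).card ≤ (K γ).card := Finset.card_image_le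
      have h3 := Finset.card_erase_add_one (hR1 γ)
      have h4 : ((R γ).erase 1).card + 1 ≤ (V.filter fun A => T γ x ∈ A).card := by omega
      have h5 : (((R γ).erase 1).card : ℝ) + 1 ≤ (V.filter fun A => T γ x ∈ A).card := by
        exact_mod_cast h4
      rw [ordAt]
      linarith
    have : Nonempty Γ := ⟨e⟩
    let m : (Γ → Fin N) → ℝ := fun i =>
      Finset.univ.inf' Finset.univ_nonempty fun γ => F (i γ + 1) (T γ x)
    have hcard : (Finset.univ.filter fun i => x ∈ w i).card ≤
        (insert 1 (Finset.univ.biUnion fun γ => (R γ).erase 1)).card := by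
      refine Finset.card_le_card_of_injOn m ?_ ?_
      · intro i hi
        have hi' : x ∈ w i := by simpa using hi
        obtain ⟨t, ht⟩ := hi'
        obtain ⟨γ, -, hγ⟩ := Finset.exists_mem_eq_inf' (s := (Finset.univ : Finset Γ))
          Finset.univ_nonempty fun γ => F (i γ + 1) (T γ x)
        by_cases h1 : m i = 1
        · simp [h1]
        · refine Finset.mem_coe.2 (Finset.mem_insert_of_mem ?_)
          refine Finset.mem_biUnion.2 ⟨γ, Finset.mem_univ _, Finset.mem_erase.2 ⟨h1, ?_⟩⟩
          refine Finset.mem_image.2 ⟨i γ, Finset.mem_filter.2 ⟨by simp, fun h => ?_⟩, hγ.symm⟩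
          have := ht γ
          rw [hFs, h] at this
          linarith [this.1, this.2]
      · intro i hi j hj hij
        obtain ⟨s, hs⟩ : x ∈ w i := by simpa using hi
        obtain ⟨t, ht⟩ : x ∈ w j := by simpa using hj
        have hsm : s < m i := (Finset.lt_inf'_iff _).2 fun γ _ => (hs γ).2
        have htm : t < m j := (Finset.lt_inf'_iff _).2 fun γ _ => (ht γ).2
        have hmi : ∀ γ, m i ≤ F (i γ + 1) (T γ x) := fun γ =>
          Finset.inf'_le _ (Finset.mem_univ γ)
        have hmj : ∀ γ, m j ≤ F (j γ + 1) (T γ x) := fun γ =>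
          Finset.inf'_le _ (Finset.mem_univ γ)
        funext γ
        by_contra hne
        rcases lt_or_gt_of_ne hne with hlt | hlt
        · have := hFm (T γ x) (show (i γ : ℕ) + 1 ≤ j γ from hlt)
          simp only at this
          linarith [hmi γ, (ht γ).1]
        · have := hFm (T γ x) (show (j γ : ℕ) + 1 ≤ i γ from hlt)
          simp only at this
          linarith [hmj γ, (hs γ).1]
    have h1 := (card_filter_mem_image_le w x).trans (hcard.trans (Finset.card_insert_le _ _))
    have h2 := h1.trans (Nat.add_le_add_right Finset.card_biUnion_le 1)
    have h3 : (((Finset.univ.image w).filter fun A => x ∈ A).card : ℝ) ≤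
        ∑ γ, (((R γ).erase 1).card : ℝ) + 1 := by exact_mod_cast h2
    have h4 := Finset.sum_le_sum fun γ (_ : γ ∈ Finset.univ) => hRcard γ
    rw [ordAt]
    linarith

end FiniteCovers

section GeneralPosition

/-- A finite family of vectors can be perturbed into linear general position. -/
lemma exists_near_linearIndepOn {ι E : Type*} [NormedAddCommGroup E] [NormedSpace ℝ E]
    [FiniteDimensional ℝ E] (W : Finset ι) (c : ι → E) {ε : ℝ} (hε : 0 < ε) :
    ∃ v : ι → E, (∀ i, ‖v i - c i‖ < ε) ∧
      ∀ s ⊆ W, s.card ≤ Module.finrank ℝ E → LinearIndepOn ℝ v (s : Set ι) := by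
  induction W using Finset.induction_on with
  | empty =>
    refine ⟨c, fun i => by simpa using hε, fun s hs _ => ?_⟩
    rw [Finset.subset_empty.1 hs]
    simp
  | insert a W ha ih =>
    obtain ⟨v, hv, hind⟩ := ih
    let P : Finset (Finset ι) := W.powerset.filter fun s => s.card < Module.finrank ℝ E
    have hlt : ∀ s ∈ P, Submodule.span ℝ (v '' (s : Set ι)) ≠ ⊤ := by
      intro s hs h
      have h1 := finrank_span_finset_le_card (R := ℝ) (s.image v)
      rw [Set.finrank, Finset.coe_image, h, finrank_top] at h1
      have h2 : s.card < Module.finrank ℝ E := (Finset.mem_filter.1 hs).2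
      have h3 : (s.image v).card ≤ s.card := Finset.card_image_le
      omega
    have hd : Dense (⋂ s ∈ (P : Set (Finset ι)),
        ((Submodule.span ℝ (v '' (s : Set ι)) : Set E))ᶜ) := by
      refine dense_biInter_of_isOpen (fun s _ => ?_) P.countable_toSet fun s hs => ?_
      · exact (Submodule.closed_of_finiteDimensional _).isOpen_compl
      · rw [← interior_eq_empty_iff_dense_compl, ← not_nonempty_iff_eq_empty]
        exact fun h => hlt s hs (Submodule.eq_top_of_nonempty_interior' _ h)
    obtain ⟨y, hy, hyc⟩ := hd.exists_dist_lt (c a) hε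
    simp only [mem_iInter, mem_compl_iff, SetLike.mem_coe] at hy
    have hvv : ∀ i ∈ W, Function.update v a y i = v i := fun i hi =>
      Function.update_of_ne (by rintro rfl; exact ha hi) _ _
    refine ⟨Function.update v a y, fun i => ?_, fun s hs hcard => ?_⟩
    · by_cases h : i = a
      · subst h
        rw [Function.update_self, ← dist_eq_norm, dist_comm]
        exact hyc
      · rw [Function.update_of_ne h]
        exact hv i
    · have hcongr : ∀ t ⊆ W, EqOn v (Function.update v a y) (t : Set ι) :=
        fun t ht i hi => (hvv i (ht hi)).symm
      by_cases has : a ∈ s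
      · have hsW : s.erase a ⊆ W := Finset.subset_insert_iff.1 hs
        have hc := Finset.card_erase_add_one has
        rw [← Finset.insert_erase has, Finset.coe_insert, linearIndepOn_insert (by simp)]
        refine ⟨(linearIndepOn_congr (hcongr _ hsW)).1 (hind _ hsW (by omega)), ?_⟩
        rw [Function.update_self, ← (hcongr _ hsW).image_eq]
        exact hy _ (Finset.mem_filter.2 ⟨Finset.mem_powerset.2 hsW, by omega⟩)
      · have hsW : s ⊆ W := (Finset.subset_insert_iff_of_notMem has).1 hs
        exact (linearIndepOn_congr (hcongr _ hsW)).1 (hind _ hsW hcard)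

variable {X : Type*} [TopologicalSpace X] [T2Space X] [CompactSpace X]

/-- On a compact space of covering dimension less than `dim E`, every `E`-valued map is uniformly
close to a nowhere vanishing one. -/
lemma exists_near_ne_zero {E : Type*} [NormedAddCommGroup E] [NormedSpace ℝ E]
    [FiniteDimensional ℝ E]
    (hd : ∀ U : Finset (Set X), IsOpenCover U → ∃ V, IsOpenCover V ∧ Refines U V ∧
      ∀ x, (V.filter fun A => x ∈ A).card ≤ Module.finrank ℝ E)
    {F : X → E} (hF : Continuous F) {ε : ℝ} (hε : 0 < ε) :
    ∃ G : X → E, Continuous G ∧ ∀ x, ‖G x - F x‖ < ε ∧ G x ≠ 0 := by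
  obtain ⟨t, ht⟩ := (isCompact_univ (X := X)).elim_finite_subcover
    (fun x => F ⁻¹' Metric.ball (F x) (ε / 4)) (fun x => Metric.isOpen_ball.preimage hF)
    fun x _ => mem_iUnion.2 ⟨x, Metric.mem_ball_self (by positivity)⟩
  obtain ⟨V, hV, hUV, hcard⟩ := hd
    (Finset.univ.image fun x : t => F ⁻¹' Metric.ball (F x) (ε / 4))
    (isOpenCover_image (fun x => Metric.isOpen_ball.preimage hF) fun x => by
      obtain ⟨y, hy, hxy⟩ := mem_iUnion₂.1 (ht (mem_univ x))
      exact ⟨⟨y, hy⟩, hxy⟩)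
  obtain ⟨N, a, φ, haV, hinj, hφc, hφ0, hφa, hφ1⟩ := hV.exists_partition
  have hex : ∀ i, ∃ c : E, i < N → ∀ x ∈ a i, ‖F x - c‖ < ε / 4 := by
    intro i
    by_cases hi : i < N
    · obtain ⟨A, hA, hsub⟩ := hUV _ (haV i hi)
      obtain ⟨y, -, rfl⟩ := Finset.mem_image.1 hA
      exact ⟨F y, fun _ x hx => by simpa [dist_eq_norm] using hsub hx⟩
    · exact ⟨0, fun h => absurd h hi⟩
  choose c hc using hex
  obtain ⟨v, hv, hind⟩ := exists_near_linearIndepOn (Finset.range N) c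
    (show 0 < ε / 4 by positivity)
  refine ⟨fun x => ∑ i ∈ Finset.range N, φ i x • v i,
    continuous_finsetSum _ fun i _ => (hφc i).smul continuous_const, fun x => ⟨?_, fun h0 => ?_⟩⟩
  · have h1 : ∑ i ∈ Finset.range N, φ i x • v i - F x
        = ∑ i ∈ Finset.range N, φ i x • (v i - F x) := by
      simp_rw [smul_sub, Finset.sum_sub_distrib, ← Finset.sum_smul, hφ1, one_smul]
    have h2 : ∀ i ∈ Finset.range N, ‖φ i x • (v i - F x)‖ ≤ φ i x * (ε / 2) := by
      intro i hi
      rw [norm_smul, Real.norm_of_nonneg (hφ0 i x)]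
      by_cases h : φ i x = 0
      · simp [h]
      · have hiN := Finset.mem_range.1 hi
        have h3 := hc i hiN x (hφa i hiN x h)
        have h4 : ‖v i - F x‖ ≤ ‖v i - c i‖ + ‖F x - c i‖ := by
          rw [norm_sub_rev (F x)]
          exact norm_sub_le_norm_sub_add_norm_sub _ _ _
        exact mul_le_mul_of_nonneg_left (by linarith [hv i]) (hφ0 i x)
    calc _ = ‖∑ i ∈ Finset.range N, φ i x • (v i - F x)‖ := by rw [← h1]
      _ ≤ ∑ i ∈ Finset.range N, φ i x * (ε / 2) :=
        (norm_sum_le _ _).trans (Finset.sum_le_sum h2)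
      _ = ε / 2 := by rw [← Finset.sum_mul, hφ1, one_mul]
      _ < ε := by linarith
  · let s := (Finset.range N).filter fun i => φ i x ≠ 0
    have hs : s.card ≤ Module.finrank ℝ E := by
      refine le_trans (Finset.card_le_card_of_injOn a ?_ ?_) (hcard x)
      · intro i hi
        have hi' := Finset.mem_filter.1 hi
        have hiN := Finset.mem_range.1 hi'.1
        exact Finset.mem_coe.2 (Finset.mem_filter.2 ⟨haV _ hiN, hφa _ hiN _ hi'.2⟩)
      · exact hinj.mono fun i hi => Finset.mem_range.1 (Finset.mem_filter.1 hi).1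
    have h1 := linearIndepOn_finset_iff.1 (hind s (Finset.filter_subset _ _) hs)
      (fun i => φ i x) (by
        rw [← h0]
        refine Finset.sum_filter_of_ne fun i _ hi h => hi ?_
        rw [h, zero_smul])
    have h2 : ∑ i ∈ Finset.range N, φ i x = 0 := Finset.sum_eq_zero fun i hi => by
      by_contra h
      exact h (h1 i (Finset.mem_filter.2 ⟨hi, h⟩))
    rw [hφ1] at h2
    exact one_ne_zero h2

end GeneralPosition

section FreeAction

lemma action_one {X Γ : Type*} [TopologicalSpace X] [Group Γ] {T : Γ → X ≃ₜ X}
    (hT : ∀ γ γ' : Γ, ∀ x : X, T (γ * γ') x = T γ (T γ' x)) (x : X) : T 1 x = x :=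
  (T 1).injective (by rw [← hT, one_mul])

variable {X Γ : Type*} [MetricSpace X] [CompactSpace X]

/-- Tuples of functions whose values along orbits, on a set `K`, do not all become small
simultaneously for a family `S` of group elements and indices. -/
def jointlyNonvanishing {I : Type*} (T : Γ → X ≃ₜ X) (K : Set X) (S : Finset (Γ × I)) :
    Set (I → ContinuousMap X ℝ) :=
  {g | ∃ δ > 0, ∀ x ∈ K, ∃ p ∈ S, δ ≤ |g p.2 (T p.1 x)|}

lemma isOpen_jointlyNonvanishing {I : Type*} [Fintype I] (T : Γ → X ≃ₜ X) (K : Set X)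
    (S : Finset (Γ × I)) : IsOpen (jointlyNonvanishing T K S) := by
  refine Metric.isOpen_iff.2 fun g hg => ?_
  obtain ⟨δ, hδ, h⟩ := hg
  refine ⟨δ / 2, by positivity, fun k hk => ⟨δ / 2, by positivity, fun x hx => ?_⟩⟩
  obtain ⟨p, hp, hpx⟩ := h x hx
  refine ⟨p, hp, ?_⟩
  have h1 : dist (k p.2 (T p.1 x)) (g p.2 (T p.1 x)) < δ / 2 :=
    ((ContinuousMap.dist_apply_le_dist _).trans (dist_le_pi_dist k g p.2)).trans_lt hk
  rw [dist_comm, Real.dist_eq] at h1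
  linarith [abs_sub_abs_le_abs_sub (g p.2 (T p.1 x)) (k p.2 (T p.1 x))]

variable [Group Γ]

lemma exists_displacement [Finite Γ] {T : Γ → X ≃ₜ X}
    (hT : ∀ γ γ' : Γ, ∀ x : X, T (γ * γ') x = T γ (T γ' x))
    (hfree : ∀ x : X, ∀ γ γ' : Γ, T γ x = T γ' x → γ = γ') :
    ∃ η > 0, ∀ γ ≠ 1, ∀ x, η ≤ dist x (T γ x) := by
  have h : ∀ γ : Γ, ∃ η : ℝ, 0 < η ∧ (γ ≠ 1 → ∀ x, η ≤ dist x (T γ x)) := by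
    intro γ
    by_cases hγ : γ = 1
    · exact ⟨1, one_pos, fun h => absurd hγ h⟩
    · obtain ⟨η, hη, hle⟩ := (isCompact_univ (X := X)).exists_forall_le'
        (continuous_id.dist (T γ).continuous).continuousOn (a := (0 : ℝ))
        (fun x _ => dist_pos.2 fun hx => hγ (hfree x γ 1 (by rw [action_one hT]; exact hx.symm)))
      exact ⟨η, hη, fun _ x => hle x (mem_univ x)⟩
  choose η hη hle using h
  obtain ⟨r, hr, hr0⟩ := ((Filter.eventually_all.2 fun γ =>
    nhdsWithin_le_nhds (Iic_mem_nhds (hη γ))).and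
      (self_mem_nhdsWithin : Ioi (0 : ℝ) ∈ nhdsWithin 0 (Ioi 0))).exists
  exact ⟨r, hr0, fun γ hγ x => (hr γ).trans (hle γ hγ x)⟩

lemma dense_jointlyNonvanishing {I : Type*} [Fintype I] {T : Γ → X ≃ₜ X}
    (hT : ∀ γ γ' : Γ, ∀ x : X, T (γ * γ') x = T γ (T γ' x))
    {η : ℝ} (hη : 0 < η) (hdisp : ∀ γ ≠ 1, ∀ x, η ≤ dist x (T γ x)) (S : Finset (Γ × I))
    (hd : ∀ U : Finset (Set X), IsOpenCover U → ∃ V, IsOpenCover V ∧ Refines U V ∧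
      ∀ x, (V.filter fun A => x ∈ A).card ≤ S.card) (x₀ : X) :
    Dense (jointlyNonvanishing T (Metric.closedBall x₀ (η / 4)) S) := by
  refine Metric.dense_iff.2 fun f ε hε => ?_
  obtain ⟨χ, hχ0, hχ1, hχ⟩ := exists_continuous_zero_one_of_isClosed
    (Metric.isOpen_ball (x := x₀) (ε := η / 2)).isClosed_compl
    (Metric.isClosed_closedBall (x := x₀) (ε := η / 4))
    (disjoint_compl_left_iff_subset.2 (Metric.closedBall_subset_ball (by linarith)))
  have hχK : ∀ x ∈ Metric.closedBall x₀ (η / 4), ∀ γ ≠ 1, χ (T γ x) = 0 := by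
    intro x hx γ hγ
    refine hχ0 fun hb => ?_
    have h1 := hdisp γ hγ x
    have h2 := dist_triangle_right x (T γ x) x₀
    have h3 := Metric.mem_closedBall.1 hx
    have h4 := Metric.mem_ball.1 hb
    linarith
  let F : X → (S → ℝ) := fun x p => f p.1.2 (T p.1.1 x)
  have hF : Continuous F := continuous_pi fun p => (f p.1.2).continuous.comp (T p.1.1).continuous
  obtain ⟨G, hG, hGF⟩ := exists_near_ne_zero (by simpa using hd) hF
    (show 0 < ε / (S.card + 1) by positivity)
  let e : S → ContinuousMap X ℝ := fun q =>
    ⟨fun y => χ (T q.1.1⁻¹ y) * (G (T q.1.1⁻¹ y) q - F (T q.1.1⁻¹ y) q), by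
      have h1 := (T q.1.1⁻¹).continuous
      have h2 := (continuous_apply q).comp (hG.comp h1)
      have h3 := (continuous_apply q).comp (hF.comp h1)
      exact (χ.continuous.comp h1).mul (h2.sub h3)⟩
  have he : ∀ q y, |e q y| ≤ ε / (S.card + 1) := by
    intro q y
    have h1 := hχ (T q.1.1⁻¹ y)
    have h2 := norm_le_pi_norm (G (T q.1.1⁻¹ y) - F (T q.1.1⁻¹ y)) q
    have h3 := (hGF (T q.1.1⁻¹ y)).1
    rw [Real.norm_eq_abs, Pi.sub_apply] at h2
    change |χ (T q.1.1⁻¹ y) * (G (T q.1.1⁻¹ y) q - F (T q.1.1⁻¹ y) q)| ≤ _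
    rw [abs_mul, abs_of_nonneg h1.1]
    exact (mul_le_of_le_one_left (abs_nonneg _) h1.2).trans (h2.trans h3.le)
  let g : I → ContinuousMap X ℝ := fun i => f i + ∑ q with q.1.2 = i, e q
  have hgG : ∀ x ∈ Metric.closedBall x₀ (η / 4), ∀ p : S, g p.1.2 (T p.1.1 x) = G x p := by
    intro x hx p
    have hinv : T p.1.1⁻¹ (T p.1.1 x) = x := by
      rw [← hT, inv_mul_cancel, action_one hT]
    have hsum : ∑ q with q.1.2 = p.1.2, e q (T p.1.1 x) = e p (T p.1.1 x) := by
      refine Finset.sum_eq_single p (fun q hq hqp => ?_) fun h => absurd (by simp) h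
      have hne : q.1.1⁻¹ * p.1.1 ≠ 1 := fun h => hqp
        (Subtype.ext (Prod.ext (inv_mul_eq_one.1 h) (Finset.mem_filter.1 hq).2))
      change χ (T q.1.1⁻¹ (T p.1.1 x)) * _ = 0
      rw [← hT, hχK x hx _ hne, zero_mul]
    have hep : e p (T p.1.1 x) = G x p - F x p := by
      change χ (T p.1.1⁻¹ (T p.1.1 x)) * _ = _
      rw [hinv, hχ1 hx, Pi.one_apply, one_mul]
    simp only [g, ContinuousMap.add_apply, ContinuousMap.sum_apply, hsum, hep, F]
    ring
  refine ⟨g, ?_, ?_⟩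
  · rw [Metric.mem_ball, dist_pi_lt_iff hε]
    intro i
    rw [ContinuousMap.dist_lt_iff hε]
    intro y
    have h1 : dist (g i y) (f i y) = |∑ q with q.1.2 = i, e q y| := by
      simp [g, ContinuousMap.sum_apply]
    rw [h1]
    have hpos : 0 < ε / (S.card + 1) := by positivity
    calc |∑ q with q.1.2 = i, e q y| ≤ ∑ q with q.1.2 = i, |e q y| :=
        Finset.abs_sum_le_sum_abs _ _
      _ ≤ ∑ q : S, |e q y| := Finset.sum_le_sum_of_subset_of_nonneg (Finset.filter_subset _ _)
        fun _ _ _ => abs_nonneg _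
      _ ≤ ∑ _q : S, ε / (S.card + 1) := Finset.sum_le_sum fun q _ => he q y
      _ = S.card * (ε / (S.card + 1)) := by simp
      _ < (S.card + 1) * (ε / (S.card + 1)) := by nlinarith
      _ = ε := by field_simp
  · obtain ⟨δ, hδ, hle⟩ := (isCompact_closedBall x₀ (η / 4)).exists_forall_le'
      hG.norm.continuousOn (a := (0 : ℝ)) fun x _ => norm_pos_iff.2 (hGF x).2
    refine ⟨δ, hδ, fun x hx => ?_⟩
    by_contra! hcon
    refine (hle x hx).not_gt ((pi_norm_lt_iff hδ).2 fun p => ?_)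
    rw [← hgG x hx p]
    exact hcon p.1 p.2

/-- On a compact space of dimension at most `d` with a free action of a finite group, a finite
family of functions can be perturbed so that along each orbit at most `d` of its values are
near zero. -/
lemma exists_near_orbit_general_position [Fintype Γ] {I : Type*} [Fintype I] {T : Γ → X ≃ₜ X}
    (hT : ∀ γ γ' : Γ, ∀ x : X, T (γ * γ') x = T γ (T γ' x))
    (hfree : ∀ x : X, ∀ γ γ' : Γ, T γ x = T γ' x → γ = γ') {d : ℕ}
    (hd : ∀ U : Finset (Set X), IsOpenCover U → ∃ V, IsOpenCover V ∧ Refines U V ∧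
      ∀ x, (V.filter fun A => x ∈ A).card ≤ d + 1)
    (f : I → ContinuousMap X ℝ) {ε : ℝ} (hε : 0 < ε) :
    ∃ g : I → ContinuousMap X ℝ, (∀ i x, |g i x - f i x| < ε) ∧
      ∃ δ > 0, ∀ x, (Finset.univ.filter fun p : Γ × I => |g p.2 (T p.1 x)| < δ).card ≤ d := by
  obtain ⟨η, hη, hdisp⟩ := exists_displacement hT hfree
  obtain ⟨t, -, htfin, htc⟩ := finite_cover_balls_of_compact (isCompact_univ (X := X))
    (show 0 < η / 4 by positivity)
  have := htfin.to_subtype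
  obtain ⟨g, hg, hgf⟩ := (dense_iInter_of_isOpen
    (f := fun q : t × {S : Finset (Γ × I) // S.card = d + 1} =>
      jointlyNonvanishing T (Metric.closedBall q.1 (η / 4)) q.2.1)
    (fun q => isOpen_jointlyNonvanishing _ _ _)
    (fun q => dense_jointlyNonvanishing hT hη hdisp _ (by rwa [q.2.2]) _)).exists_dist_lt f hε
  rw [mem_iInter] at hg
  choose δ hδ hle using hg
  obtain ⟨r, hr, hr0⟩ := ((Filter.eventually_all.2 fun q =>
    nhdsWithin_le_nhds (Iic_mem_nhds (hδ q))).and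
      (self_mem_nhdsWithin : Ioi (0 : ℝ) ∈ nhdsWithin 0 (Ioi 0))).exists
  refine ⟨g, fun i x => ?_, r, hr0, fun x => ?_⟩
  · rw [abs_sub_comm, ← Real.dist_eq]
    exact ((ContinuousMap.dist_apply_le_dist _).trans (dist_le_pi_dist f g i)).trans_lt hgf
  · by_contra! hcon
    obtain ⟨S, hS, hcard⟩ := Finset.exists_subset_card_eq (Nat.succ_le_of_lt hcon)
    obtain ⟨y, hy, hxy⟩ := mem_iUnion₂.1 (htc (mem_univ x))
    obtain ⟨p, hp, hpx⟩ := hle (⟨y, hy⟩, ⟨S, hcard⟩) x (Metric.ball_subset_closedBall hxy)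
    have h1 := (Finset.mem_filter.1 (hS hp)).2
    exact absurd h1 (not_lt.2 ((hr _).trans hpx))

/-- On a compact space of dimension at most `d` with a free action of a finite group, every finite
open cover has a refinement whose orders sum to at most `d` along each orbit. -/
lemma IsOpenCover.exists_refines_sum_ordAt_le [Fintype Γ] {T : Γ → X ≃ₜ X}
    (hT : ∀ γ γ' : Γ, ∀ x : X, T (γ * γ') x = T γ (T γ' x))
    (hfree : ∀ x : X, ∀ γ γ' : Γ, T γ x = T γ' x → γ = γ') {d : ℕ}
    (hd : ∀ U : Finset (Set X), IsOpenCover U → ∃ V, IsOpenCover V ∧ Refines U V ∧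
      ∀ x, (V.filter fun A => x ∈ A).card ≤ d + 1)
    {U : Finset (Set X)} (hU : IsOpenCover U) :
    ∃ V, IsOpenCover V ∧ Refines U V ∧ ∀ x, ∑ γ, ordAt V (T γ x) ≤ d := by
  obtain ⟨N, a, φ, haU, -, hφc, hφ0, hφa, hφ1⟩ := hU.exists_partition
  set ε : ℝ := 1 / (4 * (N + 1)) with hε
  have hε0 : 0 < ε := by positivity
  have hNε : (N : ℝ) * (4 * ε) < 1 := by
    rw [hε]
    field_simp
    linarith
  obtain ⟨g, hgf, δ', hδ', hcard'⟩ := exists_near_orbit_general_position hT hfree hd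
    (fun i : Fin N => (⟨fun x => φ i x - 2 * ε, (hφc i).sub continuous_const⟩ :
      ContinuousMap X ℝ)) hε0
  let δ := min δ' ε
  have hδ : 0 < δ := lt_min hδ' hε0
  have hcard : ∀ x,
      (Finset.univ.filter fun p : Γ × Fin N => |g p.2 (T p.1 x)| < δ).card ≤ d := fun x =>
    (Finset.card_le_card fun p hp => by
      simp only [Finset.mem_filter, Finset.mem_univ, true_and] at hp ⊢
      exact hp.trans_le (min_le_left _ _)).trans (hcard' x)
  let w : Fin N → Set X := fun i => {x | -δ < g i x ∧ ∀ j < i, g j x < δ}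
  have hord : ∀ x, ordAt (Finset.univ.image w) x ≤
      ((Finset.univ.filter fun i => |g i x| < δ).card : ℝ) := by
    intro x
    have h1 : (Finset.univ.filter fun i => x ∈ w i).card ≤
        (Finset.univ.filter fun i => |g i x| < δ).card + 1 := by
      rcases (Finset.univ.filter fun i => x ∈ w i).eq_empty_or_nonempty with h | h
      · rw [h]
        simp
      · rw [← Finset.card_erase_add_one (Finset.max'_mem _ h)]
        refine Nat.add_le_add_right (Finset.card_le_card fun i hi => ?_) 1
        have hlt := Finset.lt_max'_of_mem_erase_max' _ h hi
        have hmax := (Finset.mem_filter.1 (Finset.max'_mem _ h)).2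
        have hiw := (Finset.mem_filter.1 (Finset.mem_of_mem_erase hi)).2
        exact Finset.mem_filter.2 ⟨Finset.mem_univ _, abs_lt.2 ⟨hiw.1, hmax.2 _ hlt⟩⟩
    have h2 : (((Finset.univ.image w).filter fun A => x ∈ A).card : ℝ) ≤
        (Finset.univ.filter fun i => |g i x| < δ).card + 1 := by
      exact_mod_cast (card_filter_mem_image_le w x).trans (le_of_eq_of_le (by congr) h1)
    rw [ordAt]
    linarith
  refine ⟨Finset.univ.image w, isOpenCover_image ?_ ?_, ?_, fun x => ?_⟩
  · intro i
    have : w i = {x | -δ < g i x} ∩ ⋂ j, ⋂ (_ : j < i), {x | g j x < δ} := by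
      ext x
      simp [w]
    rw [this]
    exact (isOpen_lt continuous_const (g i).continuous).inter (isOpen_iInter_of_finite fun j =>
      isOpen_iInter_of_finite fun _ => isOpen_lt (g j).continuous continuous_const)
  · intro x
    have hex : (Finset.univ.filter fun i => 0 < g i x).Nonempty := by
      by_contra hempty
      rw [Finset.not_nonempty_iff_eq_empty, Finset.filter_eq_empty_iff] at hempty
      have h1 : ∑ i : Fin N, φ i x ≤ ∑ _i : Fin N, 4 * ε := Finset.sum_le_sum fun i _ => by
        have h2 := not_lt.1 (hempty (Finset.mem_univ i))
        have h3 := (abs_lt.1 (hgf i x)).1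
        simp only [ContinuousMap.coe_mk] at h3
        linarith
      rw [← Finset.sum_range fun i => φ i x, hφ1] at h1
      simp only [Finset.sum_const, Finset.card_univ, Fintype.card_fin, nsmul_eq_mul] at h1
      linarith
    refine ⟨Finset.min' _ hex, ?_, fun j hj => ?_⟩
    · have := (Finset.mem_filter.1 (Finset.min'_mem _ hex)).2
      linarith
    · by_contra! hcon
      exact (Finset.min'_le _ _ (Finset.mem_filter.2
        ⟨Finset.mem_univ j, hδ.trans_le hcon⟩)).not_gt hj
  · intro B hB
    obtain ⟨i, -, rfl⟩ := Finset.mem_image.1 hB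
    refine ⟨a i, haU _ i.2, fun x hx => hφa _ i.2 _ ?_⟩
    have h1 := hx.1
    have h2 := (abs_lt.1 (hgf i x)).2
    have h3 : δ ≤ ε := min_le_right _ _
    simp only [ContinuousMap.coe_mk] at h2
    exact (show 0 < φ i x by linarith).ne'
  · refine (Finset.sum_le_sum fun γ _ => hord (T γ x)).trans ?_
    have h1 : ∑ γ, (Finset.univ.filter fun i => |g i (T γ x)| < δ).card =
        (Finset.univ.filter fun p : Γ × Fin N => |g p.2 (T p.1 x)| < δ).card := by
      simp only [Finset.card_filter, Fintype.sum_prod_type]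
    have h2 := hcard x
    rw [← h1] at h2
    exact_mod_cast h2

end FreeAction

section InvariantMeasures

variable {X Γ : Type*} [MetricSpace X] [MeasurableSpace X] [BorelSpace X]

lemma integrable_ordAt {V : Finset (Set X)} (hV : IsOpenCover V) (μ : Measure X)
    [IsFiniteMeasure μ] : Integrable (ordAt V) μ := by
  have h : ordAt V = fun x => ∑ A ∈ V, A.indicator (fun _ => (1 : ℝ)) x - 1 := by
    ext x
    simp only [ordAt, Finset.card_filter, Set.indicator_apply, Nat.cast_sum, Nat.cast_ite,
      Nat.cast_one, Nat.cast_zero]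
  rw [h]
  exact (integrable_finsetSum _ fun A hA =>
    (integrable_const _).indicator (hV.1 A hA).measurableSet).sub (integrable_const _)

variable [Group Γ] [Fintype Γ]

lemma integral_ordAt_le {T : Γ → X ≃ₜ X} {V : Finset (Set X)} (hV : IsOpenCover V) {c : ℝ}
    (hc : ∀ x, ∑ γ, ordAt V (T γ x) ≤ c) {μ : ProbabilityMeasure X} (hμ : μ ∈ invProb T) :
    ∫ x, ordAt V x ∂(μ : Measure X) ≤ c / Fintype.card Γ := by
  have hmp : ∀ γ, MeasurePreserving (T γ) (μ : Measure X) (μ : Measure X) := fun γ =>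
    ⟨(T γ).continuous.measurable, hμ γ⟩
  have hint : ∀ γ, Integrable (fun x => ordAt V (T γ x)) (μ : Measure X) := fun γ =>
    (hmp γ).integrable_comp_of_integrable (integrable_ordAt hV _)
  have heq : ∀ γ, ∫ x, ordAt V (T γ x) ∂(μ : Measure X) = ∫ x, ordAt V x ∂(μ : Measure X) :=
    fun γ => (hmp γ).integral_comp (T γ).measurableEmbedding _
  have h1 : ∫ x, ∑ γ, ordAt V (T γ x) ∂(μ : Measure X) ≤ ∫ _, c ∂(μ : Measure X) :=
    integral_mono (integrable_finsetSum _ fun γ _ => hint γ) (integrable_const _) hc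
  rw [integral_finsetSum _ fun γ _ => hint γ] at h1
  simp only [heq, Finset.sum_const, Finset.card_univ, nsmul_eq_mul, integral_const,
    probReal_univ, one_smul] at h1
  have hpos : (0 : ℝ) < Fintype.card Γ := by exact_mod_cast Fintype.card_pos
  rwa [le_div_iff₀' hpos]

/-- The uniform probability measure on an orbit is invariant. -/
lemma exists_mem_invProb_integral_ordAt {T : Γ → X ≃ₜ X}
    (hT : ∀ γ γ' : Γ, ∀ x : X, T (γ * γ') x = T γ (T γ' x)) {V : Finset (Set X)}
    (hV : IsOpenCover V) (x : X) :
    ∃ μ ∈ invProb T,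
      ∫ y, ordAt V y ∂(μ : Measure X) = (∑ γ, ordAt V (T γ x)) / Fintype.card Γ := by
  have h0 : (Fintype.card Γ : ℝ≥0∞) ≠ 0 := by exact_mod_cast Fintype.card_ne_zero
  let ν : Measure X := (Fintype.card Γ : ℝ≥0∞)⁻¹ • ∑ γ, Measure.dirac (T γ x)
  have hν : IsProbabilityMeasure ν := ⟨by
    simp [ν, ENNReal.inv_mul_cancel h0 (ENNReal.natCast_ne_top _)]⟩
  refine ⟨⟨ν, hν⟩, fun γ => ?_, ?_⟩
  · change ν.map (T γ) = ν
    have hm := (T γ).continuous.measurable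
    simp only [ν]
    rw [Measure.map_smul, Measure.map_finset_sum hm.aemeasurable]
    simp only [Measure.map_dirac' hm, ← hT]
    congr 1
    exact Equiv.sum_comp (Equiv.mulLeft γ) fun γ' => Measure.dirac (T γ' x)
  · change ∫ y, ordAt V y ∂ν = _
    simp only [ν]
    rw [integral_smul_measure, integral_finsetSum_measure fun γ _ => integrable_ordAt hV _]
    simp [integral_dirac, div_eq_inv_mul]

end InvariantMeasures

lemma card_sub_one_eq_ofReal_ordAt {X : Type*} (V : Finset (Set X)) (x : X) :
    (((V.filter fun A => x ∈ A).card : ℝ≥0∞) - 1) = ENNReal.ofReal (ordAt V x) := by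
  rw [ordAt, ENNReal.ofReal_sub _ zero_le_one, ENNReal.ofReal_natCast, ENNReal.ofReal_one]

/-- A space of finite covering dimension satisfies the usual integer-valued dimension bound. -/
lemma exists_nat_le_covDimE {X : Type*} [TopologicalSpace X] (h : covDimE X ≠ ∞) :
    ∃ d : ℕ, (d : ℝ≥0∞) ≤ covDimE X ∧
      ∀ U : Finset (Set X), IsOpenCover U → ∃ V, IsOpenCover V ∧ Refines U V ∧
        ∀ x, (V.filter fun A => x ∈ A).card ≤ d + 1 := by
  refine ⟨⌊(covDimE X).toReal⌋₊, ?_, fun U hU => ?_⟩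
  · rw [← ENNReal.ofReal_natCast]
    exact ENNReal.ofReal_le_of_le_toReal (Nat.floor_le ENNReal.toReal_nonneg)
  · have hlt : covDimE X < ((⌊(covDimE X).toReal⌋₊ + 1 : ℕ) : ℝ≥0∞) := by
      rw [← ENNReal.ofReal_natCast, ENNReal.lt_ofReal_iff_toReal_lt h]
      exact_mod_cast Nat.lt_floor_add_one _
    have hU' := (le_iSup₂ (f := fun (U : Finset (Set X))
      (_ : U ∈ {U : Finset (Set X) | IsOpenCover U}) =>
        ⨅ V ∈ {V : Finset (Set X) | IsOpenCover V ∧ Refines U V},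
          ⨆ x : X, (((V.filter fun A => x ∈ A).card : ℝ≥0∞) - 1)) U hU).trans_lt hlt
    obtain ⟨V, hV⟩ := iInf_lt_iff.1 hU'
    obtain ⟨hVU, hV⟩ := iInf_lt_iff.1 hV
    refine ⟨V, hVU.1, hVU.2, fun x => ?_⟩
    have h1 := (le_iSup (fun x : X => (((V.filter fun A => x ∈ A).card : ℝ≥0∞) - 1)) x).trans_lt hV
    have h2 : (((V.filter fun A => x ∈ A).card - 1 : ℕ) : ℝ≥0∞) <
        ((⌊(covDimE X).toReal⌋₊ + 1 : ℕ) : ℝ≥0∞) := by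
      rw [ENNReal.natCast_sub]
      simpa using h1
    have h3 := Nat.cast_lt.1 h2
    omega

/-- For a free action of a finite group Γ on a compact metric space,
dim(X,T) = dim(X)/|Γ|. -/
theorem stmt13 {X Γ : Type*} [MetricSpace X] [CompactSpace X] [MeasurableSpace X] [BorelSpace X]
    [Group Γ] [Fintype Γ] (T : Γ → X ≃ₜ X)
    (hT : ∀ γ γ' : Γ, ∀ x : X, T (γ * γ') x = T γ (T γ' x))
    (hfree : ∀ x : X, ∀ γ γ' : Γ, T γ x = T γ' x → γ = γ') :
    dimDyn T = covDimE X / (Fintype.card Γ : ℝ≥0∞) := by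
  have hpos : (0 : ℝ) < Fintype.card Γ := by exact_mod_cast Fintype.card_pos
  have h0 : (Fintype.card Γ : ℝ≥0∞) ≠ 0 := by exact_mod_cast Fintype.card_ne_zero
  have htop : (Fintype.card Γ : ℝ≥0∞) ≠ ∞ := ENNReal.natCast_ne_top _
  refine le_antisymm ?_ ?_
  · by_cases hfin : covDimE X = ∞
    · rw [hfin, ENNReal.top_div_of_ne_top htop]
      exact le_top
    · obtain ⟨d, hdle, hd⟩ := exists_nat_le_covDimE hfin
      refine le_trans ?_ (ENNReal.div_le_div_right hdle _)
      refine iSup₂_le fun U hU => ?_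
      obtain ⟨V, hV, hUV, hVd⟩ := IsOpenCover.exists_refines_sum_ordAt_le hT hfree hd hU
      refine iInf₂_le_of_le V ⟨hV, hUV⟩ (iSup₂_le fun μ hμ => ?_)
      refine (ENNReal.ofReal_le_ofReal (integral_ordAt_le hV hVd hμ)).trans_eq ?_
      rw [ENNReal.ofReal_div_of_pos hpos, ENNReal.ofReal_natCast, ENNReal.ofReal_natCast]
  · rw [ENNReal.div_le_iff h0 htop]
    refine iSup₂_le fun U hU => ?_
    rw [← ENNReal.div_le_iff h0 htop]
    refine le_trans (le_iInf₂ fun V hV => ?_) (le_iSup₂ (f := fun (U : Finset (Set X))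
      (_ : U ∈ {U : Finset (Set X) | IsOpenCover U}) =>
        ⨅ V ∈ {V : Finset (Set X) | IsOpenCover V ∧ Refines U V},
          ⨆ μ ∈ invProb T, ENNReal.ofReal (∫ x, ordAt V x ∂(μ : Measure X))) U hU)
    obtain ⟨W, hW, hVW, hWV⟩ := hV.1.exists_refines_ordAt_le_sum (fun γ => T γ)
      (fun γ => (T γ).continuous) 1 (action_one hT)
    rw [ENNReal.div_le_iff h0 htop]
    refine iInf₂_le_of_le W ⟨hW, hV.2.trans hVW⟩ (iSup_le fun x => ?_)
    obtain ⟨μ, hμ, hint⟩ := exists_mem_invProb_integral_ordAt hT hV.1 x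
    rw [card_sub_one_eq_ofReal_ordAt, ← ENNReal.div_le_iff h0 htop]
    refine le_trans ?_ (le_iSup₂ (f := fun (μ : ProbabilityMeasure X) (_ : μ ∈ invProb T) =>
      ENNReal.ofReal (∫ x, ordAt V x ∂(μ : Measure X))) μ hμ)
    rw [hint, ENNReal.ofReal_div_of_pos hpos, ENNReal.ofReal_natCast]
    exact ENNReal.div_le_div_right (ENNReal.ofReal_le_ofReal (hWV x)) _
end

section
/- Let Γ be a countable group and d ∈ ℕ. Then the shift action of Γ on ([0,1]^d)^Γ satisfies dim(([0,1]^d)^Γ, shift) = d. -/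
open MeasureTheory Set
open scoped ENNReal Classical

/-- The left-shift homeomorphism of K^Γ: (shift_γ x)_{γ'} = x_{γ⁻¹ γ'}. -/
def shiftHomeo (Γ : Type*) [Group Γ] (K : Type*) [TopologicalSpace K] (γ : Γ) :
    (Γ → K) ≃ₜ (Γ → K) where
  toFun x := fun γ' => x (γ⁻¹ * γ')
  invFun x := fun γ' => x (γ * γ')
  left_inv x := by funext γ'; simp [inv_mul_cancel_left]
  right_inv x := by funext γ'; simp [mul_inv_cancel_left]
  continuous_toFun := continuous_pi fun γ' => continuous_apply _
  continuous_invFun := continuous_pi fun γ' => continuous_apply _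

/-- The coboundary of a mod 2 cubical cochain: the cube with lowest corner `z` and set of
directions `S` is represented by the pair `(z, S)`. -/
noncomputable def cubeCoboundary {ι : Type*} [DecidableEq ι] (c : (ι → ℕ) → Finset ι → ZMod 2)
    (z : ι → ℕ) (S : Finset ι) : ZMod 2 :=
  ∑ i ∈ S, (c (z + Pi.single i 1) (S.erase i) - c z (S.erase i))

/-- The iterated cup product of the coboundaries of `a (k - 1)`, …, `a 0`. -/
noncomputable def cubeCup {ι : Type*} [DecidableEq ι] (a : ℕ → (ι → ℕ) → ZMod 2) :
    ℕ → (ι → ℕ) → Finset ι → ZMod 2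
  | 0, _, _ => 1
  | k + 1, z, S => ∑ i ∈ S, (a k (z + Pi.single i 1) - a k z) *
      cubeCup a k (z + Pi.single i 1) (S.erase i)

theorem cubeCoboundary_cubeCoboundary {ι : Type*} [DecidableEq ι] (c : (ι → ℕ) → Finset ι → ZMod 2)
    (z : ι → ℕ) (S : Finset ι) : cubeCoboundary (cubeCoboundary c) z S = 0 := by
  have key : cubeCoboundary (cubeCoboundary c) z S = ∑ p ∈ S.offDiag,
      (c (z + Pi.single p.1 1 + Pi.single p.2 1) ((S.erase p.1).erase p.2)
        - c (z + Pi.single p.1 1) ((S.erase p.1).erase p.2)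
        - (c (z + Pi.single p.2 1) ((S.erase p.1).erase p.2)
        - c z ((S.erase p.1).erase p.2))) := by
    simp only [cubeCoboundary, ← Finset.sum_sub_distrib]
    rw [Finset.sum_sigma']
    refine Finset.sum_nbij' (fun p => (p.1, p.2)) (fun p => ⟨p.1, p.2⟩) ?_ ?_ ?_ ?_ ?_
    · rintro ⟨i, j⟩ h
      simp only [Finset.mem_sigma, Finset.mem_erase, Finset.mem_offDiag] at h ⊢
      exact ⟨h.1, h.2.2, h.2.1.symm⟩
    · rintro ⟨i, j⟩ h
      simp only [Finset.mem_sigma, Finset.mem_erase, Finset.mem_offDiag] at h ⊢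
      exact ⟨h.1, h.2.2.symm, h.2.1⟩
    · intros; rfl
    · intros; rfl
    · intros; rfl
  rw [key]
  refine Finset.sum_involution (fun p _ => p.swap) ?_ ?_ ?_ ?_
  · rintro ⟨i, j⟩ -
    simp only [Prod.swap]
    rw [Finset.erase_right_comm (a := j), add_right_comm z (Pi.single j 1)]
    simp only [CharTwo.sub_eq_add]
    generalize c _ _ = A
    generalize c _ _ = B
    generalize c _ _ = C
    generalize c _ _ = D
    revert A B C D
    decide
  · rintro ⟨i, j⟩ h -
    simp only [Finset.mem_offDiag] at h
    intro e
    exact h.2.2 (congrArg Prod.snd e)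
  · rintro ⟨i, j⟩ h
    simp only [Finset.mem_offDiag, Prod.swap] at h ⊢
    exact ⟨h.2.1, h.1, fun e => h.2.2 e.symm⟩
  · rintro ⟨i, j⟩ h
    rfl

theorem cubeCoboundary_mul {ι : Type*} [DecidableEq ι] (a : (ι → ℕ) → ZMod 2)
    (c : (ι → ℕ) → Finset ι → ZMod 2) (z : ι → ℕ) (S : Finset ι) :
    cubeCoboundary (fun z S => a z * c z S) z S =
      ∑ i ∈ S, (a (z + Pi.single i 1) - a z) * c (z + Pi.single i 1) (S.erase i) +
        a z * cubeCoboundary c z S := by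
  simp only [cubeCoboundary, Finset.mul_sum, ← Finset.sum_add_distrib]
  refine Finset.sum_congr rfl fun i _ => ?_
  ring

theorem cubeCoboundary_cubeCup {ι : Type*} [DecidableEq ι] (a : ℕ → (ι → ℕ) → ZMod 2) (k : ℕ) :
    cubeCoboundary (cubeCup a k) = 0 := by
  induction k with
  | zero => ext z S; simp [cubeCoboundary, cubeCup]
  | succ k ih =>
    have h : cubeCup a (k + 1) = cubeCoboundary fun z S => a k z * cubeCup a k z S := by
      ext z S
      rw [cubeCoboundary_mul, ih]
      simp [cubeCup]
    rw [h]
    ext z S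
    exact cubeCoboundary_cubeCoboundary _ z S

theorem cubeCup_succ {ι : Type*} [DecidableEq ι] (a : ℕ → (ι → ℕ) → ZMod 2) (k : ℕ) (z : ι → ℕ)
    (S : Finset ι) :
    cubeCup a (k + 1) z S = cubeCoboundary (fun z S => a k z * cubeCup a k z S) z S := by
  rw [cubeCoboundary_mul, cubeCoboundary_cubeCup]
  simp [cubeCup]

/-- A cup product having the coboundary of a function constant on a hyperplane as a factor
vanishes on the cubes of that hyperplane. -/
theorem cubeCup_eq_zero {ι : Type*} [DecidableEq ι] (a : ℕ → (ι → ℕ) → ZMod 2)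
    {k m M : ℕ} (hm : m < k) (i : ι) (v : ZMod 2) (hv : ∀ z, z i = M → a m z = v)
    (z : ι → ℕ) (hz : z i = M)
    (S : Finset ι) (hi : i ∉ S) : cubeCup a k z S = 0 := by
  induction k generalizing z S with
  | zero => omega
  | succ k ih =>
    refine Finset.sum_eq_zero fun j hj => ?_
    have hji : i ≠ j := fun e => hi (e ▸ hj)
    have hz' : (z + Pi.single j 1 : ι → ℕ) i = M := by simp [hji, hz]
    rcases Nat.lt_succ_iff_lt_or_eq.1 hm with h | rfl
    · rw [ih h _ hz' _ (fun e => hi (Finset.mem_of_mem_erase e)), mul_zero]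
    · rw [hv _ hz', hv _ hz, sub_self, zero_mul]

theorem exists_ne_of_cubeCup_ne_zero {ι : Type*} [DecidableEq ι] (a : ℕ → (ι → ℕ) → ZMod 2)
    {k m : ℕ} (hm : m < k) (z : ι → ℕ) (S : Finset ι) (h : cubeCup a k z S ≠ 0) :
    ∃ p q : ι → ℕ, z ≤ p ∧ z ≤ q ∧ (∀ i, p i ≤ z i + if i ∈ S then 1 else 0) ∧
      (∀ i, q i ≤ z i + if i ∈ S then 1 else 0) ∧ a m p ≠ a m q := by
  induction k generalizing z S with
  | zero => omega
  | succ k ih =>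
    obtain ⟨j, hj, hne⟩ := Finset.exists_ne_zero_of_sum_ne_zero h
    have hle : ∀ i, (z + Pi.single j 1 : ι → ℕ) i ≤ z i + if i ∈ S then 1 else 0 := by
      intro i
      rcases eq_or_ne i j with rfl | hij <;> simp [*]
    rcases Nat.lt_succ_iff_lt_or_eq.1 hm with h | rfl
    · obtain ⟨p, q, hp, hq, hp', hq', hpq⟩ := ih h _ _ (right_ne_zero_of_mul hne)
      have hz : z ≤ z + Pi.single j 1 := le_self_add
      have key : ∀ i, (z + Pi.single j 1 : ι → ℕ) i + (if i ∈ S.erase j then 1 else 0) ≤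
          z i + if i ∈ S then 1 else 0 := by
        intro i
        rcases eq_or_ne i j with rfl | hij <;> simp [*]
      exact ⟨p, q, hz.trans hp, hz.trans hq, fun i => (hp' i).trans (key i),
        fun i => (hq' i).trans (key i), hpq⟩
    · exact ⟨z + Pi.single j 1, z, le_self_add, le_rfl, hle, fun i => Nat.le_add_right _ _,
        sub_ne_zero.1 (left_ne_zero_of_mul hne)⟩

/-- The lowest corners of the unit cubes with directions `S` inside the face
`[0, N]^S` of the grid. -/
noncomputable def gridBox {ι : Type*} [DecidableEq ι] [Fintype ι] (N : ℕ) (S : Finset ι) :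
    Finset (ι → ℕ) :=
  Fintype.piFinset fun i => if i ∈ S then Finset.range N else {0}

theorem mem_gridBox {ι : Type*} [DecidableEq ι] [Fintype ι] {N : ℕ} {S : Finset ι} {z : ι → ℕ} :
    z ∈ gridBox N S ↔ ∀ i, (i ∈ S → z i < N) ∧ (i ∉ S → z i = 0) := by
  simp only [gridBox, Fintype.mem_piFinset]
  refine forall_congr' fun i => ?_
  by_cases h : i ∈ S <;> simp [h]

theorem sum_gridBox_sub {ι : Type*} [DecidableEq ι] [Fintype ι] (N : ℕ) {S : Finset ι} {i : ι}
    (hi : i ∈ S) (c : (ι → ℕ) → ZMod 2) :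
    ∑ z ∈ gridBox N S, (c (z + Pi.single i 1) - c z) =
      ∑ z ∈ gridBox N (S.erase i), (c (z + Pi.single i N) - c z) := by
  have h : ∀ z : ι → ℕ, c (z + Pi.single i N) - c z =
      ∑ m ∈ Finset.range N, (c (z + Pi.single i m + Pi.single i 1) - c (z + Pi.single i m)) := by
    intro z
    have := Finset.sum_range_sub (fun m => c (z + Pi.single i m)) N
    simp only [Pi.single_zero, add_zero] at this
    rw [← this]
    refine Finset.sum_congr rfl fun m _ => ?_
    rw [add_assoc, ← Pi.single_add]
  simp only [h]
  rw [← Finset.sum_product']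
  refine Finset.sum_nbij' (fun z => (Function.update z i 0, z i))
    (fun p => p.1 + Pi.single i p.2) ?_ ?_ ?_ ?_ ?_
  · intro z hz
    rw [mem_gridBox] at hz
    simp only [Finset.mem_product, mem_gridBox, Finset.mem_range]
    refine ⟨fun j => ?_, (hz i).1 hi⟩
    rcases eq_or_ne j i with rfl | hj
    · simp
    · simpa [hj] using hz j
  · rintro ⟨z, m⟩ hz
    simp only [Finset.mem_product, mem_gridBox, Finset.mem_range] at hz ⊢
    intro j
    have := hz.1 j
    rcases eq_or_ne j i with rfl | hj
    · simp_all
    · simpa [hj] using this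
  · intro z _
    ext j
    rcases eq_or_ne j i with rfl | hj <;> simp [*]
  · rintro ⟨z, m⟩ hz
    simp only [Finset.mem_product, mem_gridBox, Finset.mem_range] at hz
    have h0 : z i = 0 := (hz.1 i).2 (by simp)
    refine Prod.ext ?_ (by simp [h0])
    ext j
    rcases eq_or_ne j i with rfl | hj <;> simp [*]
  · intro z _
    have : Function.update z i 0 + Pi.single i (z i) = z := by
      ext j
      rcases eq_or_ne j i with rfl | hj <;> simp [*]
    simp only [this]

/-- The Stokes formula on the grid. -/
theorem sum_gridBox_cubeCoboundary {ι : Type*} [DecidableEq ι] [Fintype ι] (N : ℕ) (S : Finset ι)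
    (c : (ι → ℕ) → Finset ι → ZMod 2) :
    ∑ z ∈ gridBox N S, cubeCoboundary c z S = ∑ i ∈ S, ∑ z ∈ gridBox N (S.erase i),
      (c (z + Pi.single i N) (S.erase i) - c z (S.erase i)) := by
  simp only [cubeCoboundary]
  rw [Finset.sum_comm]
  exact Finset.sum_congr rfl fun i hi => sum_gridBox_sub N hi fun z => c z (S.erase i)

theorem sum_gridBox_cubeCup {d N : ℕ} (a : ℕ → (Fin d → ℕ) → ZMod 2)
    (h0 : ∀ (i : Fin d) z, z i = 0 → a i z = 1) (h1 : ∀ (i : Fin d) z, z i = N → a i z = 0)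
    {k : ℕ} (hk : k ≤ d) :
    ∑ z ∈ gridBox N {i : Fin d | (i : ℕ) < k}, cubeCup a k z {i : Fin d | (i : ℕ) < k} = 1 := by
  induction k with
  | zero =>
    have : gridBox N {i : Fin d | (i : ℕ) < 0} = {0} := by
      ext z
      simp [mem_gridBox, funext_iff]
    rw [this]
    simp [cubeCup]
  | succ k ih =>
    have hS : Finset.erase {i : Fin d | (i : ℕ) < k + 1} (⟨k, hk⟩ : Fin d) =
        ({i : Fin d | (i : ℕ) < k} : Finset (Fin d)) := by
      ext i
      simp [Fin.ext_iff]
      omega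
    simp only [cubeCup_succ]
    rw [sum_gridBox_cubeCoboundary, Finset.sum_eq_single (⟨k, hk⟩ : Fin d)]
    · rw [hS, ← CharTwo.neg_eq (1 : ZMod 2), ← ih (Nat.le_of_succ_le hk),
        ← Finset.sum_neg_distrib]
      refine Finset.sum_congr rfl fun z hz => ?_
      have hz0 : z ⟨k, hk⟩ = 0 := ((mem_gridBox.1 hz) ⟨k, hk⟩).2 (by simp)
      have e0 : a k z = 1 := h0 ⟨k, hk⟩ z hz0
      have e1 : a k (z + Pi.single ⟨k, hk⟩ N) = 0 := h1 ⟨k, hk⟩ _ (by simp [hz0])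
      rw [e0, e1]
      ring
    · intro i hi hik
      have hik' : (i : ℕ) < k := by
        simp [Fin.ext_iff] at hi hik
        omega
      refine Finset.sum_eq_zero fun z hz => ?_
      have hz0 : z i = 0 := ((mem_gridBox.1 hz) i).2 (by simp)
      have hzN : (z + Pi.single i N : Fin d → ℕ) i = N := by simp [hz0]
      rw [cubeCup_eq_zero a hik' i 1 (h0 i) z hz0 _ (Finset.notMem_erase _ _),
        cubeCup_eq_zero a hik' i 0 (h1 i) _ hzN _ (Finset.notMem_erase _ _)]
      simp
    · intro h
      simp at h

/-- A combinatorial Poincaré–Miranda theorem on the grid `{0, …, N}^d`. -/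
theorem exists_cube_forall_ne {d N : ℕ} (a : Fin d → (Fin d → ℕ) → ZMod 2)
    (h0 : ∀ (i : Fin d) z, z i = 0 → a i z = 1) (h1 : ∀ (i : Fin d) z, z i = N → a i z = 0) :
    ∃ z : Fin d → ℕ, (∀ i, z i < N) ∧ ∀ m, ∃ p q : Fin d → ℕ, z ≤ p ∧ z ≤ q ∧
      (∀ i, p i ≤ z i + 1) ∧ (∀ i, q i ≤ z i + 1) ∧ a m p = 1 ∧ a m q = 0 := by
  set b : ℕ → (Fin d → ℕ) → ZMod 2 := fun k => if h : k < d then a ⟨k, h⟩ else 0 with hb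
  have hba : ∀ i : Fin d, b i = a i := fun i => by simp [hb]
  have hsum := sum_gridBox_cubeCup (N := N) b (fun i z h => by rw [hba, h0 i z h])
    (fun i z h => by rw [hba, h1 i z h]) le_rfl
  obtain ⟨z, hz, hne⟩ := Finset.exists_ne_zero_of_sum_ne_zero (hsum.trans_ne one_ne_zero)
  refine ⟨z, fun i => ((mem_gridBox.1 hz) i).1 (by simp), fun m => ?_⟩
  obtain ⟨p, q, hp, hq, hp', hq', hpq⟩ := exists_ne_of_cubeCup_ne_zero b m.2 z _ hne
  rw [hba] at hpq
  simp only [Finset.mem_filter, Finset.mem_univ, true_and, Fin.is_lt, if_true] at hp' hq'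
  have : ∀ u v : ZMod 2, u ≠ v → u = 1 ∧ v = 0 ∨ v = 1 ∧ u = 0 := by decide
  rcases this _ _ hpq with h | h
  · exact ⟨p, q, hp, hq, hp', hq', h⟩
  · exact ⟨q, p, hq, hp, hq', hp', h⟩

/-- The Poincaré–Miranda theorem on the unit cube. -/
theorem exists_forall_eq_zero_of_faces {d : ℕ} (h : Fin d → (Fin d → unitInterval) → ℝ)
    (hc : ∀ i, Continuous (h i)) (h0 : ∀ i x, x i = 0 → 0 ≤ h i x)
    (h1 : ∀ i x, x i = 1 → h i x ≤ 0) : ∃ x, ∀ i, h i x = 0 := by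
  by_contra! hne
  have hH : Continuous fun x i => h i x := continuous_pi hc
  obtain ⟨x₀, -, hx₀⟩ := isCompact_univ.exists_isMinOn univ_nonempty hH.norm.continuousOn
  set ε := ‖fun i => h i x₀‖ with hε
  have hpos : 0 < ε := by
    obtain ⟨i, hi⟩ := hne x₀
    exact norm_pos_iff.2 fun e => hi (congrFun e i)
  obtain ⟨δ, hδ, hu⟩ := Metric.uniformContinuous_iff.1
    (CompactSpace.uniformContinuous_of_continuous hH) ε hpos
  obtain ⟨n, hn⟩ := exists_nat_one_div_lt hδ
  set N := n + 1 with hN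
  have hNpos : (0 : ℝ) < N := by positivity
  set P : (Fin d → ℕ) → Fin d → unitInterval :=
    fun z i => projIcc (0 : ℝ) 1 zero_le_one (z i / N) with hP
  set a : Fin d → (Fin d → ℕ) → ZMod 2 := fun i z =>
    if z i = 0 then 1 else if z i = N then 0 else if 0 < h i (P z) then 1 else 0 with ha
  have ha1 : ∀ i z, a i z = 1 → 0 ≤ h i (P z) := by
    intro i z hz
    by_cases hz0 : z i = 0
    · exact h0 i _ (by simp [hP, hz0, projIcc_left])
    by_cases hzN : z i = N
    · simp [ha, hzN, hN] at hz
    by_contra hlt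
    simp [ha, hz0, hzN, (not_le.1 hlt).le.not_gt] at hz
  have ha0 : ∀ i z, a i z = 0 → h i (P z) ≤ 0 := by
    intro i z hz
    by_cases hz0 : z i = 0
    · simp [ha, hz0] at hz
    by_cases hzN : z i = N
    · exact h1 i _ (by simp [hP, hzN, projIcc_right])
    by_contra hlt
    simp [ha, hz0, hzN, not_le.1 hlt] at hz
  obtain ⟨z, -, hz⟩ := exists_cube_forall_ne (N := N) a (fun i z hz => by simp [ha, hz])
    (fun i z hz => by simp [ha, hz, hN])
  have hdist : ∀ p : Fin d → ℕ, z ≤ p → (∀ i, p i ≤ z i + 1) → dist (P p) (P z) < δ := by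
    intro p hp hp'
    rw [dist_pi_lt_iff hδ]
    intro i
    refine lt_of_le_of_lt ?_ hn
    have hzp : (z i : ℝ) ≤ p i := by exact_mod_cast hp i
    have hpz : (p i : ℝ) ≤ z i + 1 := by exact_mod_cast hp' i
    calc dist (P p i) (P z i) ≤ |(p i : ℝ) / N - z i / N| := by
          rw [Subtype.dist_eq, Real.dist_eq]
          exact abs_projIcc_sub_projIcc zero_le_one
      _ = ((p i : ℝ) - z i) / N := by
          rw [← sub_div, abs_of_nonneg (div_nonneg (sub_nonneg.2 hzp) hNpos.le)]
      _ ≤ 1 / ((n : ℝ) + 1) := by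
          rw [hN]
          push_cast
          gcongr
          linarith
  have hlt : ‖fun i => h i (P z)‖ < ε := by
    rw [pi_norm_lt_iff hpos]
    intro i
    obtain ⟨p, q, hp, hq, hp', hq', hap, haq⟩ := hz i
    have hdp := (dist_pi_lt_iff hpos).1 (hu (hdist p hp hp')) i
    have hdq := (dist_pi_lt_iff hpos).1 (hu (hdist q hq hq')) i
    rw [Real.dist_eq, abs_lt] at hdp hdq
    have := ha1 i p hap
    have := ha0 i q haq
    rw [Real.norm_eq_abs, abs_lt]
    constructor <;> linarith
  exact absurd (hx₀ (mem_univ (P z))) (not_le.2 hlt)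

/-- The Lebesgue covering theorem for the unit cube. -/
theorem exists_lt_card_of_cover_cube {d : ℕ} {ι : Type*} [Fintype ι]
    (W : ι → Set (Fin d → unitInterval)) (hW : ∀ b, IsOpen (W b)) (hcov : ⋃ b, W b = univ)
    (hface : ∀ b i, ∀ p ∈ W b, ∀ q ∈ W b, p i = 0 → q i ≠ 1) :
    ∃ x, d < (Finset.univ.filter fun b => x ∈ W b).card := by
  obtain ⟨f, hf⟩ := PartitionOfUnity.exists_isSubordinate isClosed_univ W hW hcov.ge
  have hfW : ∀ b x, f b x ≠ 0 → x ∈ W b := fun b x hx => hf b (subset_tsupport _ hx)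
  set lab : ι → ℕ := fun b =>
    sInf {k | k = d ∨ ∃ i : Fin d, (i : ℕ) = k ∧ ∃ p ∈ W b, p i = 0} with hlab
  have hmem : ∀ b, lab b ∈ {k | k = d ∨ ∃ i : Fin d, (i : ℕ) = k ∧ ∃ p ∈ W b, p i = 0} :=
    fun b => Nat.sInf_mem ⟨d, Or.inl rfl⟩
  have hlab_d : ∀ b, lab b ≤ d := fun b => Nat.sInf_le (Or.inl rfl)
  have hlab_le : ∀ b (i : Fin d), ∀ x ∈ W b, x i = 0 → lab b ≤ i :=
    fun b i x hx hi => Nat.sInf_le (Or.inr ⟨i, rfl, x, hx, hi⟩)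
  have hlab_ne : ∀ b (i : Fin d), ∀ x ∈ W b, x i = 1 → lab b ≠ i := by
    intro b i x hx hi e
    have := hmem b
    rw [e] at this
    rcases this with h | ⟨j, hj, p, hp, hp0⟩
    · exact absurd h i.2.ne
    · obtain rfl := Fin.ext hj
      exact hface b j p hp x hx hp0 hi
  set G : ℕ → (Fin d → unitInterval) → ℝ :=
    fun k x => ∑ b, if lab b = k then f b x else 0 with hG
  have hGc : ∀ k, Continuous (G k) := by
    intro k
    refine continuous_finsetSum _ fun b _ => ?_
    split_ifs
    · exact (f b).continuous
    · exact continuous_const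
  have hG0 : ∀ k x, 0 ≤ G k x := by
    intro k x
    refine Finset.sum_nonneg fun b _ => ?_
    split_ifs
    · exact f.nonneg b x
    · exact le_rfl
  have hGW : ∀ k x, G k x ≠ 0 → ∃ b, lab b = k ∧ x ∈ W b := by
    intro k x hx
    obtain ⟨b, -, hb⟩ := Finset.exists_ne_zero_of_sum_ne_zero hx
    rw [ne_eq, ite_eq_right_iff, Classical.not_imp] at hb
    exact ⟨b, hb.1, hfW b x hb.2⟩
  have hGsum : ∀ x, ∑ k ∈ Finset.range (d + 1), G k x = 1 := by
    intro x
    rw [← f.sum_eq_one (mem_univ x), finsum_eq_sum_of_fintype]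
    simp only [hG]
    rw [Finset.sum_comm]
    refine Finset.sum_congr rfl fun b _ => ?_
    rw [Finset.sum_ite_eq, if_pos (Finset.mem_range.2 (Nat.lt_succ_of_le (hlab_d b)))]
  obtain ⟨x, hx⟩ := exists_forall_eq_zero_of_faces
    (fun (i : Fin d) x => G i x - ∑ j ∈ Finset.Ioc (i : ℕ) d, G j x)
    (fun i => (hGc i).sub (continuous_finsetSum _ fun j _ => hGc j))
    (by
      intro i x hi
      rw [Finset.sum_eq_zero, sub_zero]
      · exact hG0 i x
      · intro j hj
        by_contra hne
        obtain ⟨b, rfl, hb⟩ := hGW j x hne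
        exact absurd (hlab_le b i x hb hi) (not_le.2 (Finset.mem_Ioc.1 hj).1))
    (by
      intro i x hi
      have : G i x = 0 := by
        by_contra hne
        obtain ⟨b, hbi, hb⟩ := hGW i x hne
        exact hlab_ne b i x hb hi hbi
      rw [this, zero_sub, neg_nonpos]
      exact Finset.sum_nonneg fun j _ => hG0 j x)
  have hx' : ∀ k < d, G k x = ∑ j ∈ Finset.Ioc k d, G j x :=
    fun k hk => sub_eq_zero.1 (hx ⟨k, hk⟩)
  have hne : ∀ k ≤ d, G k x ≠ 0 := by
    intro k hk hk0
    have hd0 : G d x = 0 := by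
      rcases hk.lt_or_eq with h | rfl
      · rw [hx' k h] at hk0
        exact (Finset.sum_eq_zero_iff_of_nonneg fun j _ => hG0 j x).1 hk0 d (by simp [h])
      · exact hk0
    have hall : ∀ m, ∀ k, k ≤ d → d - k = m → G k x = 0 := by
      intro m
      induction m using Nat.strong_induction_on with
      | _ m ih =>
        intro k hk hm
        rcases hk.lt_or_eq with h | rfl
        · rw [hx' k h]
          refine Finset.sum_eq_zero fun j hj => ?_
          rw [Finset.mem_Ioc] at hj
          exact ih (d - j) (by omega) j hj.2 rfl
        · exact hd0
    have := hGsum x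
    rw [Finset.sum_eq_zero fun k hk => hall _ k (Nat.lt_succ_iff.1 (Finset.mem_range.1 hk)) rfl]
      at this
    exact zero_ne_one this
  refine ⟨x, ?_⟩
  have hsub : Finset.range (d + 1) ⊆ (Finset.univ.filter fun b => x ∈ W b).image lab := by
    intro k hk
    obtain ⟨b, hb, hxb⟩ := hGW k x (hne k (Nat.lt_succ_iff.1 (Finset.mem_range.1 hk)))
    exact Finset.mem_image.2 ⟨b, by simpa using hxb, hb⟩
  simpa using (Finset.card_le_card hsub).trans Finset.card_image_le

/-- For every refinement of a suitable finite open cover, the order is at least `d` somewhere on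
the copy of the cube formed by the constant configurations. -/
theorem le_dimDyn_shiftHomeo (Γ : Type) [Group Γ] (d : ℕ)
    [MeasurableSpace (Γ → Fin d → unitInterval)]
    [BorelSpace (Γ → Fin d → unitInterval)] :
    (d : ℝ≥0∞) ≤ dimDyn (shiftHomeo Γ (Fin d → unitInterval)) := by
  set A : Finset (Fin d) → Set (Γ → Fin d → unitInterval) := fun s =>
    {x | ∀ i, (i ∈ s → x 1 i ≠ 1) ∧ (i ∉ s → x 1 i ≠ 0)} with hA
  have hcov : IsOpenCover (Finset.univ.image A) := by
    constructor
    · intro B hB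
      obtain ⟨s, -, rfl⟩ := Finset.mem_image.1 hB
      simp only [hA, ofPred_forall, ofPred_and]
      refine isOpen_iInter_of_finite fun i => ?_
      have hi : Continuous fun x : Γ → Fin d → unitInterval => x 1 i := by fun_prop
      refine IsOpen.inter ?_ ?_
      · exact isOpen_iInter_of_finite fun _ => isOpen_ne_fun hi continuous_const
      · exact isOpen_iInter_of_finite fun _ => isOpen_ne_fun hi continuous_const
    · refine eq_univ_of_forall fun x => ?_
      refine mem_sUnion.2 ⟨A (Finset.univ.filter fun i => x 1 i ≠ 1), by simp, ?_⟩
      intro i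
      simp +contextual
  refine le_iSup₂_of_le _ hcov (le_iInf₂ fun V hV => ?_)
  set D : (Fin d → unitInterval) → Γ → Fin d → unitInterval := fun x _ => x with hD
  have hDc : Continuous D := continuous_pi fun _ => continuous_id
  obtain ⟨x, hx⟩ := exists_lt_card_of_cover_cube (fun B : V => D ⁻¹' (B : Set _))
    (fun B => (hV.1.1 B B.2).preimage hDc)
    (by
      refine eq_univ_of_forall fun x => ?_
      obtain ⟨B, hB, hxB⟩ := mem_sUnion.1 (hV.1.2 ▸ mem_univ (D x))
      exact mem_iUnion.2 ⟨⟨B, hB⟩, hxB⟩)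
    (by
      intro B i p hp q hq hp0 hq1
      obtain ⟨C, hC, hBC⟩ := hV.2 B B.2
      obtain ⟨s, -, rfl⟩ := Finset.mem_image.1 hC
      by_cases hi : i ∈ s
      · exact (hBC hq i).1 hi hq1
      · exact (hBC hp i).2 hi hp0)
  let μ : ProbabilityMeasure (Γ → Fin d → unitInterval) := ⟨Measure.dirac (D x), inferInstance⟩
  refine le_iSup₂_of_le μ ?_ ?_
  · intro γ
    change (Measure.dirac (D x)).map _ = Measure.dirac (D x)
    rw [Measure.map_dirac' (shiftHomeo Γ (Fin d → unitInterval) γ).continuous.measurable]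
    rfl
  · change _ ≤ ENNReal.ofReal (∫ y, ordAt V y ∂(Measure.dirac (D x)))
    rw [integral_dirac, ← ENNReal.ofReal_natCast]
    refine ENNReal.ofReal_le_ofReal ?_
    have hcard : (Finset.univ.filter fun B : V => x ∈ D ⁻¹' (B : Set _)).card ≤
        (V.filter fun B => D x ∈ B).card := by
      refine Finset.card_le_card_of_injOn (fun B => (B : Set _)) ?_
        Subtype.val_injective.injOn
      intro B hB
      simp only [Finset.coe_filter, Finset.mem_univ, true_and, mem_ofPred_eq, mem_preimage] at hB
      simp [hB]
    have : (d : ℝ) + 1 ≤ (V.filter fun B => D x ∈ B).card := by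
      exact_mod_cast Nat.succ_le_of_lt (hx.trans_le hcard)
    rw [ordAt]
    linarith

/-- The open star of the vertex `v` in the Freudenthal triangulation of `ℝ^J`. -/
def kuhnStar {J : Type*} (v : J → ℤ) : Set (J → ℝ) :=
  {y | (∀ i, |y i - v i| < 1) ∧ ∀ i j, (y i - v i) + (v j - y j) < 1}

theorem isOpen_kuhnStar {J : Type*} [Finite J] (v : J → ℤ) : IsOpen (kuhnStar v) := by
  simp only [kuhnStar, ofPred_and, ofPred_forall]
  refine IsOpen.inter ?_ ?_
  · exact isOpen_iInter_of_finite fun i => isOpen_lt (by fun_prop) continuous_const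
  · exact isOpen_iInter_of_finite fun i => isOpen_iInter_of_finite fun j =>
      isOpen_lt (by fun_prop) continuous_const

theorem mem_kuhnStar_ceil {J : Type*} (y : J → ℝ) : y ∈ kuhnStar fun i => ⌈y i⌉ := by
  refine ⟨fun i => ?_, fun i j => ?_⟩
  · rw [abs_lt]
    constructor <;> linarith [Int.le_ceil (y i), Int.ceil_lt_add_one (y i)]
  · linarith [Int.le_ceil (y i), Int.ceil_lt_add_one (y j)]

/-- The vertices whose open star contains a given point form a chain. -/
theorem le_or_le_of_mem_kuhnStar {J : Type*} {v w : J → ℤ} {y : J → ℝ} (hv : y ∈ kuhnStar v)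
    (hw : y ∈ kuhnStar w) : v ≤ w ∨ w ≤ v := by
  by_contra! h
  simp only [Pi.le_def, not_forall, not_le] at h
  obtain ⟨⟨j, hj⟩, ⟨i, hi⟩⟩ := h
  have h1 := hv.2 i j
  have h2 := hw.2 j i
  have hj' : (w j : ℝ) + 1 ≤ v j := by exact_mod_cast hj
  have hi' : (v i : ℝ) + 1 ≤ w i := by exact_mod_cast hi
  linarith

/-- A point lies in at most `m + 1` open stars, `m` being the number of its coordinates that are
not integers. -/
theorem card_filter_mem_kuhnStar_le {J : Type*} [Fintype J] (s : Finset (J → ℤ)) (y : J → ℝ) :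
    (s.filter fun v => y ∈ kuhnStar v).card ≤
      (Finset.univ.filter fun i => ∀ n : ℤ, y i ≠ n).card + 1 := by
  have hinj : Set.InjOn (fun v : J → ℤ => ∑ i, v i) (s.filter fun v => y ∈ kuhnStar v) := by
    have key : ∀ v w : J → ℤ, v ≤ w → ∑ i, v i = ∑ i, w i → v = w := by
      intro v w hle hs
      exact funext fun i =>
        (Finset.sum_eq_sum_iff_of_le fun i _ => hle i).1 hs i (Finset.mem_univ i)
    intro v hv w hw hs
    rcases le_or_le_of_mem_kuhnStar (Finset.mem_filter.1 hv).2 (Finset.mem_filter.1 hw).2 with h | h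
    · exact key v w h hs
    · exact (key w v h hs.symm).symm
  have hmaps : Set.MapsTo (fun v : J → ℤ => ∑ i, v i) (s.filter fun v => y ∈ kuhnStar v)
      (Finset.Icc (∑ i, ⌊y i⌋) (∑ i, ⌈y i⌉) : Finset ℤ) := by
    intro v hv
    have hv' := (Finset.mem_filter.1 hv).2.1
    rw [Finset.coe_Icc]
    constructor
    · refine Finset.sum_le_sum fun i _ => ?_
      have := (abs_lt.1 (hv' i)).2
      have h2 : (⌊y i⌋ : ℝ) < v i + 1 := (Int.floor_le (y i)).trans_lt (by linarith)
      exact Int.lt_add_one_iff.1 (by exact_mod_cast h2)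
    · refine Finset.sum_le_sum fun i _ => ?_
      have := (abs_lt.1 (hv' i)).1
      have h2 : (v i : ℝ) < ⌈y i⌉ + 1 := lt_of_lt_of_le (by linarith)
        (add_le_add_left (Int.le_ceil (y i)) 1)
      exact Int.lt_add_one_iff.1 (by exact_mod_cast h2)
  refine (Finset.card_le_card_of_injOn _ hmaps hinj).trans ?_
  rw [Int.card_Icc]
  have hsum : ∑ i, ⌈y i⌉ ≤ ∑ i, ⌊y i⌋ + (Finset.univ.filter fun i => ∀ n : ℤ, y i ≠ n).card := by
    rw [Finset.card_filter]
    push_cast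
    rw [← Finset.sum_add_distrib]
    refine Finset.sum_le_sum fun i _ => ?_
    split_ifs with h
    · exact Int.ceil_le_floor_add_one _
    · push Not at h
      obtain ⟨n, hn⟩ := h
      simp [hn]
  omega

/-- A continuous approximation of the identity which is an integer outside of the translates by
integers of the interval `(j / n, (j + 1) / n)`. -/
noncomputable def stair (n j : ℕ) (s : ℝ) : ℝ :=
  ⌊s⌋ + max 0 (min 1 (n * Int.fract s - j))

theorem continuous_stair {n j : ℕ} (hj : j < n) : Continuous (stair n j) := by
  have hj' : (j : ℝ) + 1 ≤ n := by exact_mod_cast hj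
  have h : stair n j = fun s => s +
      ((fun u : ℝ => max 0 (min 1 (n * u - j)) - u) ∘ Int.fract) s := by
    ext s
    have := Int.floor_add_fract s
    simp only [stair, Function.comp_apply]
    linarith
  rw [h]
  refine continuous_id.add (ContinuousOn.comp_fract'' (by fun_prop) ?_)
  have h0 : min (1 : ℝ) (n * 0 - j) ≤ 0 := (min_le_right _ _).trans (by simp)
  have h1 : min (1 : ℝ) (n * 1 - j) = 1 := min_eq_left (by linarith)
  rw [max_eq_left h0, h1]
  norm_num

theorem abs_stair_sub_le (n j : ℕ) (s : ℝ) : |stair n j s - s| ≤ 1 := by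
  have h0 := Int.fract_nonneg s
  have h1 := (Int.fract_lt_one s).le
  have h2 : max 0 (min 1 (n * Int.fract s - j)) ≤ 1 := max_le zero_le_one (min_le_left _ _)
  have h3 : 0 ≤ max 0 (min 1 (n * Int.fract s - j)) := le_max_left _ _
  have := Int.floor_add_fract s
  rw [stair, abs_le]
  constructor <;> linarith

theorem floor_eq_of_stair_ne {n j : ℕ} {s : ℝ} (h : ∀ m : ℤ, stair n j s ≠ m) :
    ⌊n * Int.fract s⌋ = (j : ℤ) := by
  rw [Int.floor_eq_iff]
  push_cast
  constructor
  · by_contra! hlt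
    refine h ⌊s⌋ ?_
    rw [stair, max_eq_left ((min_le_right _ _).trans (by linarith)), add_zero]
  · by_contra! hle
    refine h (⌊s⌋ + 1) ?_
    rw [stair, min_eq_left (by linarith), max_eq_right zero_le_one]
    push_cast
    rfl

/-- Entourages of a product of cubes contain those given by finitely many coordinates. -/
theorem exists_finset_forall_abs_sub_lt {Γ : Type*} {d : ℕ}
    {W : Set ((Γ → Fin d → unitInterval) × (Γ → Fin d → unitInterval))}
    (hW : W ∈ uniformity (Γ → Fin d → unitInterval)) :
    ∃ F : Finset Γ, ∃ ε : ℝ, 0 < ε ∧ ∀ x y : Γ → Fin d → unitInterval,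
      (∀ f ∈ F, ∀ i, |(x f i : ℝ) - y f i| < ε) → (x, y) ∈ W := by
  rw [Pi.uniformity, Filter.mem_iInf] at hW
  obtain ⟨I, hI, V, hV, rfl⟩ := hW
  have hev : ∀ f : I, ∀ᶠ ε in nhdsWithin (0 : ℝ) (Set.Ioi 0), ∀ x y : Γ → Fin d → unitInterval,
      (∀ i, |(x f i : ℝ) - y f i| < ε) → (x, y) ∈ V f := by
    intro f
    obtain ⟨A, hA, hAV⟩ := Filter.mem_comap.1 (hV f)
    obtain ⟨δ, hδ, hδA⟩ := Metric.mem_uniformity_dist.1 hA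
    filter_upwards [Ioo_mem_nhdsGT hδ] with ε hε x y hxy
    exact hAV (hδA (((dist_pi_lt_iff hε.1).2 fun i => hxy i).trans hε.2))
  have : Finite I := hI
  obtain ⟨ε, hε, hpos⟩ := ((Filter.eventually_all.2 hev).and self_mem_nhdsWithin).exists
  refine ⟨hI.toFinset, ε, hpos, fun x y hxy => mem_iInter.2 fun f => ?_⟩
  exact hε f x y (hxy f (by simp))

/-- The counting lemma: for an invariant measure, the events that the coordinates of a
configuration lie in disjoint sets have total measure at most one. -/
theorem sum_measureReal_shift_le_one {Γ : Type} [Group Γ] {K : Type*} [TopologicalSpace K]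
    [MeasurableSpace (Γ → K)] [BorelSpace (Γ → K)] {μ : ProbabilityMeasure (Γ → K)}
    (hμ : μ ∈ invProb (shiftHomeo Γ K)) (F : Finset Γ) (E : F → Set K)
    (hE : Pairwise (Function.onFun Disjoint E))
    (hm : ∀ f, MeasurableSet {x : Γ → K | x 1 ∈ E f}) :
    ∑ f : F, (μ : Measure (Γ → K)).real {x | x f ∈ E f} ≤ 1 := by
  have h : ∀ f : F, (μ : Measure (Γ → K)).real {x | x f ∈ E f} =
      (μ : Measure (Γ → K)).real {x | x 1 ∈ E f} := by
    intro f
    conv_rhs => rw [← hμ (f : Γ)⁻¹]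
    rw [map_measureReal_apply (shiftHomeo Γ K _).continuous.measurable (hm f)]
    simp [shiftHomeo, preimage]
  simp only [h]
  rw [← measureReal_iUnion_fintype _ hm]
  · exact measureReal_le_one
  · intro f g hfg
    exact (hE hfg).preimage fun x : Γ → K => x 1

theorem dimDyn_shiftHomeo_le (Γ : Type) [Group Γ] (d : ℕ)
    [MeasurableSpace (Γ → Fin d → unitInterval)]
    [BorelSpace (Γ → Fin d → unitInterval)] :
    dimDyn (shiftHomeo Γ (Fin d → unitInterval)) ≤ (d : ℝ≥0∞) := by
  refine iSup₂_le fun U hU => ?_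
  obtain ⟨W, hW, hWU⟩ := lebesgue_number_lemma_sUnion isCompact_univ hU.1 hU.2.ge
  obtain ⟨F, ε, hε, hFW⟩ := exists_finset_forall_abs_sub_lt hW
  obtain ⟨M, hM⟩ := exists_nat_gt (4 / ε)
  have hM0 : (0 : ℝ) < M := (div_pos four_pos hε).trans hM
  set n := F.card with hn
  set φ : F → ℝ → ℝ := fun f => stair n (F.equivFin f) with hφ
  set Y : (Γ → Fin d → unitInterval) → F × Fin d → ℝ :=
    fun x p => φ p.1 (M * x p.1 p.2) with hY
  have hYc : Continuous Y := continuous_pi fun p =>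
    (continuous_stair (F.equivFin p.1).2).comp (by fun_prop)
  set I : Finset (F × Fin d → ℤ) := Fintype.piFinset fun _ => Finset.Icc (-1) (M + 1 : ℤ) with hI
  set V : Finset (Set (Γ → Fin d → unitInterval)) := I.image fun v => Y ⁻¹' kuhnStar v with hV
  have hVcov : IsOpenCover V := by
    constructor
    · intro B hB
      obtain ⟨v, -, rfl⟩ := Finset.mem_image.1 hB
      exact (isOpen_kuhnStar v).preimage hYc
    · refine eq_univ_of_forall fun x => mem_sUnion.2
        ⟨_, Finset.mem_image_of_mem _ (Fintype.mem_piFinset.2 fun p => ?_),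
          mem_kuhnStar_ceil (Y x)⟩
      have h := abs_le.1 (abs_stair_sub_le n (F.equivFin p.1) (M * x p.1 p.2))
      have h0 : (0 : ℝ) ≤ M * x p.1 p.2 := mul_nonneg hM0.le (x p.1 p.2).2.1
      have h1 : (M : ℝ) * x p.1 p.2 ≤ M := mul_le_of_le_one_right hM0.le (x p.1 p.2).2.2
      have hYp : Y x p = stair n (F.equivFin p.1) (M * x p.1 p.2) := rfl
      rw [Finset.mem_Icc]
      constructor
      · have : ((-1 : ℤ) : ℝ) ≤ ⌈Y x p⌉ := by
          push_cast
          linarith [Int.le_ceil (Y x p)]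
        exact_mod_cast this
      · rw [Int.ceil_le]
        push_cast
        linarith
  have hVref : Refines U V := by
    intro B hB
    obtain ⟨v, -, rfl⟩ := Finset.mem_image.1 hB
    rcases (Y ⁻¹' kuhnStar v).eq_empty_or_nonempty with h | ⟨x, hx⟩
    · obtain ⟨A, hA, -⟩ := hWU (fun _ _ => 0) (mem_univ _)
      exact ⟨A, hA, h ▸ empty_subset A⟩
    · obtain ⟨A, hA, hxA⟩ := hWU x (mem_univ _)
      refine ⟨A, hA, fun y hy => hxA (hFW x y fun f hf i => ?_)⟩
      have hx1 := abs_lt.1 (hx.1 (⟨f, hf⟩, i))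
      have hy1 := abs_lt.1 (hy.1 (⟨f, hf⟩, i))
      have hx2 := abs_le.1 (abs_stair_sub_le n (F.equivFin ⟨f, hf⟩) (M * x f i))
      have hy2 := abs_le.1 (abs_stair_sub_le n (F.equivFin ⟨f, hf⟩) (M * y f i))
      have h4 : |(M : ℝ) * x f i - M * y f i| < 4 := by
        simp only [hY, hφ] at hx1 hy1
        rw [abs_lt]
        constructor <;> linarith
      rw [← mul_sub, abs_mul, abs_of_pos hM0] at h4
      rw [div_lt_iff₀ hε] at hM
      exact lt_of_mul_lt_mul_left (h4.trans hM) hM0.le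
  refine iInf₂_le_of_le V ⟨hVcov, hVref⟩ (iSup₂_le fun μ hμ => ?_)
  rw [← ENNReal.ofReal_natCast]
  refine ENNReal.ofReal_le_ofReal ?_
  set E : Fin d → F → Set (Fin d → unitInterval) := fun i f =>
    {t | ⌊n * Int.fract ((M : ℝ) * t i)⌋ = ((F.equivFin f : ℕ) : ℤ)} with hE
  have hmeas : ∀ i f (γ : Γ), MeasurableSet {x : Γ → Fin d → unitInterval | x γ ∈ E i f} := by
    intro i f γ
    have hc : Measurable fun x : Γ → Fin d → unitInterval => (M : ℝ) * x γ i :=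
      Continuous.measurable (by fun_prop)
    exact measurableSet_eq_fun (hc.fract.const_mul _).floor measurable_const
  have hdisj : ∀ i, Pairwise (Function.onFun Disjoint (E i)) := by
    intro i f g hfg
    refine Set.disjoint_left.2 fun t hf hg => hfg ?_
    have hfg' : ((F.equivFin f : ℕ) : ℤ) = (F.equivFin g : ℕ) := hf.symm.trans hg
    exact F.equivFin.injective (Fin.ext (by exact_mod_cast hfg'))
  have hord : ∀ x, ordAt V x ≤
      ∑ i, ∑ f : F, {x : Γ → Fin d → unitInterval | x f ∈ E i f}.indicator 1 x := by
    intro x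
    have h1 : (V.filter fun B => x ∈ B).card ≤ (I.filter fun v => Y x ∈ kuhnStar v).card := by
      rw [hV, Finset.filter_image]
      exact Finset.card_image_le
    have h2 := h1.trans (card_filter_mem_kuhnStar_le I (Y x))
    have h3 : (Finset.univ.filter fun p => ∀ m : ℤ, Y x p ≠ m).card ≤
        (Finset.univ.filter fun p : F × Fin d => x p.1 ∈ E p.2 p.1).card := by
      refine Finset.card_le_card fun p hp => ?_
      rw [Finset.mem_filter] at hp ⊢
      exact ⟨hp.1, floor_eq_of_stair_ne hp.2⟩
    have h4 : (((Finset.univ.filter fun p : F × Fin d => x p.1 ∈ E p.2 p.1).card : ℕ) : ℝ) =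
        ∑ i, ∑ f : F, {x : Γ → Fin d → unitInterval | x f ∈ E i f}.indicator 1 x := by
      rw [Finset.card_filter, Fintype.sum_prod_type_right]
      push_cast
      simp only [indicator_apply, mem_ofPred_eq, Pi.one_apply]
    have h5 : ((V.filter fun B => x ∈ B).card : ℝ) ≤
        (Finset.univ.filter fun p : F × Fin d => x p.1 ∈ E p.2 p.1).card + 1 := by
      exact_mod_cast h2.trans (Nat.add_le_add_right h3 1)
    rw [← h4, ordAt]
    linarith
  have hord0 : ∀ x, 0 ≤ ordAt V x := by
    intro x
    obtain ⟨B, hB, hxB⟩ := mem_sUnion.1 (hVcov.2 ▸ mem_univ x)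
    have : 0 < (V.filter fun B => x ∈ B).card :=
      Finset.card_pos.2 ⟨B, Finset.mem_filter.2 ⟨hB, hxB⟩⟩
    have : (1 : ℝ) ≤ (V.filter fun B => x ∈ B).card := by exact_mod_cast this
    rw [ordAt]
    linarith
  have hint : ∀ i (f : F), Integrable
      ({x : Γ → Fin d → unitInterval | x f ∈ E i f}.indicator (1 : (Γ → Fin d → unitInterval) → ℝ))
        (μ : Measure (Γ → Fin d → unitInterval)) :=
    fun i f => (integrable_const (1 : ℝ)).indicator (hmeas i f f)
  calc ∫ x, ordAt V x ∂(μ : Measure (Γ → Fin d → unitInterval))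
      ≤ ∫ x, ∑ i, ∑ f : F, {x : Γ → Fin d → unitInterval | x f ∈ E i f}.indicator 1 x
          ∂(μ : Measure (Γ → Fin d → unitInterval)) :=
        integral_mono_of_nonneg (Filter.Eventually.of_forall hord0)
          (integrable_finsetSum _ fun i _ => integrable_finsetSum _ fun f _ => hint i f)
          (Filter.Eventually.of_forall hord)
    _ = ∑ i, ∑ f : F, (μ : Measure (Γ → Fin d → unitInterval)).real {x | x f ∈ E i f} := by
        rw [integral_finsetSum _ fun i _ => integrable_finsetSum _ fun f _ => hint i f]
        refine Finset.sum_congr rfl fun i _ => ?_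
        rw [integral_finsetSum _ fun f _ => hint i f]
        exact Finset.sum_congr rfl fun f _ => integral_indicator_one (hmeas i f f)
    _ ≤ ∑ i : Fin d, 1 := Finset.sum_le_sum fun i _ =>
        sum_measureReal_shift_le_one hμ F (E i) (hdisj i) fun f => hmeas i f 1
    _ = d := by simp

/-- For any countable group Γ and any d, the dimension of the shift on ([0,1]^d)^Γ is d. -/
theorem stmt15 (Γ : Type) [Group Γ] [Countable Γ] (d : ℕ)
    [MeasurableSpace (Γ → Fin d → unitInterval)]
    [BorelSpace (Γ → Fin d → unitInterval)] :
    dimDyn (shiftHomeo Γ (Fin d → unitInterval)) = (d : ℝ≥0∞) := by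
  exact le_antisymm (dimDyn_shiftHomeo_le Γ d) (le_dimDyn_shiftHomeo Γ d)
end

section
/- Let Γ be a countable amenable group with Følner sequence (F_n), and let (X,T) be a Γ-dynamical system on a compact metric space. Then for any upper semicontinuous function f : X → [0,∞): sup_{μ∈Prob(X,T)} ∫_X f dμ = lim_{n→∞} (1/|F_n|) sup_{x∈X} Σ_{γ∈F_n} f(T_γ(x)) = inf_{F finite ⊆ Γ, F ≠ ∅} (1/|F|) sup_{x∈X} Σ_{γ∈F} f(T_γ(x)). -/
open MeasureTheory Set
open scoped ENNReal Classical

theorem UpperSemicontinuous.exists_forall_le {X : Type*} [TopologicalSpace X] [CompactSpace X]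
    {f : X → ℝ} (hf : UpperSemicontinuous f) : ∃ M, ∀ x, f x ≤ M := by
  obtain ⟨M, hM⟩ := (hf.upperSemicontinuousOn univ).bddAbove_of_isCompact isCompact_univ
  exact ⟨M, fun x => hM (mem_image_of_mem f (mem_univ x))⟩

/-- An upper semicontinuous function on a compact metric space is the pointwise limit of a sequence
of continuous functions that lie above it and share its upper bounds. -/
theorem UpperSemicontinuous.exists_continuous_approx {X : Type*} [MetricSpace X] [CompactSpace X]
    {f : X → ℝ} (hf : UpperSemicontinuous f) :
    ∃ g : ℕ → X → ℝ, (∀ k, Continuous (g k)) ∧ (∀ k x, f x ≤ g k x) ∧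
      (∀ k x C, (∀ y, f y ≤ C) → g k x ≤ C) ∧
      ∀ x, Filter.Tendsto (fun k => g k x) Filter.atTop (nhds (f x)) := by
  obtain ⟨M, hM⟩ := hf.exists_forall_le
  have hub : ∀ (k : ℕ) x y, f y - k * dist x y ≤ M := fun k x y => by
    have h₁ := hM y
    have h₂ : 0 ≤ (k : ℝ) * dist x y := by positivity
    linarith
  have hbdd : ∀ (k : ℕ) x, BddAbove (range fun y => f y - k * dist x y) := fun k x =>
    ⟨M, by rintro _ ⟨y, rfl⟩; exact hub k x y⟩
  have hle : ∀ (k : ℕ) x, f x ≤ ⨆ y, (f y - k * dist x y) := fun k x => by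
    simpa using le_ciSup (hbdd k x) x
  refine ⟨fun k x => ⨆ y, (f y - k * dist x y), fun k => ?_, hle, fun k x C hC => ?_, fun x => ?_⟩
  · refine (LipschitzWith.of_le_add_mul k fun x z => ?_).continuous
    have : Nonempty X := ⟨x⟩
    refine ciSup_le fun y => ?_
    have h₁ := le_ciSup (hbdd k z) y
    have h₂ : (k : ℝ) * dist z y ≤ k * (dist x z + dist x y) := by
      gcongr
      rw [dist_comm x z]
      exact dist_triangle z x y
    simp only [NNReal.coe_natCast]
    linarith
  · have : Nonempty X := ⟨x⟩
    refine ciSup_le fun y => ?_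
    have h₁ := hC y
    have h₂ : 0 ≤ (k : ℝ) * dist x y := by positivity
    linarith
  · refine tendsto_order.2 ⟨fun b hb => .of_forall fun k => hb.trans_le (hle k x), fun b hb => ?_⟩
    obtain ⟨c, hxc, hcb⟩ := exists_between hb
    obtain ⟨δ, hδ, hball⟩ := Metric.eventually_nhds_iff.1 (hf x c hxc)
    have hlarge : ∀ᶠ k : ℕ in Filter.atTop, (M - c) / δ ≤ k :=
      tendsto_natCast_atTop_atTop.eventually_ge_atTop _
    filter_upwards [hlarge] with k hk
    have : Nonempty X := ⟨x⟩
    refine (ciSup_le fun y => ?_ : _ ≤ c).trans_lt hcb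
    by_cases hy : dist y x < δ
    · have h₁ := hball hy
      have h₂ : 0 ≤ (k : ℝ) * dist x y := by positivity
      linarith
    · rw [div_le_iff₀ hδ] at hk
      have h₁ := hM y
      have h₂ : (k : ℝ) * δ ≤ k * dist x y := by
        rw [dist_comm x y]
        gcongr
        exact not_lt.1 hy
      linarith

theorem UpperSemicontinuous.integrable_of_nonneg {X : Type*} [MetricSpace X] [CompactSpace X]
    [MeasurableSpace X] [BorelSpace X] {f : X → ℝ} (hf : UpperSemicontinuous f)
    (hf0 : ∀ x, 0 ≤ f x) (μ : Measure X) [IsFiniteMeasure μ] : Integrable f μ := by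
  obtain ⟨M, hM⟩ := hf.exists_forall_le
  refine Integrable.of_bound hf.measurable.aestronglyMeasurable M (.of_forall fun x => ?_)
  rw [Real.norm_of_nonneg (hf0 x)]
  exact hM x

/-- Upper semicontinuity of the integral of a nonnegative upper semicontinuous function under weak
convergence of probability measures. -/
theorem UpperSemicontinuous.le_integral_of_tendsto {X ι : Type*} [MetricSpace X] [CompactSpace X]
    [MeasurableSpace X] [BorelSpace X] {f : X → ℝ} (hf : UpperSemicontinuous f)
    (hf0 : ∀ x, 0 ≤ f x) {l : Filter ι} [l.NeBot] {ν : ι → ProbabilityMeasure X}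
    {μ : ProbabilityMeasure X} (hν : Filter.Tendsto ν l (nhds μ)) {c : ℝ}
    (hc : ∀ᶠ i in l, c ≤ ∫ x, f x ∂(ν i : Measure X)) : c ≤ ∫ x, f x ∂(μ : Measure X) := by
  obtain ⟨M, hM⟩ := hf.exists_forall_le
  obtain ⟨g, hg, hfg, hgM, hlim⟩ := hf.exists_continuous_approx
  have hfint : ∀ k (ρ : ProbabilityMeasure X), Integrable (g k) (ρ : Measure X) := fun k ρ =>
    (BoundedContinuousFunction.mkOfCompact ⟨g k, hg k⟩).integrable _
  have hgc : ∀ k, c ≤ ∫ x, g k x ∂(μ : Measure X) := fun k => by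
    refine ge_of_tendsto ((ProbabilityMeasure.tendsto_iff_forall_integral_tendsto.1 hν)
      (BoundedContinuousFunction.mkOfCompact ⟨g k, hg k⟩)) ?_
    filter_upwards [hc] with i hi
    exact hi.trans (integral_mono (hf.integrable_of_nonneg hf0 _) (hfint k _) (hfg k))
  refine ge_of_tendsto' (tendsto_integral_of_dominated_convergence (fun _ => M)
    (fun k => (hfint k μ).aestronglyMeasurable) (integrable_const _) (fun k => .of_forall fun x => ?_)
    (.of_forall hlim)) hgc
  rw [Real.norm_of_nonneg ((hf0 x).trans (hfg k x))]
  exact hgM k x M hM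

/-- The uniform probability measure on the points `p i`, `i ∈ s`, counted with multiplicity. -/
noncomputable def empiricalMeasure {X ι : Type*} [MeasurableSpace X] (s : Finset ι) (p : ι → X) :
    Measure X :=
  (s.card : ℝ≥0∞)⁻¹ • ∑ i ∈ s, Measure.dirac (p i)

theorem isProbabilityMeasure_empiricalMeasure {X ι : Type*} [MeasurableSpace X] {s : Finset ι}
    (hs : s.Nonempty) (p : ι → X) : IsProbabilityMeasure (empiricalMeasure s p) := by
  refine ⟨?_⟩
  simp only [empiricalMeasure, Measure.smul_apply, Measure.coe_finsetSum, Finset.sum_apply,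
    measure_univ, Finset.sum_const, smul_eq_mul, nsmul_eq_mul, mul_one]
  exact ENNReal.inv_mul_cancel (by simpa using hs.ne_empty) (by simp)

theorem integral_empiricalMeasure {X ι : Type*} [MeasurableSpace X] [MeasurableSingletonClass X]
    (s : Finset ι) (p : ι → X) (f : X → ℝ) :
    ∫ x, f x ∂(empiricalMeasure s p) = (∑ i ∈ s, f (p i)) / s.card := by
  rw [empiricalMeasure, integral_smul_measure,
    integral_finsetSum_measure fun i _ => integrable_dirac (by simp)]
  simp [integral_dirac, div_eq_inv_mul]

theorem abs_sum_sub_sum_le_card_symmDiff {ι : Type*} (A B : Finset ι) (h : ι → ℝ) {C : ℝ}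
    (hC : ∀ i, |h i| ≤ C) : |∑ i ∈ A, h i - ∑ i ∈ B, h i| ≤ (symmDiff A B).card * C := by
  have hA := Finset.sum_sdiff_sub_sum_sdiff (s₁ := B) (s₂ := A) (f := h)
  have h₁ : |∑ i ∈ A \ B, h i| ≤ (A \ B).card * C := by
    refine (Finset.abs_sum_le_sum_abs _ _).trans ?_
    simpa using Finset.sum_le_card_nsmul (A \ B) (fun i => |h i|) C fun i _ => hC i
  have h₂ : |∑ i ∈ B \ A, h i| ≤ (B \ A).card * C := by
    refine (Finset.abs_sum_le_sum_abs _ _).trans ?_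
    simpa using Finset.sum_le_card_nsmul (B \ A) (fun i => |h i|) C fun i _ => hC i
  have hcard : (symmDiff A B).card = (A \ B).card + (B \ A).card := by
    rw [symmDiff_def, Finset.sup_eq_union, Finset.card_union_of_disjoint disjoint_sdiff_sdiff]
  rw [← hA, hcard]
  push_cast
  refine (abs_sub _ _).trans ?_
  linarith

/-- A weak limit of empirical measures along Følner sets of orbits is invariant. -/
theorem mem_invProb_of_tendsto_empiricalMeasure {X Γ ι : Type*} [MetricSpace X] [CompactSpace X]
    [MeasurableSpace X] [BorelSpace X] [Group Γ] (T : Γ → X ≃ₜ X)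
    (hT : ∀ γ γ' : Γ, ∀ x : X, T (γ * γ') x = T γ (T γ' x)) {l : Filter ι} [l.NeBot]
    (F : ι → Finset Γ)
    (hFol : ∀ γ : Γ, Filter.Tendsto
      (fun n => ((symmDiff ((F n).image fun x => γ * x) (F n)).card : ℝ) / (F n).card) l (nhds 0))
    (x : ι → X) {ν : ι → ProbabilityMeasure X}
    (hν : ∀ n, (ν n : Measure X) = empiricalMeasure (F n) fun γ => T γ (x n))
    {μ : ProbabilityMeasure X} (hμ : Filter.Tendsto ν l (nhds μ)) : μ ∈ invProb T := by
  intro γ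
  have : IsProbabilityMeasure ((μ : Measure X).map (T γ)) :=
    Measure.isProbabilityMeasure_map (T γ).continuous.measurable.aemeasurable
  refine ext_of_forall_integral_eq_of_IsFiniteMeasure fun g => ?_
  rw [integral_map (T γ).continuous.measurable.aemeasurable
    g.continuous.measurable.aestronglyMeasurable]
  have hlim := ProbabilityMeasure.tendsto_iff_forall_integral_tendsto.1 hμ
  have h₁ := (hlim (g.compContinuous ⟨T γ, (T γ).continuous⟩)).sub (hlim g)
  refine sub_eq_zero.1 (tendsto_nhds_unique h₁ ?_)
  refine squeeze_zero_norm (fun n => ?_) (zero_mul ‖g‖ ▸ (hFol γ).mul_const ‖g‖)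
  have himage : ∑ δ ∈ F n, g (T γ (T δ (x n))) =
      ∑ δ ∈ (F n).image fun δ => γ * δ, g (T δ (x n)) := by
    rw [Finset.sum_image fun _ _ _ _ h => mul_left_cancel h]
    simp only [hT]
  simp only [hν, integral_empiricalMeasure, BoundedContinuousFunction.compContinuous_apply,
    ContinuousMap.coe_mk]
  rw [himage, ← sub_div, Real.norm_eq_abs, abs_div, Nat.abs_cast, div_mul_eq_mul_div]
  gcongr
  exact abs_sum_sub_sum_le_card_symmDiff _ _ _ fun δ => g.norm_coe_le_norm _

theorem UpperSemicontinuous.sum_comp_homeomorph {X Γ : Type*} [TopologicalSpace X]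
    {f : X → ℝ} (hf : UpperSemicontinuous f) (T : Γ → X ≃ₜ X) (F : Finset Γ) :
    UpperSemicontinuous fun x => ∑ γ ∈ F, f (T γ x) :=
  upperSemicontinuous_sum fun γ _ => hf.comp (T γ).continuous

theorem integral_le_iSup_sum_div_card {X Γ : Type*} [MetricSpace X] [CompactSpace X]
    [MeasurableSpace X] [BorelSpace X] {f : X → ℝ} (hf : UpperSemicontinuous f)
    (hf0 : ∀ x, 0 ≤ f x) (T : Γ → X ≃ₜ X) {F : Finset Γ}
    (hF : F.Nonempty) {μ : ProbabilityMeasure X} (hμ : μ ∈ invProb T) :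
    ∫ x, f x ∂(μ : Measure X) ≤ (⨆ x, ∑ γ ∈ F, f (T γ x)) / F.card := by
  have hcard : (0 : ℝ) < F.card := by exact_mod_cast hF.card_pos
  obtain ⟨M, hM⟩ := (hf.sum_comp_homeomorph T F).exists_forall_le
  have hfint : ∀ γ ∈ F, Integrable (fun x => f (T γ x)) (μ : Measure X) := fun γ _ =>
    (hf.comp (T γ).continuous).integrable_of_nonneg (fun x => hf0 _) _
  have hinv : ∀ γ ∈ F, ∫ x, f (T γ x) ∂(μ : Measure X) = ∫ x, f x ∂(μ : Measure X) := fun γ _ => by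
    conv_rhs => rw [← hμ γ]
    rw [integral_map (T γ).continuous.measurable.aemeasurable
      hf.measurable.aestronglyMeasurable]
  have hsum : ∫ x, ∑ γ ∈ F, f (T γ x) ∂(μ : Measure X) = F.card * ∫ x, f x ∂(μ : Measure X) := by
    rw [integral_finsetSum _ hfint, Finset.sum_congr rfl hinv, Finset.sum_const, nsmul_eq_mul]
  rw [le_div_iff₀ hcard, mul_comm, ← hsum]
  calc ∫ x, ∑ γ ∈ F, f (T γ x) ∂(μ : Measure X)
      ≤ ∫ _, (⨆ x, ∑ γ ∈ F, f (T γ x)) ∂(μ : Measure X) := by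
        refine integral_mono (integrable_finsetSum _ hfint) (integrable_const _) fun x => ?_
        exact le_ciSup (f := fun x => ∑ γ ∈ F, f (T γ x))
          ⟨M, by rintro _ ⟨y, rfl⟩; exact hM y⟩ x
    _ = ⨆ x, ∑ γ ∈ F, f (T γ x) := by simp

theorem exists_sum_eq_iSup {X Γ : Type*} [TopologicalSpace X] [CompactSpace X] [Nonempty X]
    {f : X → ℝ} (hf : UpperSemicontinuous f) (T : Γ → X ≃ₜ X) (F : Finset Γ) :
    ∃ x, ∑ γ ∈ F, f (T γ x) = ⨆ y, ∑ γ ∈ F, f (T γ y) := by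
  obtain ⟨x, -, hx⟩ := UpperSemicontinuousOn.exists_isMaxOn univ_nonempty isCompact_univ
    ((hf.sum_comp_homeomorph T F).upperSemicontinuousOn univ)
  have hx' : ∀ y, ∑ γ ∈ F, f (T γ y) ≤ ∑ γ ∈ F, f (T γ x) := fun y => hx (mem_univ y)
  exact ⟨x, le_antisymm (le_ciSup (f := fun x => ∑ γ ∈ F, f (T γ x))
    ⟨_, by rintro _ ⟨y, rfl⟩; exact hx' y⟩ x) (ciSup_le hx')⟩

/-- If the normalized maximal orbital sums along a Følner sequence are frequently at least `c`, then
some invariant measure gives `f` integral at least `c`. -/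
theorem exists_mem_invProb_le_integral {X Γ : Type*} [MetricSpace X] [CompactSpace X] [Nonempty X]
    [MeasurableSpace X] [BorelSpace X] [Group Γ] {f : X → ℝ}
    (T : Γ → X ≃ₜ X) (hT : ∀ γ γ' : Γ, ∀ x : X, T (γ * γ') x = T γ (T γ' x))
    (F : ℕ → Finset Γ) (hFne : ∀ n, (F n).Nonempty)
    (hFol : ∀ γ : Γ, Filter.Tendsto
      (fun n => ((symmDiff ((F n).image fun x => γ * x) (F n)).card : ℝ) / (F n).card)
      Filter.atTop (nhds 0))
    (hf : UpperSemicontinuous f) (hf0 : ∀ x, 0 ≤ f x) {c : ℝ}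
    (hc : ∃ᶠ n in Filter.atTop, c ≤ (⨆ x : X, ∑ γ ∈ F n, f (T γ x)) / (F n).card) :
    ∃ μ ∈ invProb T, c ≤ ∫ x, f x ∂(μ : Measure X) := by
  obtain ⟨U, hUle⟩ := Filter.exists_ultrafilter_iff.2 (Filter.frequently_mem_iff_neBot
    (s := {n | c ≤ (⨆ x : X, ∑ γ ∈ F n, f (T γ x)) / (F n).card}).1 hc)
  have hU : (U : Filter ℕ) ≤ Filter.atTop := hUle.trans inf_le_left
  have hUc : {n | c ≤ (⨆ x : X, ∑ γ ∈ F n, f (T γ x)) / (F n).card} ∈ (U : Filter ℕ) :=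
    Filter.le_principal_iff.1 (hUle.trans inf_le_right)
  choose x hx using fun n => exists_sum_eq_iSup hf T (F n)
  let ν : ℕ → ProbabilityMeasure X := fun n =>
    ⟨empiricalMeasure (F n) fun γ => T γ (x n), isProbabilityMeasure_empiricalMeasure (hFne n) _⟩
  obtain ⟨μ, -, hμ⟩ := isCompact_univ.ultrafilter_le_nhds (U.map ν) (by simp)
  have hμ' : Filter.Tendsto ν U (nhds μ) := hμ
  refine ⟨μ, mem_invProb_of_tendsto_empiricalMeasure T hT F (fun γ => (hFol γ).mono_left hU) x
    (fun n => rfl) hμ', hf.le_integral_of_tendsto hf0 hμ' ?_⟩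
  filter_upwards [hUc] with n hn
  rwa [← hx n, ← integral_empiricalMeasure (F n) (fun γ => T γ (x n)) f] at hn

/-- Maximal ergodic average: for an action of a countable amenable group (with Følner
sequence F) on a compact metric space and an upper semicontinuous f : X → [0,∞),
the supremum over invariant measures of ∫ f dμ equals the limit along the Følner sequence
of the normalized maximal orbital sums, and also equals the infimum over nonempty finite
subsets F' ⊆ Γ of the normalized maximal F'-sums. -/
theorem stmt16 {X Γ : Type*} [MetricSpace X] [CompactSpace X] [MeasurableSpace X] [BorelSpace X]
    [Group Γ] [Countable Γ] (T : Γ → X ≃ₜ X)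
    (hT : ∀ γ γ' : Γ, ∀ x : X, T (γ * γ') x = T γ (T γ' x))
    (F : ℕ → Finset Γ) (hFne : ∀ n, (F n).Nonempty)
    (hFol : ∀ γ : Γ, Filter.Tendsto
      (fun n => ((symmDiff ((F n).image fun x => γ * x) (F n)).card : ℝ) / (F n).card)
      Filter.atTop (nhds 0))
    (f : X → ℝ) (hf : UpperSemicontinuous f) (hf0 : ∀ x, 0 ≤ f x) :
    Filter.Tendsto
      (fun n => ENNReal.ofReal ((⨆ x : X, ∑ γ ∈ F n, f (T γ x)) / (F n).card))
      Filter.atTop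
      (nhds (⨆ μ ∈ invProb T, ENNReal.ofReal (∫ x, f x ∂(μ : Measure X)))) ∧
    (⨆ μ ∈ invProb T, ENNReal.ofReal (∫ x, f x ∂(μ : Measure X))) =
      ⨅ F' : {F' : Finset Γ // F'.Nonempty},
        ENNReal.ofReal ((⨆ x : X, ∑ γ ∈ F'.1, f (T γ x)) / F'.1.card) := by
  set S : ℝ≥0∞ := ⨆ μ ∈ invProb T, ENNReal.ofReal (∫ x, f x ∂(μ : Measure X))
  have hlower : ∀ F' : Finset Γ, F'.Nonempty →
      S ≤ ENNReal.ofReal ((⨆ x : X, ∑ γ ∈ F', f (T γ x)) / F'.card) := fun F' hF' =>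
    iSup₂_le fun μ hμ =>
      ENNReal.ofReal_le_ofReal (integral_le_iSup_sum_div_card hf hf0 T hF' hμ)
  have hlim : Filter.Tendsto
      (fun n => ENNReal.ofReal ((⨆ x : X, ∑ γ ∈ F n, f (T γ x)) / (F n).card))
      Filter.atTop (nhds S) := by
    refine tendsto_order.2 ⟨fun b hb => .of_forall fun n => hb.trans_le (hlower _ (hFne n)),
      fun b hb => ?_⟩
    by_contra hfreq
    obtain ⟨c, hSc, hcb⟩ := ENNReal.lt_iff_exists_nnreal_btwn.1 hb
    have hc0 : (0 : ℝ) < c := by exact_mod_cast (zero_le (a := S)).trans_lt hSc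
    have hc : ∃ᶠ n in Filter.atTop,
        (c : ℝ) ≤ (⨆ x : X, ∑ γ ∈ F n, f (T γ x)) / (F n).card := by
      refine (Filter.not_eventually.1 hfreq).mono fun n hn => ?_
      have h := hcb.le.trans (not_lt.1 hn)
      rwa [← ENNReal.ofReal_coe_nnreal, ENNReal.ofReal_le_ofReal_iff', or_iff_left hc0.not_ge] at h
    have : Nonempty X := by
      by_contra hX
      rw [not_nonempty_iff] at hX
      obtain ⟨n, hn⟩ := hc.exists
      rw [Real.iSup_of_isEmpty, zero_div] at hn
      exact hn.not_gt hc0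
    obtain ⟨μ, hμ, hcμ⟩ := exists_mem_invProb_le_integral T hT F hFne hFol hf hf0 hc
    refine hSc.not_ge ?_
    rw [← ENNReal.ofReal_coe_nnreal]
    exact (ENNReal.ofReal_le_ofReal hcμ).trans (le_iSup₂ (f := fun (μ : ProbabilityMeasure X)
      (_ : μ ∈ invProb T) => ENNReal.ofReal (∫ x, f x ∂(μ : Measure X))) μ hμ)
  exact ⟨hlim, le_antisymm (le_iInf fun F' => hlower F'.1 F'.2)
    (ge_of_tendsto' hlim fun n => iInf_le_of_le ⟨F n, hFne n⟩ le_rfl)⟩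
end

section
/- Let (X,T) be a distal Γ-dynamical system. Then any continuous equivariant almost embedding f : X → Y into a Γ-dynamical system (Y,S) is a topological embedding. -/
open MeasureTheory Set

/-- Shannon entropy of the partition of a measure space into the fibres of a labelling `R`. -/
noncomputable def labelEntropy {X ι : Type*} [MeasurableSpace X] [Fintype ι] (ν : Measure X)
    (R : X → ι) : ℝ :=
  ∑ i, Real.negMulLog (ν.real (R ⁻¹' {i}))

/-- The `ℓ¹` distance between the distributions of a labelling `R` before and after composing
it with a transformation `g`. -/
noncomputable def labelShift {X ι : Type*} [MeasurableSpace X] [Fintype ι] (ν : Measure X)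
    (R : X → ι) (g : X → X) : ℝ :=
  ∑ i, |ν.real (g ⁻¹' (R ⁻¹' {i})) - ν.real (R ⁻¹' {i})|

section Label

variable {X ι κ : Type*} [MeasurableSpace X] [Fintype ι] [Fintype κ]

lemma sum_measureReal_preimage_inter (ν : Measure X) [IsFiniteMeasure ν] {R : X → ι}
    (hR : ∀ i, MeasurableSet (R ⁻¹' {i})) (s : Set X) :
    ∑ i, ν.real (R ⁻¹' {i} ∩ s) = ν.real s := by
  have h : ν.real s = ν.real (⋃ i ∈ (Finset.univ : Finset ι), (R ⁻¹' {i} ∩ s)) := by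
    congr 1
    ext x
    simp
  rw [h]
  have h2 : ∀ i : ι, ν.real (R ⁻¹' {i} ∩ s) = (ν.restrict s).real (R ⁻¹' {i}) := fun i => by
    rw [measureReal_restrict_apply (hR i)]
  simp_rw [h2]
  rw [← measureReal_biUnion_finset (fun i _ j _ hij => ?_) (fun i _ => hR i)]
  · rw [measureReal_restrict_apply (Finset.measurableSet_biUnion _ fun i _ => hR i)]
    congr 1
    ext x
    simp
  · exact Disjoint.preimage _ (by simpa using hij)

lemma sum_measureReal_preimage (ν : Measure X) [IsProbabilityMeasure ν] {R : X → ι}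
    (hR : ∀ i, MeasurableSet (R ⁻¹' {i})) :
    ∑ i, ν.real (R ⁻¹' {i}) = 1 := by
  simpa using sum_measureReal_preimage_inter ν hR univ

lemma labelEntropy_nonneg (ν : Measure X) [IsProbabilityMeasure ν] (R : X → ι) :
    0 ≤ labelEntropy ν R :=
  Finset.sum_nonneg fun _ _ => Real.negMulLog_nonneg measureReal_nonneg measureReal_le_one

lemma negMulLog_le_one {x : ℝ} (h0 : 0 ≤ x) : Real.negMulLog x ≤ 1 := by
  have := Real.negMulLog_le_one_sub_self h0
  linarith

lemma labelEntropy_le_card (ν : Measure X) (R : X → ι) :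
    labelEntropy ν R ≤ Fintype.card ι := by
  calc labelEntropy ν R ≤ ∑ _i : ι, (1 : ℝ) :=
        Finset.sum_le_sum fun i _ => negMulLog_le_one measureReal_nonneg
    _ = _ := by simp

lemma labelEntropy_equiv_comp (ν : Measure X) (e : ι ≃ κ) (R : X → ι) :
    labelEntropy ν (e ∘ R) = labelEntropy ν R := by
  refine (Fintype.sum_equiv e _ _ fun i => ?_).symm
  congr 2
  ext x
  simp

lemma labelEntropy_prodMk_le (ν : Measure X) [IsProbabilityMeasure ν] {R : X → ι} {S : X → κ}
    (hR : ∀ i, MeasurableSet (R ⁻¹' {i})) (hS : ∀ j, MeasurableSet (S ⁻¹' {j})) :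
    labelEntropy ν (fun x => (R x, S x)) ≤ labelEntropy ν R + labelEntropy ν S := by
  set r : ι → ℝ := fun i => ν.real (R ⁻¹' {i}) with hr
  set s : κ → ℝ := fun j => ν.real (S ⁻¹' {j}) with hs
  set p : ι → κ → ℝ := fun i j => ν.real (R ⁻¹' {i} ∩ S ⁻¹' {j}) with hp
  have hpr : ∀ i, ∑ j, p i j = r i := fun i => by
    simp_rw [hp, inter_comm (R ⁻¹' {i})]
    exact sum_measureReal_preimage_inter ν hS _
  have hps : ∀ j, ∑ i, p i j = s j := fun j => sum_measureReal_preimage_inter ν hR _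
  have hr1 : ∑ i, r i = 1 := sum_measureReal_preimage ν hR
  have hs1 : ∑ j, s j = 1 := sum_measureReal_preimage ν hS
  have key : ∀ i j, Real.negMulLog (p i j)
      ≤ -(p i j * Real.log (r i)) - p i j * Real.log (s j) - p i j + r i * s j := fun i j => by
    have hp0 : 0 ≤ p i j := measureReal_nonneg
    have hpr : p i j ≤ r i := measureReal_mono inter_subset_left
    have hps : p i j ≤ s j := measureReal_mono inter_subset_right
    rcases hp0.eq_or_lt with h | h
    · rw [← h]
      simpa using mul_nonneg (hp0.trans hpr) (hp0.trans hps)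
    · have hri := h.trans_le hpr
      have hsj := h.trans_le hps
      have hlog := Real.log_le_sub_one_of_pos (div_pos (mul_pos hri hsj) h)
      rw [Real.log_div (by positivity) h.ne', Real.log_mul hri.ne' hsj.ne'] at hlog
      have := mul_le_mul_of_nonneg_left hlog h.le
      have h3 : p i j * (r i * s j / p i j - 1) = r i * s j - p i j := by field_simp
      rw [h3] at this
      unfold Real.negMulLog
      linarith
  have hL : labelEntropy ν (fun x => (R x, S x)) = ∑ i, ∑ j, Real.negMulLog (p i j) := by
    rw [labelEntropy, Fintype.sum_prod_type]
    refine Finset.sum_congr rfl fun i _ => Finset.sum_congr rfl fun j _ => ?_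
    congr 2
    ext x
    simp
  rw [hL]
  refine (Finset.sum_le_sum fun i _ => Finset.sum_le_sum fun j _ => key i j).trans_eq ?_
  have e1 : ∑ i, ∑ j, p i j * Real.log (r i) = ∑ i, r i * Real.log (r i) :=
    Finset.sum_congr rfl fun i _ => by rw [← Finset.sum_mul, hpr]
  have e2 : ∑ i, ∑ j, p i j * Real.log (s j) = ∑ j, s j * Real.log (s j) := by
    rw [Finset.sum_comm]
    exact Finset.sum_congr rfl fun i _ => by rw [← Finset.sum_mul, hps]
  have e3 : ∑ i, ∑ j, p i j = 1 := by simp_rw [hpr, hr1]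
  have e4 : ∑ i, ∑ j, r i * s j = 1 := by simp_rw [← Finset.mul_sum, hs1, mul_one, hr1]
  simp only [Finset.sum_add_distrib, Finset.sum_sub_distrib, Finset.sum_neg_distrib, e1, e2, e3,
    e4, labelEntropy, Real.negMulLog, neg_mul]
  ring

lemma labelEntropy_indicators_le (ν : Measure X) [IsProbabilityMeasure ν] (N : ℕ)
    {A : ℕ → Set X} (hA : ∀ n, MeasurableSet (A n)) [∀ n x, Decidable (x ∈ A n)] :
    labelEntropy ν (fun x (n : Fin N) => decide (x ∈ A n))
      ≤ ∑ n ∈ Finset.range N, Real.binEntropy (ν.real (A n)) := by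
  have hb : ∀ n b, MeasurableSet ((fun x => decide (x ∈ A n)) ⁻¹' {b}) := fun n b => by
    cases b
    · convert (hA n).compl using 1
      ext x
      simp
    · convert hA n using 1
      ext x
      simp
  induction N with
  | zero =>
    have : ∀ i : Fin 0 → Bool, (fun x (n : Fin 0) => decide (x ∈ A n)) ⁻¹' {i} = univ :=
      fun i => by
        ext x
        simpa using Subsingleton.elim _ _
    simp [labelEntropy, this]
  | succ N ih =>
    have h1 : (fun x (n : Fin (N + 1)) => decide (x ∈ A n)) =
        (Fin.snocEquiv fun _ => Bool) ∘
          fun x => (decide (x ∈ A N), fun n : Fin N => decide (x ∈ A n)) := by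
      ext x n
      refine Fin.lastCases ?_ (fun i => ?_) n <;> simp [Fin.snocEquiv]
    have h2 : labelEntropy ν (fun x => decide (x ∈ A N)) = Real.binEntropy (ν.real (A N)) := by
      have e1 : (fun x => decide (x ∈ A N)) ⁻¹' {true} = A N := by ext x; simp
      have e2 : (fun x => decide (x ∈ A N)) ⁻¹' {false} = (A N)ᶜ := by ext x; simp
      rw [labelEntropy, Fintype.sum_bool, e1, e2, probReal_compl_eq_one_sub (hA N),
        Real.binEntropy_eq_negMulLog_add_negMulLog_one_sub]
    rw [h1, labelEntropy_equiv_comp, Finset.sum_range_succ]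
    refine (labelEntropy_prodMk_le ν (hb N) fun j => ?_).trans ?_
    · have : (fun x (n : Fin N) => decide (x ∈ A n)) ⁻¹' {j}
          = ⋂ n : Fin N, (fun x => decide (x ∈ A n)) ⁻¹' {j n} := by
        ext x
        simp [funext_iff]
      rw [this]
      exact MeasurableSet.iInter fun n => hb n _
    · rw [h2]
      linarith

lemma labelShift_comp_le (ν : Measure X) [IsFiniteMeasure ν] {R : X → ι} (φ : ι → κ)
    {g : X → X} (hR : ∀ i, MeasurableSet (R ⁻¹' {i})) (hg : Measurable g) :
    labelShift ν (φ ∘ R) g ≤ labelShift ν R g := by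
  classical
  have h1 : ∀ (T : X → ι), (∀ i, MeasurableSet (T ⁻¹' {i})) → ∀ j,
      ν.real ((φ ∘ T) ⁻¹' {j}) = ∑ i with φ i = j, ν.real (T ⁻¹' {i}) := fun T hT j => by
    rw [← measureReal_biUnion_finset (fun i _ k _ hik => ?_) (fun i _ => hT i)]
    · congr 1
      ext x
      simp
    · exact Disjoint.preimage _ (by simpa using hik)
  have h2 := h1 R hR
  have h3 := h1 (R ∘ g) fun i => hg (hR i)
  calc labelShift ν (φ ∘ R) g
      = ∑ j, |∑ i with φ i = j, (ν.real (g ⁻¹' (R ⁻¹' {i})) - ν.real (R ⁻¹' {i}))| := by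
        refine Finset.sum_congr rfl fun j _ => ?_
        rw [Finset.sum_sub_distrib, h2]
        congr 2
        exact h3 j
    _ ≤ ∑ j, ∑ i with φ i = j, |ν.real (g ⁻¹' (R ⁻¹' {i})) - ν.real (R ⁻¹' {i})| :=
        Finset.sum_le_sum fun j _ => Finset.abs_sum_le_sum_abs _ _
    _ = labelShift ν R g := Finset.sum_fiberwise _ _ _

lemma abs_measureReal_preimage_sub_le_labelShift (ν : Measure X) [IsFiniteMeasure ν] {R : X → ι}
    {g : X → X} (hR : ∀ i, MeasurableSet (R ⁻¹' {i})) (hg : Measurable g) (S : Set ι) :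
    |ν.real (g ⁻¹' (R ⁻¹' S)) - ν.real (R ⁻¹' S)| ≤ labelShift ν R g := by
  classical
  have h := labelShift_comp_le ν (fun i => decide (i ∈ S)) hR hg
  refine le_trans ?_ h
  have hS : R ⁻¹' S = ((fun i => decide (i ∈ S)) ∘ R) ⁻¹' {true} := by
    ext x
    simp
  rw [hS, labelShift]
  exact Finset.single_le_sum (f := fun b : Bool => |ν.real (g ⁻¹' (((fun i => decide (i ∈ S)) ∘ R)
    ⁻¹' {b})) - ν.real (((fun i => decide (i ∈ S)) ∘ R) ⁻¹' {b})|) (fun _ _ => abs_nonneg _)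
    (Finset.mem_univ true)

end Label

section Gap

variable {Γ : Type*} [MeasurableSpace Γ] [DiscreteMeasurableSpace Γ]

lemma integrable_of_discrete_of_bound [Countable Γ] (μ : Measure Γ)
    [IsFiniteMeasure μ] {F : Γ → ℝ} (C : ℝ)
    (h : ∀ γ, |F γ| ≤ C) : Integrable F μ :=
  Integrable.of_bound Measurable.of_discrete.aestronglyMeasurable C (.of_forall h)

lemma negMulLog_le_tangent_sub_hellinger {q r : ℝ} (hq : 0 ≤ q) (hr : 0 < r) :
    Real.negMulLog q ≤ -(q * Real.log r) - q + r - (√q - √r) ^ 2 := by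
  have hsq : (√q - √r) ^ 2 = q + r - 2 * (√q * √r) := by
    rw [sub_sq, Real.sq_sqrt hq, Real.sq_sqrt hr.le]
    ring
  rw [hsq]
  rcases hq.eq_or_lt with h | h
  · rw [← h]
    simp
  · have hsr := Real.sqrt_pos.2 hr
    have hsq := Real.sqrt_pos.2 h
    have hlog := Real.log_le_sub_one_of_pos (div_pos hsr hsq)
    rw [Real.log_div hsr.ne' hsq.ne', Real.log_sqrt hr.le, Real.log_sqrt hq] at hlog
    have h1 := mul_le_mul_of_nonneg_left hlog h.le
    have h2 : q * (√r / √q - 1) = √q * √r - q := by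
      field_simp
      linear_combination (-√r) * Real.sq_sqrt hq
    rw [h2] at h1
    unfold Real.negMulLog
    linarith

lemma integral_hellinger_le_negMulLog_gap [Countable Γ] (μ : Measure Γ)
    [IsProbabilityMeasure μ] {q : Γ → ℝ}
    (h0 : ∀ γ, 0 ≤ q γ) (h1 : ∀ γ, q γ ≤ 1) {r : ℝ} (hr : r = ∫ γ, q γ ∂μ) :
    ∫ γ, (√(q γ) - √r) ^ 2 ∂μ ≤ Real.negMulLog r - ∫ γ, Real.negMulLog (q γ) ∂μ := by
  have hr0 : 0 ≤ r := hr ▸ integral_nonneg h0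
  have hqi : Integrable q μ := integrable_of_discrete_of_bound μ 1 fun γ => by
    rw [abs_of_nonneg (h0 γ)]
    exact h1 γ
  rcases hr0.eq_or_lt with h | h
  · have hq : q =ᵐ[μ] 0 := (integral_eq_zero_iff_of_nonneg h0 hqi).1 (hr.symm.trans h.symm)
    have e1 : ∫ γ, (√(q γ) - √r) ^ 2 ∂μ = 0 := integral_eq_zero_of_ae <| by
      filter_upwards [hq] with γ hγ
      simp [hγ, ← h]
    have e2 : ∫ γ, Real.negMulLog (q γ) ∂μ = 0 := integral_eq_zero_of_ae <| by
      filter_upwards [hq] with γ hγ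
      simp [hγ]
    rw [e1, e2, ← h]
    simp
  · have hr1 : r ≤ 1 := by
      rw [hr]
      refine (integral_mono hqi (integrable_const 1) h1).trans_eq (by simp)
    have i1 : Integrable (fun γ => Real.negMulLog (q γ)) μ :=
      integrable_of_discrete_of_bound μ 1 fun γ => by
        rw [abs_of_nonneg (Real.negMulLog_nonneg (h0 γ) (h1 γ))]
        exact negMulLog_le_one (h0 γ)
    have i2 : Integrable (fun γ => (√(q γ) - √r) ^ 2) μ :=
      integrable_of_discrete_of_bound μ 1 fun γ => by
        rw [abs_of_nonneg (sq_nonneg _), sq_le_one_iff_abs_le_one, abs_le]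
        have := Real.sqrt_nonneg (q γ)
        have := Real.sqrt_nonneg r
        have := Real.sqrt_le_one.2 (h1 γ)
        have := Real.sqrt_le_one.2 hr1
        constructor <;> linarith
    have key : ∫ γ, (Real.negMulLog (q γ) + (√(q γ) - √r) ^ 2) ∂μ
        ≤ ∫ γ, (q γ * (-Real.log r - 1) + r) ∂μ :=
      integral_mono (i1.add i2) ((hqi.mul_const _).add (integrable_const _)) fun γ => by
        have := negMulLog_le_tangent_sub_hellinger (h0 γ) h
        simp only
        linarith
    rw [integral_add i1 i2, integral_add (hqi.mul_const _) (integrable_const _),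
      integral_mul_const, ← hr, integral_const, probReal_univ, one_smul] at key
    have : Real.negMulLog r = r * (-Real.log r - 1) + r := by
      unfold Real.negMulLog
      ring
    linarith

lemma sq_sum_abs_sub_le_hellinger {ι : Type*} [Fintype ι] {q r : ι → ℝ} (hq : ∀ i, 0 ≤ q i)
    (hr : ∀ i, 0 ≤ r i) (hq1 : ∑ i, q i = 1) (hr1 : ∑ i, r i = 1) :
    (∑ i, |q i - r i|) ^ 2 ≤ 4 * ∑ i, (√(q i) - √(r i)) ^ 2 := by
  have h1 : ∀ i, |q i - r i| = |√(q i) - √(r i)| * (√(q i) + √(r i)) := fun i => by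
    rw [← abs_of_nonneg (add_nonneg (Real.sqrt_nonneg (q i)) (Real.sqrt_nonneg (r i))), ← abs_mul]
    congr 1
    nlinarith [Real.sq_sqrt (hq i), Real.sq_sqrt (hr i)]
  simp_rw [h1]
  refine (Finset.sum_mul_sq_le_sq_mul_sq _ _ _).trans ?_
  have h2 : ∑ i, (√(q i) + √(r i)) ^ 2 ≤ 4 := by
    calc ∑ i, (√(q i) + √(r i)) ^ 2 ≤ ∑ i, (2 * q i + 2 * r i) :=
          Finset.sum_le_sum fun i _ => by
            nlinarith [Real.sq_sqrt (hq i), Real.sq_sqrt (hr i), sq_nonneg (√(q i) - √(r i))]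
      _ = 4 := by
          rw [Finset.sum_add_distrib, ← Finset.mul_sum, ← Finset.mul_sum, hq1, hr1]
          norm_num
  simp_rw [sq_abs]
  rw [mul_comm]
  exact mul_le_mul_of_nonneg_right h2 (Finset.sum_nonneg fun _ _ => sq_nonneg _)

end Gap

/-- The measure `ν` equals the `μ`-average of its translates. -/
def IsStationaryFor {X Γ : Type*} [MeasurableSpace X] [MeasurableSpace Γ] [SMul Γ X]
    (μ : Measure Γ) (ν : Measure X) : Prop :=
  ∀ B : Set X, MeasurableSet B → ν.real B = ∫ γ, ν.real ((γ • · : X → X) ⁻¹' B) ∂μ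

section Shift

variable {X Γ ι : Type*} [MeasurableSpace X] [MeasurableSpace Γ] [DiscreteMeasurableSpace Γ]
  [Countable Γ] [SMul Γ X] [MeasurableConstSMul Γ X] [Fintype ι]

lemma labelShift_nonneg (ν : Measure X) (R : X → ι) (g : X → X) : 0 ≤ labelShift ν R g :=
  Finset.sum_nonneg fun _ _ => abs_nonneg _

lemma labelShift_sq_le (ν : Measure X) [IsProbabilityMeasure ν] {R : X → ι}
    (hR : ∀ i, MeasurableSet (R ⁻¹' {i})) {g : X → X} (hg : Measurable g) :
    labelShift ν R g ^ 2 ≤ 4 * ∑ i, (√(ν.real (g ⁻¹' (R ⁻¹' {i}))) - √(ν.real (R ⁻¹' {i}))) ^ 2 :=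
  sq_sum_abs_sub_le_hellinger (fun _ => measureReal_nonneg) (fun _ => measureReal_nonneg)
    (sum_measureReal_preimage ν (R := R ∘ g) fun i => hg (hR i)) (sum_measureReal_preimage ν hR)

lemma labelShift_le_two (ν : Measure X) [IsProbabilityMeasure ν] {R : X → ι}
    (hR : ∀ i, MeasurableSet (R ⁻¹' {i})) {g : X → X} (hg : Measurable g) :
    labelShift ν R g ≤ 2 := by
  have h1 : ∑ i, ν.real (g ⁻¹' (R ⁻¹' {i})) = 1 :=
    sum_measureReal_preimage ν (R := R ∘ g) fun i => hg (hR i)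
  calc labelShift ν R g
      ≤ ∑ i, (ν.real (g ⁻¹' (R ⁻¹' {i})) + ν.real (R ⁻¹' {i})) :=
        Finset.sum_le_sum fun i _ => by
          have := measureReal_nonneg (μ := ν) (s := R ⁻¹' {i})
          have := measureReal_nonneg (μ := ν) (s := g ⁻¹' (R ⁻¹' {i}))
          rw [abs_le]
          constructor <;> linarith
    _ = 2 := by
        rw [Finset.sum_add_distrib, h1, sum_measureReal_preimage ν hR]
        norm_num

lemma labelShift_sq_le_four (ν : Measure X) [IsProbabilityMeasure ν] {R : X → ι}
    (hR : ∀ i, MeasurableSet (R ⁻¹' {i})) {g : X → X} (hg : Measurable g) :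
    |labelShift ν R g ^ 2| ≤ 4 := by
  have := labelShift_nonneg ν R g
  have := labelShift_le_two ν hR hg
  rw [abs_of_nonneg (sq_nonneg _)]
  nlinarith

lemma abs_labelEntropy_le_card (ν : Measure X) [IsProbabilityMeasure ν] (R : X → ι) :
    |labelEntropy ν R| ≤ Fintype.card ι := by
  rw [abs_of_nonneg (labelEntropy_nonneg ν R)]
  exact labelEntropy_le_card ν R

lemma integral_labelShift_sq_le {μ : Measure Γ} [IsProbabilityMeasure μ] {ν : Measure X}
    [IsProbabilityMeasure ν] (hν : IsStationaryFor μ ν) {R : X → ι}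
    (hR : ∀ i, MeasurableSet (R ⁻¹' {i})) :
    ∫ γ, labelShift ν R (γ • · : X → X) ^ 2 ∂μ
      ≤ 4 * (labelEntropy ν R - ∫ γ, labelEntropy ν (R ∘ (γ • · : X → X)) ∂μ) := by
  have hb : ∀ (γ : Γ) (i : ι),
      |(√(ν.real ((γ • · : X → X) ⁻¹' (R ⁻¹' {i}))) - √(ν.real (R ⁻¹' {i}))) ^ 2| ≤ 1 :=
    fun γ i => by
      rw [abs_of_nonneg (sq_nonneg _), sq_le_one_iff_abs_le_one, abs_le]
      have := Real.sqrt_nonneg (ν.real ((γ • · : X → X) ⁻¹' (R ⁻¹' {i})))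
      have := Real.sqrt_nonneg (ν.real (R ⁻¹' {i}))
      have := Real.sqrt_le_one.2 (measureReal_le_one (μ := ν) (s := R ⁻¹' {i}))
      have := Real.sqrt_le_one.2
        (measureReal_le_one (μ := ν) (s := (γ • · : X → X) ⁻¹' (R ⁻¹' {i})))
      constructor <;> linarith
  have hi : ∀ i : ι, Integrable (fun γ : Γ =>
      (√(ν.real ((γ • · : X → X) ⁻¹' (R ⁻¹' {i}))) - √(ν.real (R ⁻¹' {i}))) ^ 2) μ := fun i =>
    integrable_of_discrete_of_bound μ 1 fun γ => hb γ i
  calc ∫ γ, labelShift ν R (γ • · : X → X) ^ 2 ∂μ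
      ≤ ∫ γ, 4 * ∑ i, (√(ν.real ((γ • · : X → X) ⁻¹' (R ⁻¹' {i}))) -
          √(ν.real (R ⁻¹' {i}))) ^ 2 ∂μ :=
        integral_mono (integrable_of_discrete_of_bound μ 4 fun γ =>
          labelShift_sq_le_four ν hR (measurable_const_smul γ))
          ((integrable_finsetSum _ fun i _ => hi i).const_mul 4)
          fun γ => labelShift_sq_le ν hR (measurable_const_smul γ)
    _ = 4 * ∑ i, ∫ γ, (√(ν.real ((γ • · : X → X) ⁻¹' (R ⁻¹' {i}))) -
          √(ν.real (R ⁻¹' {i}))) ^ 2 ∂μ := by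
        rw [integral_const_mul, integral_finsetSum _ fun i _ => hi i]
    _ ≤ 4 * ∑ i, (Real.negMulLog (ν.real (R ⁻¹' {i})) -
          ∫ γ, Real.negMulLog (ν.real ((γ • · : X → X) ⁻¹' (R ⁻¹' {i}))) ∂μ) := by
        gcongr with i
        exact integral_hellinger_le_negMulLog_gap μ (fun _ => measureReal_nonneg)
          (fun _ => measureReal_le_one) (hν _ (hR i))
    _ = _ := by
        rw [Finset.sum_sub_distrib, ← integral_finsetSum]
        · rfl
        · exact fun i _ => integrable_of_discrete_of_bound μ 1 fun γ => by
            rw [abs_of_nonneg (Real.negMulLog_nonneg measureReal_nonneg measureReal_le_one)]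
            exact negMulLog_le_one measureReal_nonneg

end Shift

/-- Prepend a term to a sequence. -/
def consSeq {Γ : Type*} (γ : Γ) (w : ℕ → Γ) : ℕ → Γ
  | 0 => γ
  | n + 1 => w n

/-- The position at time `k` of the left random walk with increments `w`. -/
def walk {Γ : Type*} [Monoid Γ] (w : ℕ → Γ) : ℕ → Γ
  | 0 => 1
  | k + 1 => w k * walk w k

/-- The first `L` positions of the walk with increments `w`. -/
def walkPrefix {Γ : Type*} [Monoid Γ] (L : ℕ) (w : ℕ → Γ) : Fin L → Γ := fun k => walk w k

/-- The itinerary of `x` along the transformations `u`, as seen through the labelling `ξ`. -/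
def itinerary {X Γ κ : Type*} [SMul Γ X] {L : ℕ} (u : Fin L → Γ) (ξ : X → κ) (x : X) :
    Fin L → κ := fun k => ξ (u k • x)

lemma walk_consSeq_succ {Γ : Type*} [Monoid Γ] (γ : Γ) (w : ℕ → Γ) (k : ℕ) :
    walk (consSeq γ w) (k + 1) = walk w k * γ := by
  induction k with
  | zero => simp [walk, consSeq]
  | succ k ih => rw [walk, ih, walk, mul_assoc, consSeq]

lemma itinerary_walkPrefix_consSeq {X Γ κ : Type*} [Monoid Γ] [MulAction Γ X] (L : ℕ) (γ : Γ)
    (w : ℕ → Γ) (ξ : X → κ) :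
    itinerary (walkPrefix (L + 1) (consSeq γ w)) ξ =
      (Fin.consEquiv fun _ => κ) ∘
        fun x => (ξ x, (itinerary (walkPrefix L w) ξ ∘ (γ • · : X → X)) x) := by
  ext x k
  refine Fin.cases ?_ (fun k => ?_) k
  · simp [itinerary, walkPrefix, walk]
  · simp [itinerary, walkPrefix, walk_consSeq_succ, mul_smul]

section Walk

variable {Γ : Type*} [MeasurableSpace Γ]

lemma measurable_consSeq : Measurable fun p : Γ × (ℕ → Γ) => consSeq p.1 p.2 :=
  measurable_pi_iff.2 fun n => by
    cases n with
    | zero => exact measurable_fst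
    | succ n => exact (measurable_pi_apply n).comp measurable_snd

lemma map_consSeq_prod_infinitePi (μ : Measure Γ) [IsProbabilityMeasure μ] :
    (μ.prod (Measure.infinitePi fun _ : ℕ => μ)).map (fun p => consSeq p.1 p.2) =
      Measure.infinitePi fun _ : ℕ => μ := by
  refine Measure.eq_infinitePi _ fun s t ht => ?_
  set s' : Finset ℕ := s.preimage Nat.succ Nat.succ_injective.injOn with hs'
  have hpre : (fun p : Γ × (ℕ → Γ) => consSeq p.1 p.2) ⁻¹' (Set.pi s t) =
      {γ | 0 ∈ s → γ ∈ t 0} ×ˢ Set.pi s' fun n => t (n + 1) := by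
    ext p
    simp only [mem_preimage, Set.mem_pi, mem_prod, Set.mem_ofPred_eq, Finset.mem_coe, hs',
      Finset.mem_preimage]
    constructor
    · exact fun h => ⟨fun h0 => h 0 h0, fun n hn => h (n + 1) hn⟩
    · rintro ⟨h0, h1⟩ (_ | n) hn
      · exact h0 hn
      · exact h1 n hn
  rw [Measure.map_apply measurable_consSeq (MeasurableSet.pi s.countable_toSet fun i _ => ht i),
    hpre, Measure.prod_prod, Measure.infinitePi_pi _ fun i _ => ht _]
  have herase : s.erase 0 = s'.map ⟨Nat.succ, Nat.succ_injective⟩ := by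
    ext n
    cases n <;> simp [hs']
  have h1 : ∏ i ∈ s.erase 0, μ (t i) = ∏ i ∈ s', μ (t (i + 1)) := by
    rw [herase, Finset.prod_map]
    rfl
  by_cases h0 : 0 ∈ s
  · rw [← Finset.mul_prod_erase _ _ h0, h1]
    simp [h0]
  · rw [← h1, Finset.erase_eq_of_notMem h0]
    simp [h0]

lemma measurable_walk [Countable Γ] [DiscreteMeasurableSpace Γ] [Monoid Γ] (k : ℕ) :
    Measurable fun w : ℕ → Γ => walk w k := by
  induction k with
  | zero => exact measurable_const
  | succ k ih =>
    exact (Measurable.of_discrete (f := fun p : Γ × Γ => p.1 * p.2)).comp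
      ((measurable_pi_apply k).prodMk ih)

lemma measurable_walkPrefix [Countable Γ] [DiscreteMeasurableSpace Γ] [Monoid Γ] (L : ℕ) :
    Measurable fun w : ℕ → Γ => walkPrefix L w :=
  measurable_pi_iff.2 fun k => measurable_walk k

lemma integrable_of_walkPrefix [Countable Γ] [DiscreteMeasurableSpace Γ] [Monoid Γ]
    (P : Measure (ℕ → Γ)) [IsFiniteMeasure P] {L : ℕ} (F : (Fin L → Γ) → ℝ) (C : ℝ)
    (h : ∀ u, |F u| ≤ C) : Integrable (fun w => F (walkPrefix L w)) P :=
  Integrable.of_bound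
    ((Measurable.of_discrete (f := F)).comp (measurable_walkPrefix L)).aestronglyMeasurable C
    (.of_forall fun _ => h _)

lemma integral_infinitePi_eq_integral_consSeq [Countable Γ] [DiscreteMeasurableSpace Γ] [Monoid Γ]
    (μ : Measure Γ) [IsProbabilityMeasure μ] {L : ℕ} (F : (Fin L → Γ) → ℝ) (C : ℝ)
    (h : ∀ u, |F u| ≤ C) :
    ∫ w, F (walkPrefix L w) ∂(Measure.infinitePi fun _ : ℕ => μ) =
      ∫ w, ∫ γ, F (walkPrefix L (consSeq γ w)) ∂μ ∂(Measure.infinitePi fun _ : ℕ => μ) := by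
  have hm : Measurable fun w => F (walkPrefix L w) :=
    (Measurable.of_discrete (f := F)).comp (measurable_walkPrefix L)
  conv_lhs => rw [← map_consSeq_prod_infinitePi μ]
  rw [integral_map measurable_consSeq.aemeasurable hm.aestronglyMeasurable]
  exact integral_prod_symm _ (Integrable.of_bound
    (hm.comp measurable_consSeq).aestronglyMeasurable C (.of_forall fun w => h _))

end Walk

section Itinerary

variable {X Γ κ : Type*} [MeasurableSpace X] [Monoid Γ] [MulAction Γ X] [MeasurableConstSMul Γ X]

lemma measurableSet_itinerary_preimage {L : ℕ} (u : Fin L → Γ) {ξ : X → κ}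
    (hξ : ∀ i, MeasurableSet (ξ ⁻¹' {i})) (j : Fin L → κ) :
    MeasurableSet (itinerary u ξ ⁻¹' {j}) := by
  have : itinerary u ξ ⁻¹' {j} = ⋂ k, (u k • · : X → X) ⁻¹' (ξ ⁻¹' {j k}) := by
    ext x
    simp [itinerary, funext_iff]
  rw [this]
  exact MeasurableSet.iInter fun k => measurable_const_smul (u k) (hξ _)

lemma labelShift_itinerary_le_succ [Fintype κ] (ν : Measure X) [IsFiniteMeasure ν] (L : ℕ) (w : ℕ → Γ)
    {ξ : X → κ} (hξ : ∀ i, MeasurableSet (ξ ⁻¹' {i})) {g : X → X} (hg : Measurable g) :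
    labelShift ν (itinerary (walkPrefix L w) ξ) g
      ≤ labelShift ν (itinerary (walkPrefix (L + 1) w) ξ) g :=
  labelShift_comp_le (R := itinerary (walkPrefix (L + 1) w) ξ) ν
    (fun (u : Fin (L + 1) → κ) (k : Fin L) => u k.castSucc)
    (fun j => measurableSet_itinerary_preimage (walkPrefix (L + 1) w) hξ j) hg

/-- Along a stationary random walk, the future itinerary of a labelling of small entropy is
almost independent of the last increment. -/
lemma integral_integral_labelShift_sq_le [Fintype κ] [MeasurableSpace Γ]
    [DiscreteMeasurableSpace Γ] [Countable Γ] (μ : Measure Γ) [IsProbabilityMeasure μ] {ν : Measure X}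
    [IsProbabilityMeasure ν] (hν : IsStationaryFor μ ν) {ξ : X → κ}
    (hξ : ∀ i, MeasurableSet (ξ ⁻¹' {i})) (L : ℕ) :
    ∫ w, ∫ γ, labelShift ν (itinerary (walkPrefix L w) ξ) (γ • · : X → X) ^ 2 ∂μ
      ∂(Measure.infinitePi fun _ : ℕ => μ) ≤ 4 * labelEntropy ν ξ := by
  set P : Measure (ℕ → Γ) := Measure.infinitePi fun _ : ℕ => μ with hP
  set E : ℕ → ℝ := fun L => ∫ w, labelEntropy ν (itinerary (walkPrefix L w) ξ) ∂P with hE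
  set D : ℕ → ℝ := fun L =>
    ∫ w, ∫ γ, labelShift ν (itinerary (walkPrefix L w) ξ) (γ • · : X → X) ^ 2 ∂μ ∂P with hD
  change D L ≤ _
  have hms := fun (L : ℕ) (u : Fin L → Γ) => measurableSet_itinerary_preimage u hξ
  have hsq : ∀ (L : ℕ) (u : Fin L → Γ) (γ : Γ),
      |labelShift ν (itinerary u ξ) (γ • · : X → X) ^ 2| ≤ 4 := fun L u γ =>
    labelShift_sq_le_four ν (hms L u) (measurable_const_smul γ)
  have hDint : ∀ L, Integrable (fun w =>
      ∫ γ, labelShift ν (itinerary (walkPrefix L w) ξ) (γ • · : X → X) ^ 2 ∂μ) P := fun L =>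
    integrable_of_walkPrefix P
      (fun u => ∫ γ, labelShift ν (itinerary u ξ) (γ • · : X → X) ^ 2 ∂μ) 4 fun u => by
        simpa using norm_integral_le_of_norm_le_const (μ := μ) (C := 4)
          (f := fun γ => labelShift ν (itinerary u ξ) (γ • · : X → X) ^ 2)
          (Filter.Eventually.of_forall fun γ => hsq L u γ)
  have hEint : ∀ L, Integrable (fun w => labelEntropy ν (itinerary (walkPrefix L w) ξ)) P :=
    fun L => integrable_of_walkPrefix P (fun u => labelEntropy ν (itinerary u ξ)) _
      fun u => abs_labelEntropy_le_card ν _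
  have hEγ : ∀ L (w : ℕ → Γ), Integrable (fun γ =>
      labelEntropy ν (itinerary (walkPrefix L w) ξ ∘ (γ • · : X → X))) μ := fun L w =>
    integrable_of_discrete_of_bound μ _ fun γ => abs_labelEntropy_le_card ν _
  have hDmono : Monotone D := monotone_nat_of_le_succ fun L =>
    integral_mono (hDint L) (hDint (L + 1)) fun w =>
      integral_mono (integrable_of_discrete_of_bound μ 4 fun γ => hsq L _ γ)
        (integrable_of_discrete_of_bound μ 4 fun γ => hsq (L + 1) _ γ) fun γ =>
        pow_le_pow_left₀ (labelShift_nonneg _ _ _)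
          (labelShift_itinerary_le_succ ν L w hξ (measurable_const_smul γ)) 2
  have hstep : ∀ L, E (L + 1) ≤ E L + labelEntropy ν ξ - D L / 4 := fun L => by
    have hpt : ∀ w : ℕ → Γ,
        ∫ γ, labelEntropy ν (itinerary (walkPrefix (L + 1) (consSeq γ w)) ξ) ∂μ
          ≤ labelEntropy ν ξ + labelEntropy ν (itinerary (walkPrefix L w) ξ) -
            (∫ γ, labelShift ν (itinerary (walkPrefix L w) ξ) (γ • · : X → X) ^ 2 ∂μ) / 4 :=
      fun w => by
        have h1 := integral_labelShift_sq_le hν (hms L (walkPrefix L w))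
        have h2 : ∫ γ, labelEntropy ν (itinerary (walkPrefix (L + 1) (consSeq γ w)) ξ) ∂μ
            ≤ ∫ γ, (labelEntropy ν ξ +
              labelEntropy ν (itinerary (walkPrefix L w) ξ ∘ (γ • · : X → X))) ∂μ :=
          integral_mono (integrable_of_discrete_of_bound μ _ fun γ => abs_labelEntropy_le_card ν _)
            ((integrable_const _).add (hEγ L w)) fun γ => by
              simp only
              rw [itinerary_walkPrefix_consSeq, labelEntropy_equiv_comp]
              exact labelEntropy_prodMk_le ν hξ
                fun j => measurable_const_smul γ (hms L (walkPrefix L w) j)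
        rw [integral_add (integrable_const _) (hEγ L w), integral_const, probReal_univ,
          one_smul] at h2
        linarith
    have h3 : E (L + 1) =
        ∫ w, ∫ γ, labelEntropy ν (itinerary (walkPrefix (L + 1) (consSeq γ w)) ξ) ∂μ ∂P :=
      integral_infinitePi_eq_integral_consSeq μ (fun u => labelEntropy ν (itinerary u ξ)) _
        fun u => abs_labelEntropy_le_card ν _
    rw [h3]
    refine (integral_mono_of_nonneg (.of_forall fun w => integral_nonneg fun γ =>
      labelEntropy_nonneg _ _) (((integrable_const _).add (hEint L)).sub ((hDint L).div_const 4))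
      (.of_forall hpt)).trans_eq ?_
    have h4 := integral_sub ((integrable_const (labelEntropy ν ξ)).add (hEint L))
      ((hDint L).div_const 4)
    have h5 := integral_add (integrable_const (μ := P) (labelEntropy ν ξ)) (hEint L)
    rw [integral_const, probReal_univ, one_smul] at h5
    simp only [Pi.add_apply] at h4
    refine h4.trans ?_
    rw [h5, integral_div]
    ring
  have hiter : ∀ j : ℕ, E (L + j) ≤ E L + j * (labelEntropy ν ξ - D L / 4) := fun j => by
    induction j with
    | zero => simp
    | succ j ih =>
      have h1 := hstep (L + j)
      have h2 := hDmono (Nat.le_add_right L j)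
      rw [← add_assoc]
      push_cast
      linarith
  by_contra hlt
  have hpos : 0 < D L / 4 - labelEntropy ν ξ := by linarith
  obtain ⟨j, hj⟩ := exists_nat_gt (E L / (D L / 4 - labelEntropy ν ξ))
  rw [div_lt_iff₀ hpos] at hj
  have h1 := hiter j
  have h2 : 0 ≤ E (L + j) := integral_nonneg fun w => labelEntropy_nonneg _ _
  linarith

end Itinerary

section Hitting

variable {X Γ : Type*} [TopologicalSpace X] [CompactSpace X] [Group Γ] [MulAction Γ X]
  [ContinuousConstSMul Γ X] [MulAction.IsMinimal Γ X] [Countable Γ] [MeasurableSpace Γ]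
  [DiscreteMeasurableSpace Γ]

/-- In a minimal system, the random walk driven by a fully supported measure almost surely enters
any given nonempty open set. -/
lemma ae_exists_walk_smul_mem {μ : Measure Γ} [IsProbabilityMeasure μ] (hμ : ∀ γ, μ {γ} ≠ 0)
    {U : Set X} (hU : IsOpen U) (hne : U.Nonempty) (x : X) :
    ∀ᵐ w ∂(Measure.infinitePi fun _ : ℕ => μ), ∃ k, walk w k • x ∈ U := by
  set P : Measure (ℕ → Γ) := Measure.infinitePi fun _ : ℕ => μ with hP
  set N : X → Set (ℕ → Γ) := fun y => {w | ∀ k, walk w k • y ∉ U} with hN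
  have hNm : ∀ y, MeasurableSet (N y) := fun y => by
    have : N y = ⋂ k, (fun w => walk w k) ⁻¹' {γ : Γ | γ • y ∉ U} := by
      ext w
      simp [hN]
    rw [this]
    exact MeasurableSet.iInter fun k => measurable_walk k (MeasurableSet.of_discrete)
  have hNU : ∀ y ∈ U, P (N y) = 0 := fun y hy => by
    have : N y = ∅ := eq_empty_of_forall_notMem fun w hw => hw 0 (by simpa [walk] using hy)
    rw [this, measure_empty]
  have hle : ∀ y, P (N y) ≤ ∫⁻ γ, P (N (γ • y)) ∂μ := fun y => by
    have h1 : P (N y) = (μ.prod P) ((fun p => consSeq p.1 p.2) ⁻¹' N y) := by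
      conv_lhs => rw [hP, ← map_consSeq_prod_infinitePi μ]
      exact Measure.map_apply measurable_consSeq (hNm y)
    rw [h1, Measure.prod_apply (measurable_consSeq (hNm y))]
    refine lintegral_mono fun γ => measure_mono fun w hw k => ?_
    have := hw (k + 1)
    rwa [walk_consSeq_succ, mul_smul] at this
  obtain ⟨I, hI⟩ := isCompact_univ.exists_finite_cover_smul Γ hU hne
  set p := I.inf fun g => μ {g⁻¹} with hp
  have hp0 : 0 < p := by
    rw [hp, Finset.lt_inf_iff ENNReal.zero_lt_top]
    exact fun g _ => pos_iff_ne_zero.2 (hμ _)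
  set s := ⨆ y, P (N y) with hs
  have hs1 : s ≤ 1 := iSup_le fun y => prob_le_one
  have hstep : ∀ y, P (N y) ≤ s * (1 - p) := fun y => by
    obtain ⟨g, hg, hgy⟩ := mem_iUnion₂.1 (hI (mem_univ y))
    have hgU : g⁻¹ • y ∈ U := mem_smul_set_iff_inv_smul_mem.1 hgy
    calc P (N y) ≤ ∫⁻ γ, P (N (γ • y)) ∂μ := hle y
      _ ≤ ∫⁻ γ, ({g⁻¹}ᶜ : Set Γ).indicator (fun _ => s) γ ∂μ := lintegral_mono fun γ => by
          by_cases h : γ = g⁻¹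
          · simp [h, hNU _ hgU]
          · simpa [h] using le_iSup (fun y => P (N y)) (γ • y)
      _ = s * μ {g⁻¹}ᶜ := by
          rw [lintegral_indicator (MeasurableSet.of_discrete), setLIntegral_const]
      _ ≤ s * (1 - p) := by
          rw [prob_compl_eq_one_sub MeasurableSet.of_discrete]
          exact mul_le_mul_right (tsub_le_tsub_left (Finset.inf_le (f := fun g => μ {g⁻¹}) hg) _) _
  have hs0 : s = 0 := by
    by_contra h0
    have h1 : s ≤ s * (1 - p) := iSup_le hstep
    have h2 : s * (1 - p) < s * 1 := (ENNReal.mul_lt_mul_iff_right h0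
      (ne_top_of_le_ne_top ENNReal.one_ne_top hs1)).2
      (ENNReal.sub_lt_self ENNReal.one_ne_top one_ne_zero hp0.ne')
    rw [mul_one] at h2
    exact h1.not_gt h2
  have h0 : P (N x) = 0 := le_antisymm (hs0 ▸ le_iSup (fun y => P (N y)) x) bot_le
  filter_upwards [measure_eq_zero_iff_ae_notMem.1 h0] with w hw
  simpa [hN] using hw

lemma ae_ae_forall_exists_walk_smul_mem [MeasurableSpace X] [BorelSpace X] {μ : Measure Γ}
    [IsProbabilityMeasure μ] (hμ : ∀ γ, μ {γ} ≠ 0) (ν : Measure X) [SFinite ν] {A : ℕ → Set X}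
    (hA : ∀ n, IsOpen (A n)) (hne : ∀ n, (A n).Nonempty) :
    ∀ᵐ w ∂(Measure.infinitePi fun _ : ℕ => μ), ∀ᵐ x ∂ν, ∀ n, ∃ k, walk w k • x ∈ A n := by
  have h : ∀ n, ∀ᵐ w ∂(Measure.infinitePi fun _ : ℕ => μ), ∀ᵐ x ∂ν, ∃ k, walk w k • x ∈ A n :=
    fun n => by
      refine (Measure.ae_ae_comm ?_).2 (.of_forall (ae_exists_walk_smul_mem hμ (hA n) (hne n)))
      have hsmul : Measurable fun p : Γ × X => p.1 • p.2 :=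
        measurable_from_prod_countable_right fun γ => measurable_const_smul γ
      have : {p : (ℕ → Γ) × X | ∃ k, walk p.1 k • p.2 ∈ A n} =
          ⋃ k, (fun p : (ℕ → Γ) × X => walk p.1 k • p.2) ⁻¹' A n := by
        ext p
        simp
      rw [this]
      exact MeasurableSet.iUnion fun k => (hsmul.comp
        (((measurable_walk k).comp measurable_fst).prodMk measurable_snd)) (hA n).measurableSet
  filter_upwards [ae_all_iff.2 h] with w hw using ae_all_iff.2 hw

end Hitting

section Approximation

variable {X Γ : Type*} [MeasurableSpace X]

/-- If countably many Boolean labels separate almost all points of a standard Borel space, then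
finitely many of them determine a given event up to small probability. -/
lemma exists_cylinder_symmDiff_lt [StandardBorelSpace X] (ν : Measure X) [IsFiniteMeasure ν]
    {ι : Type*} [Countable ι] {Φ : X → ι → Bool} (hΦ : Measurable Φ) {Z : Set X}
    (hZ : MeasurableSet Z) (hZν : ν Zᶜ = 0) (hinj : InjOn Φ Z) {B : Set X} (hB : MeasurableSet B)
    {ε : ENNReal} (hε : 0 < ε) :
    ∃ (s : Finset ι) (S : Set (s → Bool)), ν (symmDiff (Φ ⁻¹' cylinder s S) B) < ε := by
  have hB' : MeasurableSet (Φ '' (B ∩ Z)) := (hB.inter hZ).image_of_measurable_injOn hΦ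
    (hinj.mono inter_subset_right)
  obtain ⟨t, ht, hlt⟩ := exists_measure_symmDiff_lt_of_generateFrom_isSetRing
    (μ := ν.map Φ) (C := measurableCylinders fun _ : ι => Bool) isSetRing_measurableCylinders
    ⟨{univ}, countable_singleton _, by simpa using univ_mem_measurableCylinders fun _ : ι => Bool,
      by simp⟩
    generateFrom_measurableCylinders.symm hB' hε
  obtain ⟨s, S, -, rfl⟩ := (mem_measurableCylinders _).1 ht
  refine ⟨s, S, lt_of_le_of_lt ?_ hlt⟩
  rw [Measure.map_apply hΦ ((MeasurableSet.of_mem_measurableCylinders ht).symmDiff hB')]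
  refine measure_mono_ae ?_
  have hae : ∀ᵐ x ∂ν, x ∈ Z := by
    rw [ae_iff]
    exact hZν
  filter_upwards [hae] with x hx hmem
  have hiff : Φ x ∈ Φ '' (B ∩ Z) ↔ x ∈ B :=
    ⟨fun ⟨y, hy, hyx⟩ => hinj hy.2 hx hyx ▸ hy.1, fun h => ⟨x, ⟨h, hx⟩, rfl⟩⟩
  rcases hmem with ⟨h1, h2⟩ | ⟨h1, h2⟩
  · exact Or.inl ⟨h1, fun h => h2 (hiff.1 h)⟩
  · exact Or.inr ⟨hiff.2 h1, h2⟩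

open Classical in
/-- The labels recording membership in the first `N` sets of a sequence. -/
noncomputable def memLabels (A : ℕ → Set X) (N : ℕ) (x : X) : Fin N → Bool :=
  fun n => decide (x ∈ A n)

/-- The least error in guessing an event `B` from the itinerary along `u` with respect to the
first `L` sets of a sequence. -/
noncomputable def guessError [SMul Γ X] (ν : Measure X) (A : ℕ → Set X) (B : Set X) (L : ℕ)
    (u : Fin L → Γ) : ℝ :=
  ⨅ S : Set (Fin L → Fin L → Bool), ν.real (symmDiff (itinerary u (memLabels A L) ⁻¹' S) B)

lemma measurableSet_memLabels_preimage {A : ℕ → Set X} (hA : ∀ n, MeasurableSet (A n)) (N : ℕ)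
    (i : Fin N → Bool) : MeasurableSet (memLabels A N ⁻¹' {i}) := by
  have : memLabels A N ⁻¹' {i} = ⋂ n : Fin N, if i n then A n else (A n)ᶜ := by
    ext x
    simp only [memLabels, mem_preimage, mem_singleton_iff, funext_iff, mem_iInter]
    refine forall_congr' fun n => ?_
    cases h : i n <;> simp
  rw [this]
  refine MeasurableSet.iInter fun n => ?_
  split_ifs
  exacts [hA n, (hA n).compl]

lemma exists_guessError_eq [SMul Γ X] (ν : Measure X) (A : ℕ → Set X) (B : Set X) (L : ℕ)
    (u : Fin L → Γ) : ∃ S : Set (Fin L → Fin L → Bool),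
      ν.real (symmDiff (itinerary u (memLabels A L) ⁻¹' S) B) = guessError ν A B L u :=
  exists_eq_ciInf_of_finite

lemma guessError_nonneg [SMul Γ X] (ν : Measure X) (A : ℕ → Set X) (B : Set X) (L : ℕ)
    (u : Fin L → Γ) : 0 ≤ guessError ν A B L u :=
  Real.iInf_nonneg fun _ => measureReal_nonneg

lemma guessError_le [SMul Γ X] (ν : Measure X) (A : ℕ → Set X) (B : Set X) (L : ℕ)
    (u : Fin L → Γ) (S : Set (Fin L → Fin L → Bool)) :
    guessError ν A B L u ≤ ν.real (symmDiff (itinerary u (memLabels A L) ⁻¹' S) B) :=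
  ciInf_le (finite_range _).bddBelow S

lemma abs_guessError_le_one [SMul Γ X] (ν : Measure X) [IsProbabilityMeasure ν] (A : ℕ → Set X)
    (B : Set X) (L : ℕ) (u : Fin L → Γ) : |guessError ν A B L u| ≤ 1 := by
  rw [abs_of_nonneg (guessError_nonneg ν A B L u)]
  exact (guessError_le ν A B L u ∅).trans measureReal_le_one

lemma tendsto_guessError [PseudoMetricSpace X] [StandardBorelSpace X] [Monoid Γ] [MulAction Γ X]
    [MeasurableConstSMul Γ X] (ν : Measure X) [IsFiniteMeasure ν]
    (hdist : ∀ x y : X, x ≠ y → ∃ δ > 0, ∀ γ : Γ, δ ≤ dist (γ • x) (γ • y))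
    {A : ℕ → Set X} (hA : ∀ n, MeasurableSet (A n))
    (hdiam : ∀ δ > 0, ∃ n, ∀ x ∈ A n, ∀ y ∈ A n, dist x y < δ)
    {B : Set X} (hB : MeasurableSet B) {w : ℕ → Γ}
    (hw : ∀ᵐ x ∂ν, ∀ n, ∃ k, walk w k • x ∈ A n) :
    Filter.Tendsto (fun L => guessError ν A B L (walkPrefix L w)) Filter.atTop (nhds 0) := by
  classical
  set Z := (toMeasurable ν {x | ∀ n, ∃ k, walk w k • x ∈ A n}ᶜ)ᶜ with hZ
  have hZν : ν Zᶜ = 0 := by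
    rw [hZ, compl_compl, measure_toMeasurable]
    exact hw
  have hZmem : ∀ x ∈ Z, ∀ n, ∃ k, walk w k • x ∈ A n := fun x hx => by
    by_contra h
    exact hx (subset_toMeasurable _ _ h)
  set Φ : X → ℕ × ℕ → Bool := fun x p => decide (walk w p.1 • x ∈ A p.2) with hΦ
  have hΦm : Measurable Φ := measurable_pi_iff.2 fun p =>
    measurable_to_bool (by
      have : (fun x => Φ x p) ⁻¹' {true} = (walk w p.1 • · : X → X) ⁻¹' A p.2 := by
        ext x
        simp [hΦ]
      rw [this]
      exact measurable_const_smul _ (hA _))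
  have hinj : InjOn Φ Z := fun x hx y _ hxy => by
    by_contra hne
    obtain ⟨δ, hδ, hδd⟩ := hdist x y hne
    obtain ⟨n, hn⟩ := hdiam δ hδ
    obtain ⟨k, hk⟩ := hZmem x hx n
    have hk' : walk w k • y ∈ A n := by
      have := congrFun hxy (k, n)
      simpa [hΦ, hk] using this
    exact (hn _ hk _ hk').not_ge (hδd _)
  rw [Metric.tendsto_atTop]
  intro ε hε
  obtain ⟨s, S, hs⟩ := exists_cylinder_symmDiff_lt ν hΦm
    (measurableSet_toMeasurable _ _).compl hZν hinj hB (ENNReal.ofReal_pos.2 hε)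
  refine ⟨s.sup (fun p => max p.1 p.2) + 1, fun L hL => ?_⟩
  have hlt : ∀ p ∈ s, p.1 < L ∧ p.2 < L := fun p hp => by
    have := Finset.le_sup (f := fun p : ℕ × ℕ => max p.1 p.2) hp
    grind
  have hle := guessError_le ν A B L (walkPrefix L w)
    {j | (fun p : s => j ⟨p.1.1, (hlt p.1 p.2).1⟩ ⟨p.1.2, (hlt p.1 p.2).2⟩) ∈ S}
  have heq : itinerary (walkPrefix L w) (memLabels A L) ⁻¹'
      {j | (fun p : s => j ⟨p.1.1, (hlt p.1 p.2).1⟩ ⟨p.1.2, (hlt p.1 p.2).2⟩) ∈ S} =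
      Φ ⁻¹' cylinder s S := by
    ext x
    simp [itinerary, walkPrefix, memLabels, hΦ, cylinder, Finset.restrict_def]
    convert Iff.rfl
    exact decide_eq_decide.2 Iff.rfl
  rw [heq] at hle
  rw [Real.dist_eq, sub_zero, abs_of_nonneg (guessError_nonneg _ _ _ _ _)]
  exact hle.trans_lt ((ENNReal.lt_ofReal_iff_toReal_lt (measure_ne_top _ _)).1 hs)

end Approximation

section Nonatomic

lemma measureReal_singleton_mul_le_integral {Γ : Type*} [MeasurableSpace Γ]
    [MeasurableSingletonClass Γ] (μ : Measure Γ) {F : Γ → ℝ} (hF : Integrable F μ)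
    (h0 : ∀ γ, 0 ≤ F γ) (γ : Γ) : μ.real {γ} * F γ ≤ ∫ γ', F γ' ∂μ := by
  have := setIntegral_le_integral (s := {γ}) hF (.of_forall h0)
  rwa [integral_singleton, smul_eq_mul] at this

lemma exists_ball_binEntropy_lt {X : Type*} [PseudoMetricSpace X] [MeasurableSpace X]
    [OpensMeasurableSpace X] (ν : Measure X) [IsFiniteMeasure ν] [ν.OuterRegular] {x : X}
    (hx : ν {x} = 0) {η ρ : ℝ} (hη : 0 < η) (hρ : 0 < ρ) :
    ∃ r, 0 < r ∧ r ≤ ρ ∧ Real.binEntropy (ν.real (Metric.ball x r)) < η := by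
  have hc : Filter.Tendsto Real.binEntropy (nhds 0) (nhds 0) := by
    simpa using Real.binEntropy_continuous.tendsto 0
  obtain ⟨δ, hδ, h⟩ := Metric.tendsto_nhds_nhds.1 hc η hη
  obtain ⟨U, hxU, hU, hUδ⟩ := Set.exists_isOpen_lt_of_lt {x} (ENNReal.ofReal δ)
    (by rw [hx]; exact ENNReal.ofReal_pos.2 hδ)
  obtain ⟨r, hr, hrU⟩ := Metric.isOpen_iff.1 hU x (hxU rfl)
  refine ⟨min r ρ, lt_min hr hρ, min_le_right _ _, ?_⟩
  have hlt : ν.real (Metric.ball x (min r ρ)) < δ :=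
    (ENNReal.lt_ofReal_iff_toReal_lt (measure_ne_top _ _)).1
      ((measure_mono ((Metric.ball_subset_ball (min_le_left _ _)).trans hrU)).trans_lt hUδ)
  have := h (x := ν.real (Metric.ball x (min r ρ)))
    (by rwa [Real.dist_eq, sub_zero, abs_of_nonneg measureReal_nonneg])
  rw [Real.dist_eq, sub_zero] at this
  exact (le_abs_self _).trans_lt this

variable {X Γ : Type*} [MeasurableSpace X] [Group Γ] [MulAction Γ X] [MeasurableSpace Γ]
  [DiscreteMeasurableSpace Γ] [Countable Γ]

lemma IsStationaryFor.measureReal_singleton_mul_le [MeasurableConstSMul Γ X] {μ : Measure Γ}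
    [IsProbabilityMeasure μ] {ν : Measure X} [IsProbabilityMeasure ν] (hν : IsStationaryFor μ ν)
    (γ : Γ) {B : Set X} (hB : MeasurableSet B) :
    μ.real {γ} * ν.real ((γ • · : X → X) ⁻¹' B) ≤ ν.real B := by
  rw [hν B hB]
  exact measureReal_singleton_mul_le_integral μ (F := fun γ => ν.real ((γ • · : X → X) ⁻¹' B))
    (integrable_of_discrete_of_bound μ 1 fun γ => by
      rw [abs_of_nonneg measureReal_nonneg]; exact measureReal_le_one)
    (fun _ => measureReal_nonneg) γ

lemma IsStationaryFor.abs_measureReal_preimage_smul_sub_le [MeasurableConstSMul Γ X]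
    {μ : Measure Γ} [IsProbabilityMeasure μ] {ν : Measure X} [IsProbabilityMeasure ν]
    (hν : IsStationaryFor μ ν) {γ : Γ} (hγ : 0 < μ.real {γ}) {A : ℕ → Set X}
    (hA : ∀ n, MeasurableSet (A n)) {B : Set X} (hB : MeasurableSet B) {L : ℕ} (u : Fin L → Γ) :
    |ν.real ((γ • · : X → X) ⁻¹' B) - ν.real B| ≤
      labelShift ν (itinerary u (memLabels A L)) (γ • · : X → X) +
        (1 + (μ.real {γ})⁻¹) * guessError ν A B L u := by
  obtain ⟨S, hS⟩ := exists_guessError_eq ν A B L u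
  have hms := measurableSet_itinerary_preimage (X := X) u (measurableSet_memLabels_preimage hA L)
  set R := itinerary u (memLabels A L) (X := X) with hR
  have hRS : MeasurableSet (R ⁻¹' S) := by
    rw [← biUnion_preimage_singleton]
    exact MeasurableSet.biUnion S.to_countable fun i _ => hms i
  have h1 := abs_measureReal_preimage_sub_le_labelShift ν hms (measurable_const_smul γ) S
  have h2 := abs_measureReal_sub_le_measureReal_symmDiff (μ := ν)
    hRS.nullMeasurableSet hB.nullMeasurableSet
  have h3 := abs_measureReal_sub_le_measureReal_symmDiff (μ := ν)
    (measurable_const_smul γ hRS).nullMeasurableSet (measurable_const_smul γ hB).nullMeasurableSet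
  have h4 := hν.measureReal_singleton_mul_le γ (hRS.symmDiff hB)
  rw [mul_comm, ← le_div_iff₀ hγ, hS, div_eq_inv_mul] at h4
  rw [hS] at h2
  have h5 := h3.trans h4
  rw [abs_le] at *
  constructor <;> linarith [h1.1, h1.2, h2.1, h2.2, h5.1, h5.2]

end Nonatomic

section Minimal

variable {X Γ : Type*} [MetricSpace X] [CompactSpace X] [MeasurableSpace X] [BorelSpace X]
  [Group Γ] [MulAction Γ X] [ContinuousConstSMul Γ X] [MulAction.IsMinimal Γ X]
  [MeasurableSpace Γ] [DiscreteMeasurableSpace Γ] [Countable Γ]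

/-- On a minimal distal system, a stationary measure which does not charge some point is
invariant. -/
lemma IsStationaryFor.measureReal_preimage_smul_of_measure_singleton_eq_zero
    (hdist : ∀ x y : X, x ≠ y → ∃ δ > 0, ∀ γ : Γ, δ ≤ dist (γ • x) (γ • y))
    {μ : Measure Γ} [IsProbabilityMeasure μ] (hμ : ∀ γ, μ {γ} ≠ 0) {ν : Measure X}
    [IsProbabilityMeasure ν] (hν : IsStationaryFor μ ν) {x : X} (hx : ν {x} = 0) (γ : Γ)
    {B : Set X} (hB : MeasurableSet B) :
    ν.real ((γ • · : X → X) ⁻¹' B) = ν.real B := by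
  set P : Measure (ℕ → Γ) := Measure.infinitePi fun _ : ℕ => μ with hP
  set m := μ.real {γ} with hm
  have hm0 : 0 < m := ENNReal.toReal_pos (hμ γ) (measure_ne_top _ _)
  set c := 1 + m⁻¹ with hc
  set d := |ν.real ((γ • · : X → X) ⁻¹' B) - ν.real B| with hd
  have key : ∀ ε > 0, d ^ 2 ≤ 8 * ε / m := fun ε hε => by
    choose r hr0 hr1 hrε using fun n : ℕ => exists_ball_binEntropy_lt ν hx
      (η := ε * (1 / 2) ^ (n + 1)) (ρ := 1 / (n + 1)) (by positivity) (by positivity)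
    set A : ℕ → Set X := fun n => Metric.ball x (r n) with hA
    have hAo : ∀ n, IsOpen (A n) := fun n => Metric.isOpen_ball
    have hAm : ∀ n, MeasurableSet (A n) := fun n => (hAo n).measurableSet
    have hdiam : ∀ δ > 0, ∃ n, ∀ y ∈ A n, ∀ z ∈ A n, dist y z < δ := fun δ hδ => by
      obtain ⟨n, hn⟩ := exists_nat_one_div_lt (half_pos hδ)
      refine ⟨n, fun y hy z hz => ?_⟩
      have h1 := Metric.mem_ball.1 hy
      have h2 := Metric.mem_ball.1 hz
      have h3 := dist_triangle_right y z x
      linarith [hr1 n]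
    have hae : ∀ᵐ w ∂P, Filter.Tendsto (fun L => guessError ν A B L (walkPrefix L w))
        Filter.atTop (nhds 0) := by
      filter_upwards [ae_ae_forall_exists_walk_smul_mem hμ ν hAo
        fun n => ⟨x, Metric.mem_ball_self (hr0 n)⟩] with w hw
      exact tendsto_guessError ν hdist hAm hdiam hB hw
    have hgint : ∀ L, Integrable (fun w => guessError ν A B L (walkPrefix L w)) P := fun L =>
      integrable_of_walkPrefix P _ 1 (abs_guessError_le_one ν A B L)
    have hlim : Filter.Tendsto (fun L => ∫ w, guessError ν A B L (walkPrefix L w) ∂P)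
        Filter.atTop (nhds 0) := by
      have := tendsto_integral_of_dominated_convergence (μ := P) (f := fun _ => (0 : ℝ))
        (fun _ => 1) (fun L => (hgint L).aestronglyMeasurable) (integrable_const _)
        (fun L => .of_forall fun w => abs_guessError_le_one ν A B L _) hae
      simpa using this
    have hent : ∀ L, labelEntropy ν (memLabels A L) ≤ ε := fun L => by
      classical
      have h1 : ∑ n ∈ Finset.range L, (1 / 2 : ℝ) ^ (n + 1) ≤ 1 := by
        have : ∀ L : ℕ, ∑ n ∈ Finset.range L, (1 / 2 : ℝ) ^ (n + 1) = 1 - (1 / 2) ^ L := fun L => by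
          induction L with
          | zero => simp
          | succ L ih => rw [Finset.sum_range_succ, ih]; ring
        rw [this]
        have : (0 : ℝ) ≤ (1 / 2) ^ L := by positivity
        linarith
      calc labelEntropy ν (memLabels A L)
          ≤ ∑ n ∈ Finset.range L, Real.binEntropy (ν.real (A n)) :=
            labelEntropy_indicators_le ν L hAm
        _ ≤ ∑ n ∈ Finset.range L, ε * (1 / 2) ^ (n + 1) :=
            Finset.sum_le_sum fun n _ => (hrε n).le
        _ ≤ ε := by
            rw [← Finset.mul_sum]
            exact mul_le_of_le_one_right hε.le h1
    set D : (L : ℕ) → (ℕ → Γ) → ℝ := fun L w =>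
      labelShift ν (itinerary (walkPrefix L w) (memLabels A L)) (γ • · : X → X) with hD
    have hms := fun (L : ℕ) (u : Fin L → Γ) =>
      measurableSet_itinerary_preimage (X := X) u (measurableSet_memLabels_preimage hAm L)
    have hsq : ∀ (L : ℕ) (u : Fin L → Γ) (γ : Γ),
        |labelShift ν (itinerary u (memLabels A L)) (γ • · : X → X) ^ 2| ≤ 4 := fun L u γ =>
      labelShift_sq_le_four ν (hms L u) (measurable_const_smul γ)
    have hDint : ∀ L, Integrable (fun w => D L w ^ 2) P := fun L =>
      integrable_of_walkPrefix P (fun u => labelShift ν (itinerary u (memLabels A L))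
        (γ • · : X → X) ^ 2) 4 fun u => hsq L u γ
    have hD2 : ∀ L, ∫ w, D L w ^ 2 ∂P ≤ 4 * ε / m := fun L => by
      rw [le_div_iff₀ hm0, mul_comm, ← integral_const_mul]
      refine le_trans (integral_mono ((hDint L).const_mul m)
        (integrable_of_walkPrefix P (fun u => ∫ γ,
          labelShift ν (itinerary u (memLabels A L)) (γ • · : X → X) ^ 2 ∂μ) 4 fun u => by
          simpa using norm_integral_le_of_norm_le_const (μ := μ) (C := 4)
            (f := fun γ => labelShift ν (itinerary u (memLabels A L)) (γ • · : X → X) ^ 2)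
            (Filter.Eventually.of_forall fun γ => hsq L u γ)) fun w => ?_)
        ((integral_integral_labelShift_sq_le μ hν
          (measurableSet_memLabels_preimage hAm L) L).trans ?_)
      · exact measureReal_singleton_mul_le_integral μ (F := fun γ =>
          labelShift ν (itinerary (walkPrefix L w) (memLabels A L)) (γ • · : X → X) ^ 2)
          (integrable_of_discrete_of_bound μ 4 fun γ => hsq L _ γ) (fun _ => sq_nonneg _) γ
      · linarith [hent L]
    have hbound : ∀ L, d ^ 2 ≤ 8 * ε / m +
        2 * c ^ 2 * ∫ w, guessError ν A B L (walkPrefix L w) ∂P := fun L => by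
      have hpt : ∀ w, d ^ 2 ≤ 2 * D L w ^ 2 +
          2 * c ^ 2 * guessError ν A B L (walkPrefix L w) := fun w => by
        have h1 := hν.abs_measureReal_preimage_smul_sub_le hm0 hAm hB (walkPrefix L w)
        have h2 := guessError_nonneg ν A B L (walkPrefix L w)
        have h3 := (abs_le.1 (abs_guessError_le_one ν A B L (walkPrefix L w))).2
        set h := guessError ν A B L (walkPrefix L w)
        have h4 : d ^ 2 ≤ (D L w + c * h) ^ 2 := pow_le_pow_left₀ (abs_nonneg _) h1 2
        have h5 : c ^ 2 * h ^ 2 ≤ c ^ 2 * h :=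
          mul_le_mul_of_nonneg_left (by nlinarith) (sq_nonneg c)
        nlinarith [sq_nonneg (D L w - c * h)]
      have h_int := integral_mono (integrable_const (μ := P) (d ^ 2))
        (((hDint L).const_mul 2).add ((hgint L).const_mul (2 * c ^ 2))) hpt
      have hadd := integral_add ((hDint L).const_mul 2) ((hgint L).const_mul (2 * c ^ 2))
      rw [integral_const, probReal_univ, one_smul] at h_int
      rw [integral_const_mul, integral_const_mul] at hadd
      refine (h_int.trans_eq hadd).trans ?_
      have : 8 * ε / m = 2 * (4 * ε / m) := by ring
      linarith [hD2 L]
    have := ge_of_tendsto' ((hlim.const_mul (2 * c ^ 2)).const_add (8 * ε / m)) hbound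
    simpa using this
  have hd0 : d ^ 2 ≤ 0 := by
    refine le_of_forall_pos_le_add fun η hη => ?_
    have := key (η * m / 8) (by positivity)
    have h2 : 8 * (η * m / 8) / m = η := by field_simp
    linarith
  have : d = 0 := by nlinarith [abs_nonneg (ν.real ((γ • · : X → X) ⁻¹' B) - ν.real B)]
  exact sub_eq_zero.1 (abs_eq_zero.1 this)

end Minimal

section Stationary

variable {X Γ : Type*} [MetricSpace X] [MeasurableSpace X] [BorelSpace X] [SMul Γ X]
  [ContinuousConstSMul Γ X] [MeasurableSpace Γ] [DiscreteMeasurableSpace Γ] [Countable Γ]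

lemma measurable_uncurry_smul : Measurable fun p : Γ × X => p.1 • p.2 :=
  measurable_from_prod_countable_right fun γ => measurable_const_smul γ

/-- The distribution of a `ν`-random point moved by an independent `μ`-random element. -/
noncomputable def convolve (μ : Measure Γ) (ν : Measure X) : Measure X :=
  (μ.prod ν).map fun p => p.1 • p.2

instance (μ : Measure Γ) (ν : Measure X) [IsProbabilityMeasure μ] [IsProbabilityMeasure ν] :
    IsProbabilityMeasure (convolve μ ν) :=
  Measure.isProbabilityMeasure_map measurable_uncurry_smul.aemeasurable

lemma isStationaryFor_of_convolve_eq {μ : Measure Γ} {ν : Measure X} [IsProbabilityMeasure μ]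
    [IsProbabilityMeasure ν] (h : convolve μ ν = ν) : IsStationaryFor μ ν := fun B hB => by
  have h1 : ν B = ∫⁻ γ, ν ((γ • · : X → X) ⁻¹' B) ∂μ := by
    conv_lhs => rw [← h]
    rw [convolve, Measure.map_apply measurable_uncurry_smul hB,
      Measure.prod_apply (measurable_uncurry_smul hB)]
    rfl
  rw [measureReal_def, h1, ← integral_toReal (Measurable.of_discrete).aemeasurable
    (.of_forall fun γ => measure_lt_top _ _)]
  rfl

open BoundedContinuousFunction in
/-- The average of `f` over one step of the random walk. -/
noncomputable def stepAverage (μ : Measure Γ) [IsProbabilityMeasure μ] (f : X →ᵇ ℝ) : X →ᵇ ℝ :=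
  BoundedContinuousFunction.ofNormedAddCommGroup (fun x => ∫ γ, f ((γ : Γ) • x) ∂μ)
    (continuous_of_dominated (bound := fun _ => ‖f‖)
      (fun _ => (Measurable.of_discrete).aestronglyMeasurable)
      (fun _ => .of_forall fun _ => f.norm_coe_le_norm _) (integrable_const _)
      (.of_forall fun γ => f.continuous.comp (continuous_const_smul γ))) ‖f‖ fun x => by
        simpa using norm_integral_le_of_norm_le_const (μ := μ) (C := ‖f‖)
          (f := fun γ : Γ => f (γ • x)) (.of_forall fun γ => f.norm_coe_le_norm _)

open BoundedContinuousFunction in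
lemma integral_convolve (μ : Measure Γ) [IsProbabilityMeasure μ] (ν : Measure X)
    [IsProbabilityMeasure ν] (f : X →ᵇ ℝ) :
    ∫ x, f x ∂(convolve μ ν) = ∫ x, stepAverage μ f x ∂ν := by
  rw [convolve, integral_map measurable_uncurry_smul.aemeasurable
    f.continuous.measurable.aestronglyMeasurable]
  exact integral_prod_symm _ (Integrable.of_bound
    (f.continuous.measurable.comp measurable_uncurry_smul).aestronglyMeasurable ‖f‖
    (.of_forall fun p => f.norm_coe_le_norm _))

end Stationary

/-- The average of the first `n + 1` terms of a sequence of probability measures. -/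
noncomputable def cesaro {X : Type*} [MeasurableSpace X] (m : ℕ → Measure X) (n : ℕ) : Measure X :=
  ((n + 1 : ℕ) : ENNReal)⁻¹ • ∑ k ∈ Finset.range (n + 1), m k

instance {X : Type*} [MeasurableSpace X] (m : ℕ → Measure X) [∀ k, IsProbabilityMeasure (m k)]
    (n : ℕ) : IsProbabilityMeasure (cesaro m n) :=
  ⟨by
    simp only [cesaro, Measure.smul_apply, Measure.finsetSum_apply, measure_univ, smul_eq_mul,
      Finset.sum_const, Finset.card_range, nsmul_eq_mul, mul_one]
    exact ENNReal.inv_mul_cancel (by simp) (ENNReal.natCast_ne_top _)⟩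

lemma integral_cesaro {X : Type*} [MeasurableSpace X] (m : ℕ → Measure X) (n : ℕ) {f : X → ℝ}
    (hf : ∀ k, Integrable f (m k)) :
    ∫ x, f x ∂(cesaro m n) = (n + 1 : ℝ)⁻¹ * ∑ k ∈ Finset.range (n + 1), ∫ x, f x ∂(m k) := by
  rw [cesaro, integral_smul_measure, integral_finsetSum_measure fun k _ => hf k]
  rw [ENNReal.toReal_inv, ENNReal.toReal_natCast, smul_eq_mul]
  push_cast
  rfl

open BoundedContinuousFunction in
lemma exists_isStationaryFor {X Γ : Type*} [MetricSpace X] [CompactSpace X] [Nonempty X]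
    [MeasurableSpace X] [BorelSpace X] [SMul Γ X] [ContinuousConstSMul Γ X] [MeasurableSpace Γ]
    [DiscreteMeasurableSpace Γ] [Countable Γ] (μ : Measure Γ) [IsProbabilityMeasure μ] :
    ∃ ν : Measure X, IsProbabilityMeasure ν ∧ IsStationaryFor μ ν := by
  obtain ⟨x₀⟩ := ‹Nonempty X›
  set m : ℕ → Measure X := fun k => (convolve μ)^[k] (Measure.dirac x₀) with hm
  have hsucc : ∀ k, m (k + 1) = convolve μ (m k) := fun k => Function.iterate_succ_apply' _ _ _
  have hprob : ∀ k, IsProbabilityMeasure (m k) := fun k => by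
    induction k with
    | zero => exact Measure.dirac.isProbabilityMeasure
    | succ k ih => rw [hsucc]; infer_instance
  set a : ℕ → ProbabilityMeasure X := fun n => ⟨cesaro m n, inferInstance⟩ with ha
  obtain ⟨ν, -, hν⟩ := isCompact_univ.ultrafilter_le_nhds
    ((Filter.hyperfilter ℕ).map a) (by simp)
  have hlim := ProbabilityMeasure.tendsto_iff_forall_integral_tendsto.1
    (show Filter.Tendsto a (Filter.hyperfilter ℕ : Filter ℕ) (nhds ν) from hν)
  refine ⟨ν, inferInstance, isStationaryFor_of_convolve_eq
    (ext_of_forall_integral_eq_of_IsFiniteMeasure fun f => ?_)⟩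
  rw [integral_convolve]
  have h_int : ∀ (g : X →ᵇ ℝ) k, Integrable g (m k) := fun g k => g.integrable (m k)
  have hdiff : ∀ n, |∫ x, stepAverage μ f x ∂(cesaro m n) - ∫ x, f x ∂(cesaro m n)|
      ≤ 2 * ‖f‖ * (1 / ((n : ℝ) + 1)) := fun n => by
    rw [integral_cesaro m n (h_int _), integral_cesaro m n (h_int f), ← mul_sub,
      ← Finset.sum_sub_distrib]
    simp_rw [← integral_convolve, ← hsucc]
    rw [Finset.sum_range_sub (fun k => ∫ x, f x ∂(m k)), abs_mul,
      abs_of_nonneg (by positivity : (0 : ℝ) ≤ (n + 1 : ℝ)⁻¹), one_div, mul_comm]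
    refine mul_le_mul_of_nonneg_right ?_ (by positivity)
    have hb : ∀ k, |∫ x, f x ∂(m k)| ≤ ‖f‖ := fun k => f.norm_integral_le_norm (m k)
    exact (abs_sub _ _).trans (by linarith [hb (n + 1), hb 0])
  have h0 : Filter.Tendsto (fun n : ℕ => 2 * ‖f‖ * (1 / ((n : ℝ) + 1)))
      (Filter.hyperfilter ℕ : Filter ℕ) (nhds 0) := by
    have := (tendsto_one_div_add_atTop_nhds_zero_nat (𝕜 := ℝ)).const_mul (2 * ‖f‖)
    rw [mul_zero] at this
    exact this.mono_left Nat.hyperfilter_le_atTop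
  have h1 := squeeze_zero_norm (f := fun n => ∫ x, stepAverage μ f x ∂(cesaro m n) - ∫ x, f x ∂(cesaro m n))
    hdiff h0
  exact sub_eq_zero.1 (tendsto_nhds_unique ((hlim (stepAverage μ f)).sub (hlim f)) h1)

section Invariant

/-- If a stationary measure charges every point of a minimal system, then it is invariant. -/
lemma IsStationaryFor.map_smul_eq_of_measure_singleton_ne_zero {X Γ : Type*} [TopologicalSpace X]
    [T1Space X] [MeasurableSpace X] [BorelSpace X] [Nonempty X] [Group Γ] [MulAction Γ X]
    [ContinuousConstSMul Γ X] [MulAction.IsMinimal Γ X] [MeasurableSpace Γ]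
    [DiscreteMeasurableSpace Γ] [Countable Γ] {μ : Measure Γ} [IsProbabilityMeasure μ]
    (hμ : ∀ γ, μ {γ} ≠ 0) {ν : Measure X} [IsProbabilityMeasure ν] (hν : IsStationaryFor μ ν)
    (hpos : ∀ x, ν {x} ≠ 0) (γ : Γ) : ν.map (γ • · : X → X) = ν := by
  have hfin : ∀ x, {y | ν {x} ≤ ν {y}}.Finite := fun x =>
    Measure.finite_const_le_meas_of_disjoint_iUnion ν (pos_iff_ne_zero.2 (hpos x))
      (fun y => measurableSet_singleton y) (fun y z hyz => by simpa using hyz)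
      (measure_ne_top _ _)
  obtain ⟨x₀, hx₀⟩ : ∃ x₀, ∀ y, ν {y} ≤ ν {x₀} := by
    obtain ⟨x⟩ := ‹Nonempty X›
    obtain ⟨x₀, h, hmax⟩ := (hfin x).exists_maximalFor (fun y => ν {y}) _ ⟨x, le_refl (ν {x})⟩
    refine ⟨x₀, fun y => ?_⟩
    by_contra! hlt
    exact (hmax (h.trans hlt.le) hlt.le).not_gt hlt
  have hle : ∀ y, ν.real {y} ≤ ν.real {x₀} := fun y =>
    ENNReal.toReal_mono (measure_ne_top _ _) (hx₀ y)
  have hpre : ∀ (γ : Γ) y, (γ • · : X → X) ⁻¹' {y} = {γ⁻¹ • y} := fun γ y => by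
    ext z
    simp [eq_inv_smul_iff]
  set F := {y | ν.real {x₀} ≤ ν.real {y}} with hF
  have hFinv : ∀ (γ : Γ), ∀ y ∈ F, γ⁻¹ • y ∈ F := fun γ y hy => by
    have h1 := hν {y} (measurableSet_singleton y)
    have h_int : Integrable (fun γ : Γ => ν.real ((γ • · : X → X) ⁻¹' {y})) μ :=
      integrable_of_discrete_of_bound μ 1 fun γ => by
        rw [abs_of_nonneg measureReal_nonneg]; exact measureReal_le_one
    have h2 := measureReal_singleton_mul_le_integral μ
      (F := fun γ : Γ => ν.real {x₀} - ν.real ((γ • · : X → X) ⁻¹' {y}))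
      ((integrable_const _).sub h_int) (fun γ => by rw [hpre]; exact sub_nonneg.2 (hle _)) γ
    rw [integral_sub (integrable_const _) h_int, integral_const, probReal_univ, one_smul, ← h1,
      hpre] at h2
    have h3 : 0 < μ.real {γ} := ENNReal.toReal_pos (hμ γ) (measure_ne_top _ _)
    have h4 : ν.real {x₀} ≤ ν.real {y} := hy
    change ν.real {x₀} ≤ ν.real {γ⁻¹ • y}
    nlinarith
  have hFfin : F.Finite := (hfin x₀).subset fun y hy =>
    (ENNReal.toReal_le_toReal (measure_ne_top _ _) (measure_ne_top _ _)).1 hy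
  have hFuniv : F = univ :=
    (eq_empty_or_univ_of_smul_invariant_closed Γ hFfin.isClosed
      fun γ => by
        rintro _ ⟨y, hy, rfl⟩
        simpa using hFinv γ⁻¹ y hy).resolve_left
      (Set.nonempty_iff_ne_empty.1 ⟨x₀, le_refl (ν.real {x₀})⟩)
  have hcard : ∀ y, ν {y} = ν {x₀} := fun y => by
    have : y ∈ F := hFuniv ▸ mem_univ y
    exact le_antisymm (hx₀ y)
      ((ENNReal.toReal_le_toReal (measure_ne_top _ _) (measure_ne_top _ _)).1 this)
  have : Countable X := countable_univ_iff.1 (hFuniv ▸ hFfin).countable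
  refine Measure.ext_of_singleton fun y => ?_
  rw [Measure.map_apply (measurable_const_smul γ) (measurableSet_singleton y), hpre, hcard, hcard y]

lemma exists_isProbabilityMeasure_forall_singleton_ne_zero (Γ : Type*) [Countable Γ] [Nonempty Γ]
    [MeasurableSpace Γ] [MeasurableSingletonClass Γ] :
    ∃ μ : Measure Γ, IsProbabilityMeasure μ ∧ ∀ γ, μ {γ} ≠ 0 :=
  ⟨Measure.count.toFinite, inferInstance, fun γ => by simp⟩

/-- A minimal distal action of a countable group on a compact metric space has an invariant
probability measure. -/
lemma exists_map_smul_eq_of_isMinimal {X Γ : Type*} [MetricSpace X] [CompactSpace X]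
    [MeasurableSpace X] [BorelSpace X] [Nonempty X] [Group Γ] [Countable Γ] [MulAction Γ X]
    [ContinuousConstSMul Γ X] [MulAction.IsMinimal Γ X]
    (hdist : ∀ x y : X, x ≠ y → ∃ δ > 0, ∀ γ : Γ, δ ≤ dist (γ • x) (γ • y)) :
    ∃ ν : Measure X, IsProbabilityMeasure ν ∧ ∀ γ : Γ, ν.map (γ • · : X → X) = ν := by
  let : MeasurableSpace Γ := ⊤
  have : DiscreteMeasurableSpace Γ := ⟨fun _ => trivial⟩
  obtain ⟨μ, hμp, hμ⟩ := exists_isProbabilityMeasure_forall_singleton_ne_zero Γ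
  obtain ⟨ν, hνp, hν⟩ := exists_isStationaryFor (X := X) μ
  refine ⟨ν, hνp, fun γ => ?_⟩
  by_cases h : ∃ x, ν {x} = 0
  · obtain ⟨x, hx⟩ := h
    ext B hB
    rw [Measure.map_apply (measurable_const_smul γ) hB]
    exact (measureReal_eq_measureReal_iff).1
      (hν.measureReal_preimage_smul_of_measure_singleton_eq_zero hdist hμ hx γ hB)
  · push Not at h
    exact hν.map_smul_eq_of_measure_singleton_ne_zero hμ h γ

end Invariant

/-- Every nonempty closed invariant subset of a compact system contains a minimal one. -/
lemma exists_minimal_isClosed_smul_mem {E Γ : Type*} [TopologicalSpace E] [CompactSpace E]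
    [SMul Γ E] {C : Set E} (hC : IsClosed C) (hne : C.Nonempty)
    (hinv : ∀ γ : Γ, ∀ x ∈ C, γ • x ∈ C) :
    ∃ Z ⊆ C, Minimal (fun Z => IsClosed Z ∧ Z.Nonempty ∧ ∀ γ : Γ, ∀ x ∈ Z, γ • x ∈ Z) Z := by
  refine zorn_superset_nonempty {Z | IsClosed Z ∧ Z.Nonempty ∧ ∀ γ : Γ, ∀ x ∈ Z, γ • x ∈ Z}
    (fun c hc hchain hcne => ⟨⋂₀ c, ⟨isClosed_sInter fun s hs => (hc hs).1, ?_, ?_⟩,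
      fun s hs => sInter_subset_of_mem hs⟩) C ⟨hC, hne, hinv⟩
  · have := hcne.to_subtype
    exact IsCompact.nonempty_sInter_of_directed_nonempty_isCompact_isClosed
      (fun s hs t ht => (hchain.total hs ht).elim (fun h => ⟨s, hs, subset_rfl, h⟩)
        fun h => ⟨t, ht, h, subset_rfl⟩) (fun s hs => (hc hs).2.1) (fun s hs => (hc hs).1.isCompact)
      (fun s hs => (hc hs).1)
  · exact fun γ x hx s hs => (hc hs).2.2 γ x (hx s hs)

/-- Every nonempty closed invariant subset of a distal compact metric system carries an invariant
probability measure. -/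
lemma exists_map_smul_eq_of_isClosed {E Γ : Type*} [MetricSpace E] [CompactSpace E]
    [MeasurableSpace E] [BorelSpace E] [Group Γ] [Countable Γ] [MulAction Γ E]
    [ContinuousConstSMul Γ E]
    (hdist : ∀ x y : E, x ≠ y → ∃ δ > 0, ∀ γ : Γ, δ ≤ dist (γ • x) (γ • y))
    {C : Set E} (hC : IsClosed C) (hne : C.Nonempty) (hinv : ∀ γ : Γ, ∀ x ∈ C, γ • x ∈ C) :
    ∃ ν : Measure E, IsProbabilityMeasure ν ∧ (∀ γ : Γ, ν.map (γ • · : E → E) = ν) ∧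
      ν Cᶜ = 0 := by
  obtain ⟨Z, hZC, ⟨hZ, hZne, hZinv⟩, hmin⟩ := exists_minimal_isClosed_smul_mem hC hne hinv
  let W : SubMulAction Γ E := ⟨Z, fun γ {x} hx => hZinv γ x hx⟩
  have : CompactSpace W := isCompact_iff_compactSpace.1 hZ.isCompact
  have : Nonempty W := hZne.to_subtype
  have : ContinuousConstSMul Γ W :=
    ⟨fun γ => Continuous.subtype_mk ((continuous_const_smul γ).comp continuous_subtype_val) _⟩
  have : MulAction.IsMinimal Γ W := by
    refine (isMinimal_iff_isClosed_smul_invariant Γ).2 fun s hs hsinv => ?_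
    refine s.eq_empty_or_nonempty.imp_right fun hsne => ?_
    have hsub := hmin (y := (↑) '' s)
      ⟨(hZ.isClosedEmbedding_subtypeVal).isClosedMap s hs, hsne.image _, ?_⟩ ?_
    · refine eq_univ_of_forall fun x => ?_
      obtain ⟨y, hy, hyx⟩ := hsub x.2
      rwa [← Subtype.ext hyx]
    · rintro γ _ ⟨x, hx, rfl⟩
      exact ⟨γ • x, hsinv γ ⟨x, hx, rfl⟩, rfl⟩
    · rintro _ ⟨x, -, rfl⟩
      exact x.2
  have : BorelSpace W := inferInstanceAs (BorelSpace Z)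
  obtain ⟨ν, hν, hmap⟩ := exists_map_smul_eq_of_isMinimal (X := W) (Γ := Γ) fun x y hxy =>
    hdist x y (Subtype.coe_ne_coe.2 hxy)
  have hval : Measurable ((↑) : W → E) := measurable_subtype_coe
  refine ⟨ν.map (↑), Measure.isProbabilityMeasure_map hval.aemeasurable, fun γ => ?_, ?_⟩
  · conv_rhs => rw [← hmap γ]
    rw [Measure.map_map (measurable_const_smul γ) hval,
      Measure.map_map hval (measurable_const_smul γ)]
    rfl
  · rw [Measure.map_apply hval hC.measurableSet.compl]
    convert measure_empty (μ := ν)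
    exact eq_empty_of_forall_notMem fun x hx => hx (hZC x.2)

/-- For a distal system, any continuous equivariant almost embedding (i.e. a map such
that every (T×T)-invariant probability measure on the fiber product is supported on the
diagonal) is a topological embedding. -/
theorem stmt19 {X Y Γ : Type*}
    [MetricSpace X] [CompactSpace X] [MeasurableSpace X] [BorelSpace X]
    [MetricSpace Y] [CompactSpace Y] [MeasurableSpace Y] [BorelSpace Y]
    [Group Γ] [Countable Γ] (T : Γ → X ≃ₜ X) (S : Γ → Y ≃ₜ Y)
    (hT : ∀ γ γ' : Γ, ∀ x : X, T (γ * γ') x = T γ (T γ' x))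
    (hS : ∀ γ γ' : Γ, ∀ y : Y, S (γ * γ') y = S γ (S γ' y))
    (hdistal : ∀ x₁ x₂ : X, x₁ ≠ x₂ →
      ∀ z ∈ closure {p : X × X | ∃ γ : Γ, p = (T γ x₁, T γ x₂)}, z.1 ≠ z.2)
    (f : X → Y) (hf : Continuous f)
    (hequiv : ∀ γ : Γ, ∀ x : X, f (T γ x) = S γ (f x))
    (halmost : ∀ lam : ProbabilityMeasure (X × X),
      (∀ γ : Γ, (lam : Measure (X × X)).map (fun p => (T γ p.1, T γ p.2)) =
        (lam : Measure (X × X))) →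
      (lam : Measure (X × X)) {p : X × X | f p.1 = f p.2} = 1 →
      (lam : Measure (X × X)) {p : X × X | p.1 = p.2} = 1) :
    Topology.IsEmbedding f := by
  let _ : MulAction Γ X :=
    { smul := fun γ x => T γ x
      one_smul := fun x => (T 1).injective (by
        change T 1 (T 1 x) = T 1 x
        rw [← hT, one_mul])
      mul_smul := hT }
  have : ContinuousConstSMul Γ X := ⟨fun γ => (T γ).continuous⟩
  have hdist : ∀ x y : X, x ≠ y → ∃ δ > 0, ∀ γ : Γ, δ ≤ dist (γ • x) (γ • y) := fun x y hxy => by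
    set K := closure {p : X × X | ∃ γ : Γ, p = (T γ x, T γ y)}
    obtain ⟨p, hp, hmin⟩ := (isClosed_closure.isCompact : IsCompact K).exists_isMinOn
      ⟨_, subset_closure ⟨1, rfl⟩⟩ (continuous_dist.continuousOn)
    exact ⟨dist p.1 p.2, dist_pos.2 (hdistal x y hxy p hp),
      fun γ => hmin (subset_closure ⟨γ, rfl⟩)⟩
  have hdist₂ : ∀ p q : X × X, p ≠ q → ∃ δ > 0, ∀ γ : Γ, δ ≤ dist (γ • p) (γ • q) :=
    fun p q hpq => by
      by_cases h : p.1 = q.1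
      · obtain ⟨δ, hδ, hle⟩ := hdist p.2 q.2 fun h' => hpq (Prod.ext h h')
        exact ⟨δ, hδ, fun γ => (hle γ).trans (le_max_right _ _)⟩
      · obtain ⟨δ, hδ, hle⟩ := hdist p.1 q.1 h
        exact ⟨δ, hδ, fun γ => (hle γ).trans (le_max_left _ _)⟩
  refine (hf.isClosedEmbedding fun x₁ x₂ hx => ?_).isEmbedding
  by_contra hne
  set C := closure {p : X × X | ∃ γ : Γ, p = (T γ x₁, T γ x₂)}
  have hinv : ∀ γ : Γ, ∀ p ∈ C, γ • p ∈ C := fun γ p hp =>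
    map_mem_closure (continuous_const_smul γ) hp (by
      rintro _ ⟨γ', rfl⟩
      exact ⟨γ * γ', by rw [hT, hT]; rfl⟩)
  have hfib : C ⊆ {p : X × X | f p.1 = f p.2} :=
    closure_minimal (by
      rintro _ ⟨γ, rfl⟩
      change f (T γ x₁) = f (T γ x₂)
      rw [hequiv, hequiv, hx])
      (isClosed_eq (hf.comp continuous_fst) (hf.comp continuous_snd))
  obtain ⟨ν, hν, hmap, hmem⟩ := exists_map_smul_eq_of_isClosed hdist₂ (C := C) isClosed_closure
    ⟨_, subset_closure ⟨1, rfl⟩⟩ hinv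
  have hdiag := halmost ⟨ν, hν⟩ hmap ((prob_compl_eq_zero_iff (μ := ν)
    (isClosed_eq (hf.comp continuous_fst) (hf.comp continuous_snd)).measurableSet).1
    (measure_mono_null (compl_subset_compl.2 hfib) hmem))
  have hzero : ν {p : X × X | p.1 = p.2} = 0 :=
    measure_mono_null (t := Cᶜ) (fun p hp hpC => hdistal x₁ x₂ hne p hpC hp) hmem
  exact zero_ne_one (hzero.symm.trans hdiag)
end
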